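/- arXiv:2212.11780 — 3 statements merged into one kernel-verified Lean document; each statement's English description precedes it below -/
import Mathlib

section
/- Let n ≥ 2, let F_n be the free group on e₁,…,e_n, and let 0 ≤ d < 1/16. Let σ be a universal sentence with constants from F_n, i.e. a sentence ∀x̄ φ(x̄,ā) where φ is a finite boolean combination of equations w(x̄,ā) = 1, w a word in the variables x̄ and in fixed elements ā of F_n, interpreted in the random group Γ_ℓ by replacing ā with π_ℓ(ā). Then σ is true in F_n if and only if σ is true with probability tending to 1 as ℓ → ∞ in the random group of density d. -/
open Filter

/-- A boolean combination of equations `w = 1`, where the words `w` range over `α`. -/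
inductive BoolComb (α : Type*) : Type _
  | eq : α → BoolComb α
  | not : BoolComb α → BoolComb α
  | and : BoolComb α → BoolComb α → BoolComb α
  | or : BoolComb α → BoolComb α → BoolComb α

/-- Truth of a boolean combination of equations under an evaluation `ev` of the words
in a group `G`. -/
def BoolComb.Holds {α : Type*} {G : Type*} [Group G] (ev : α → G) : BoolComb α → Prop
  | .eq w => ev w = 1
  | .not φ => ¬ BoolComb.Holds ev φ
  | .and φ ψ => BoolComb.Holds ev φ ∧ BoolComb.Holds ev ψ
  | .or φ ψ => BoolComb.Holds ev φ ∨ BoolComb.Holds ev ψ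

/-- The number of relators `⌊(2n-1)^(dℓ)⌋` at density `d` and length `ℓ`. -/
noncomputable def numRel (n : ℕ) (d : ℝ) (ℓ : ℕ) : ℕ :=
  ⌊(2 * (n : ℝ) - 1) ^ (d * (ℓ : ℝ))⌋₊

/-- The tuples of `N` relators, each a reduced word of length `ℓ` in the free group
on `n` generators. -/
def relTuples (n ℓ N : ℕ) : Set (Fin N → FreeGroup (Fin n)) :=
  {r | ∀ i, ((r i).toWord).length = ℓ}

/-- The random group presented by a tuple `r` of relators: the quotient of the free group
on `n` generators by the normal closure of the relators. -/
abbrev RandGroup {n N : ℕ} (r : Fin N → FreeGroup (Fin n)) : Type :=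
  FreeGroup (Fin n) ⧸ Subgroup.normalClosure (Set.range r)

/-- The canonical quotient map `π : F_n → Γ` onto the random group. -/
def randProj {n N : ℕ} (r : Fin N → FreeGroup (Fin n)) :
    FreeGroup (Fin n) →* RandGroup r :=
  QuotientGroup.mk' _

/-- The probability, for a uniformly random `N`-tuple of reduced relators of length `ℓ`
(chosen uniformly and independently), that property `P` holds. -/
noncomputable def relProb (n ℓ N : ℕ) (P : (Fin N → FreeGroup (Fin n)) → Prop) : ℝ :=
  (Set.ncard {r ∈ relTuples n ℓ N | P r} : ℝ) / (Set.ncard (relTuples n ℓ N) : ℝ)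

/-- `P` holds with overwhelming probability in the random group of density `d`:
the probability tends to `1` as `ℓ → ∞`. -/
def wop (n : ℕ) (d : ℝ) (P : ∀ ℓ : ℕ, (Fin (numRel n d ℓ) → FreeGroup (Fin n)) → Prop) : Prop :=
  Tendsto (fun ℓ => relProb n ℓ (numRel n d ℓ) (P ℓ)) atTop (nhds 1)

/-- A group `G` satisfies the universal sentence `∀ x̄, φ(x̄,ā)` with constants, where `φ`
is a boolean combination of equations `w(x̄,ā) = 1`, `w` a word in the variables
`x̄ = (x₁,…,x_p)` and in constant symbols `ā = (a₁,…,a_m)`, the constants being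
interpreted in `G` by the tuple `c`. -/
def SatAc (G : Type*) [Group G] {p m : ℕ}
    (φ : BoolComb (FreeGroup (Fin p ⊕ Fin m))) (c : Fin m → G) : Prop :=
  ∀ x : Fin p → G, φ.Holds (⇑(FreeGroup.lift (Sum.elim x c)))

section Area

variable {G : Type*} [Group G] {R : Set G}

/-- The products of at most `k` conjugates of elements of `R`. -/
def Area (R : Set G) (k : ℕ) : Set G :=
  {g | ∃ L : List G, L.length ≤ k ∧ (∀ x ∈ L, x ∈ Group.conjugatesOfSet R) ∧ L.prod = g}

theorem Area.one_mem (k : ℕ) : (1 : G) ∈ Area R k := ⟨[], by simp, by simp, rfl⟩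

theorem Area.mono {k l : ℕ} (h : k ≤ l) {g : G} (hg : g ∈ Area R k) : g ∈ Area R l := by
  obtain ⟨L, h1, h2, h3⟩ := hg
  exact ⟨L, h1.trans h, h2, h3⟩

theorem Area.mul_mem {k l : ℕ} {g h : G} (hg : g ∈ Area R k) (hh : h ∈ Area R l) :
    g * h ∈ Area R (k + l) := by
  obtain ⟨L, h1, h2, rfl⟩ := hg
  obtain ⟨M, h4, h5, rfl⟩ := hh
  refine ⟨L ++ M, by simp; omega, fun x hx => ?_, by simp⟩
  rcases List.mem_append.1 hx with h | h
  · exact h2 x h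
  · exact h5 x h

theorem Area.conj_mem {k : ℕ} {g : G} (hg : g ∈ Area R k) (c : G) :
    c * g * c⁻¹ ∈ Area R k := by
  obtain ⟨L, h1, h2, rfl⟩ := hg
  refine ⟨L.map (MulAut.conj c), by simpa, fun x hx => ?_, ?_⟩
  · obtain ⟨y, hy, rfl⟩ := List.mem_map.1 hx
    exact Group.conj_mem_conjugatesOfSet (h2 y hy)
  · rw [← map_list_prod, MulAut.conj_apply]

theorem inv_mem_conjugatesOfSet (hR : ∀ x ∈ R, x⁻¹ ∈ R) {x : G}
    (hx : x ∈ Group.conjugatesOfSet R) : x⁻¹ ∈ Group.conjugatesOfSet R := by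
  obtain ⟨r, hr, hc⟩ := Group.mem_conjugatesOfSet_iff.1 hx
  refine Group.mem_conjugatesOfSet_iff.2 ⟨r⁻¹, hR r hr, ?_⟩
  obtain ⟨c, rfl⟩ := isConj_iff.1 hc
  exact isConj_iff.2 ⟨c, by group⟩

theorem Area.inv_mem (hR : ∀ x ∈ R, x⁻¹ ∈ R) {k : ℕ} {g : G} (hg : g ∈ Area R k) :
    g⁻¹ ∈ Area R k := by
  obtain ⟨L, h1, h2, rfl⟩ := hg
  refine ⟨(L.map (·⁻¹)).reverse, by simpa, fun x hx => ?_, (List.prod_inv_reverse L).symm⟩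
  obtain ⟨y, hy, rfl⟩ := List.mem_map.1 (List.mem_reverse.1 hx)
  exact inv_mem_conjugatesOfSet hR (h2 y hy)

theorem Area.mem_normalClosure {k : ℕ} {g : G} (hg : g ∈ Area R k) :
    g ∈ Subgroup.normalClosure R := by
  obtain ⟨L, -, h2, rfl⟩ := hg
  exact list_prod_mem fun x hx => Subgroup.conjugatesOfSet_subset_normalClosure (h2 x hx)

theorem exists_mem_area (hR : ∀ x ∈ R, x⁻¹ ∈ R) {g : G} (hg : g ∈ Subgroup.normalClosure R) :
    ∃ k, g ∈ Area R k := by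
  induction hg using Subgroup.closure_induction with
  | mem x hx => exact ⟨1, [x], by simp, by simpa using hx, by simp⟩
  | one => exact ⟨0, Area.one_mem 0⟩
  | mul x y _ _ hx hy =>
    obtain ⟨k, hk⟩ := hx
    obtain ⟨l, hl⟩ := hy
    exact ⟨_, Area.mul_mem hk hl⟩
  | inv x _ hx =>
    obtain ⟨k, hk⟩ := hx
    exact ⟨k, Area.inv_mem hR hk⟩

/-- `x` and `y` differ by a product of at most `k` conjugates of elements of `R`. -/
def Near (R : Set G) (k : ℕ) (x y : G) : Prop := x * y⁻¹ ∈ Area R k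

theorem Near.refl (k : ℕ) (x : G) : Near R k x x := by
  simpa [Near] using Area.one_mem k

theorem Near.mono {k l : ℕ} (h : k ≤ l) {x y : G} (hxy : Near R k x y) : Near R l x y :=
  Area.mono h hxy

theorem Near.symm (hR : ∀ x ∈ R, x⁻¹ ∈ R) {k : ℕ} {x y : G} (h : Near R k x y) :
    Near R k y x := by
  simpa [Near] using Area.inv_mem hR h

theorem Near.trans {k l : ℕ} {x y z : G} (h : Near R k x y) (h' : Near R l y z) :
    Near R (k + l) x z := by
  simpa [Near] using Area.mul_mem h h'

theorem Near.mul {k l : ℕ} {x y x' y' : G} (h : Near R k x y) (h' : Near R l x' y') :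
    Near R (k + l) (x * x') (y * y') := by
  have := Area.mul_mem (Area.conj_mem h' x) h
  rw [add_comm] at this
  simpa [Near, mul_assoc] using this

theorem Near.inv (hR : ∀ x ∈ R, x⁻¹ ∈ R) {k : ℕ} {x y : G} (h : Near R k x y) :
    Near R k x⁻¹ y⁻¹ := by
  have := Area.conj_mem (Area.inv_mem hR h) x⁻¹
  simpa [Near, mul_assoc] using this

/-- A family version of `Near`, with a bound on the total area. -/
def NearSum {K : Type*} (R : Set G) (U : Finset K) (c : ℕ) (x y : K → G) : Prop :=
  ∃ e : K → ℕ, (∀ κ ∈ U, Near R (e κ) (x κ) (y κ)) ∧ ∑ κ ∈ U, e κ ≤ c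

variable {K : Type*} {U : Finset K}

theorem NearSum.refl (c : ℕ) (x : K → G) : NearSum R U c x x :=
  ⟨0, fun _ _ => Near.refl _ _, by simp⟩

theorem NearSum.of_eq {x y : K → G} (h : ∀ κ ∈ U, x κ = y κ) : NearSum R U 0 x y :=
  ⟨0, fun κ hκ => by rw [h κ hκ]; exact Near.refl _ _, by simp⟩

theorem NearSum.mono {c c' : ℕ} (h : c ≤ c') {x y : K → G} (hxy : NearSum R U c x y) :
    NearSum R U c' x y := by
  obtain ⟨e, h1, h2⟩ := hxy
  exact ⟨e, h1, h2.trans h⟩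

theorem NearSum.symm (hR : ∀ x ∈ R, x⁻¹ ∈ R) {c : ℕ} {x y : K → G} (h : NearSum R U c x y) :
    NearSum R U c y x := by
  obtain ⟨e, h1, h2⟩ := h
  exact ⟨e, fun κ hκ => (h1 κ hκ).symm hR, h2⟩

theorem NearSum.trans {c c' : ℕ} {x y z : K → G} (h : NearSum R U c x y)
    (h' : NearSum R U c' y z) : NearSum R U (c + c') x z := by
  obtain ⟨e, h1, h2⟩ := h
  obtain ⟨e', h3, h4⟩ := h'
  exact ⟨fun κ => e κ + e' κ, fun κ hκ => (h1 κ hκ).trans (h3 κ hκ), by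
    rw [Finset.sum_add_distrib]; omega⟩

theorem NearSum.mul {c c' : ℕ} {x y x' y' : K → G} (h : NearSum R U c x y)
    (h' : NearSum R U c' x' y') :
    NearSum R U (c + c') (fun κ => x κ * x' κ) (fun κ => y κ * y' κ) := by
  obtain ⟨e, h1, h2⟩ := h
  obtain ⟨e', h3, h4⟩ := h'
  exact ⟨fun κ => e κ + e' κ, fun κ hκ => (h1 κ hκ).mul (h3 κ hκ), by
    rw [Finset.sum_add_distrib]; omega⟩

theorem NearSum.inv (hR : ∀ x ∈ R, x⁻¹ ∈ R) {c : ℕ} {x y : K → G} (h : NearSum R U c x y) :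
    NearSum R U c (fun κ => (x κ)⁻¹) (fun κ => (y κ)⁻¹) := by
  obtain ⟨e, h1, h2⟩ := h
  exact ⟨e, fun κ hκ => (h1 κ hκ).inv hR, h2⟩

end Area

section Flip

open FreeGroup
open scoped Classical

variable {α : Type*}

/-- The product of the letters of a word, the letters at the positions satisfying `b`
being replaced by their images under `f`. -/
noncomputable def flipProd (f : α × Bool → FreeGroup α) :
    List (α × Bool) → (ℕ → Prop) → FreeGroup α
  | [], _ => 1
  | l :: u, b => (if b 0 then f l else mk [l]) * flipProd f u (fun s => b (s + 1))

/-- The position `s` is the centre of an occurrence of `W` or of its inverse in `u`. -/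
def Flagged (k : ℕ) (W u : List (α × Bool)) (s : ℕ) : Prop :=
  ∃ X Y, (u = X ++ W ++ Y ∨ u = X ++ invRev W ++ Y) ∧ X.length + k = s

/-- Replace by its image under `f` every letter of `u` at the centre of an occurrence of
`W` or of its inverse. -/
noncomputable def flipWord (k : ℕ) (W : List (α × Bool)) (f : α × Bool → FreeGroup α)
    (u : List (α × Bool)) : FreeGroup α :=
  flipProd f u (Flagged k W u)

variable {f : α × Bool → FreeGroup α}

theorem flipProd_append (u v : List (α × Bool)) (b : ℕ → Prop) :
    flipProd f (u ++ v) b = flipProd f u b * flipProd f v (fun s => b (s + u.length)) := by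
  induction u generalizing b with
  | nil => simp [flipProd]
  | cons l u ih => simp [flipProd, ih, mul_assoc, add_assoc]

theorem flipProd_congr {u : List (α × Bool)} {b b' : ℕ → Prop}
    (h : ∀ s < u.length, (b s ↔ b' s)) : flipProd f u b = flipProd f u b' := by
  induction u generalizing b b' with
  | nil => rfl
  | cons l u ih =>
    simp only [flipProd, h 0 (by simp)]
    rw [ih fun s hs => h (s + 1) (by simpa using hs)]

theorem flipProd_of_not {u : List (α × Bool)} {b : ℕ → Prop}
    (h : ∀ s < u.length, ¬ b s) : flipProd f u b = mk u := by
  induction u generalizing b with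
  | nil => rfl
  | cons l u ih =>
    rw [flipProd, ih fun s hs => h (s + 1) (by simpa using hs), if_neg (h 0 (by simp)),
      mul_mk]
    rfl

theorem flipProd_invRev (hf : ∀ l, f (l.1, !l.2) = (f l)⁻¹) (u : List (α × Bool))
    (b : ℕ → Prop) :
    flipProd f (invRev u) (fun s => b (u.length - 1 - s)) = (flipProd f u b)⁻¹ := by
  induction u generalizing b with
  | nil => simp [flipProd, invRev]
  | cons l u ih =>
    have h : invRev (l :: u) = invRev u ++ [(l.1, !l.2)] := by simp [invRev]
    rw [h, flipProd_append,
      show flipProd f (l :: u) b = (if b 0 then f l else mk [l]) * flipProd f u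
      (fun s => b (s + 1)) from rfl, mul_inv_rev, ← ih]
    congr 1
    · refine flipProd_congr fun s hs => ?_
      rw [invRev_length] at hs
      simp only [List.length_cons]
      rw [show u.length + 1 - 1 - s = u.length - 1 - s + 1 by omega]
    · simp only [flipProd, mul_one, zero_add, List.length_cons, invRev_length]
      simp only [Nat.add_sub_cancel, Nat.sub_self]
      split_ifs
      · exact hf l
      · simp [inv_mk, invRev]

variable {R : Set (FreeGroup α)}

theorem flipProd_near (hR : ∀ x ∈ R, x⁻¹ ∈ R) (hfR : ∀ l, Near R 1 (f l) (mk [l]))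
    (u : List (α × Bool)) (b b' : ℕ → Prop) :
    Near R (Nat.count (fun s => ¬ (b s ↔ b' s)) u.length)
      (flipProd f u b) (flipProd f u b') := by
  induction u generalizing b b' with
  | nil => exact Near.refl _ _
  | cons l u ih =>
    rw [List.length_cons, Nat.count_succ', add_comm]
    refine Near.mul ?_ (ih _ _)
    by_cases h : b 0 <;> by_cases h' : b' 0 <;>
      simp only [h, h', if_true, if_false, iff_true, iff_false, not_true, not_false_eq_true]
    · exact Near.refl _ _
    · exact hfR l
    · exact (hfR l).symm hR
    · exact Near.refl _ _

theorem flipProd_near_card (hR : ∀ x ∈ R, x⁻¹ ∈ R) (hfR : ∀ l, Near R 1 (f l) (mk [l]))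
    (u : List (α × Bool)) (b b' : ℕ → Prop) (D : Finset ℕ)
    (hD : ∀ s < u.length, ¬ (b s ↔ b' s) → s ∈ D) :
    Near R D.card (flipProd f u b) (flipProd f u b') := by
  refine (flipProd_near hR hfR u b b').mono ?_
  rw [Nat.count_eq_card_filter_range]
  refine Finset.card_le_card fun s hs => ?_
  rw [Finset.mem_filter, Finset.mem_range] at hs
  exact hD s hs.1 hs.2

variable {k : ℕ} {W : List (α × Bool)}

theorem Flagged.add_lt (hW : W.length = 2 * k + 1) {u : List (α × Bool)} {s : ℕ}
    (h : Flagged k W u s) : k ≤ s ∧ s + k < u.length := by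
  obtain ⟨X, Y, rfl | rfl, rfl⟩ := h
  · simp [hW]; omega
  · simp [hW]; omega

theorem flagged_invRev_of (hW : W.length = 2 * k + 1) {u : List (α × Bool)} {s : ℕ}
    (h : Flagged k W u s) : Flagged k W (invRev u) (u.length - 1 - s) := by
  obtain ⟨X, Y, rfl | rfl, rfl⟩ := h
  · exact ⟨invRev Y, invRev X, Or.inr (by simp [invRev_append]), by simp [hW]; omega⟩
  · exact ⟨invRev Y, invRev X, Or.inl (by simp [invRev_append]), by simp [hW]; omega⟩

theorem flagged_invRev (hW : W.length = 2 * k + 1) {u : List (α × Bool)} {s : ℕ}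
    (hs : s < u.length) : Flagged k W (invRev u) s ↔ Flagged k W u (u.length - 1 - s) := by
  constructor
  · intro h
    simpa using flagged_invRev_of hW h
  · intro h
    have := flagged_invRev_of hW h
    rwa [show u.length - 1 - (u.length - 1 - s) = s by omega] at this

theorem flipWord_invRev (hf : ∀ l, f (l.1, !l.2) = (f l)⁻¹) (hW : W.length = 2 * k + 1)
    (u : List (α × Bool)) : flipWord k W f (invRev u) = (flipWord k W f u)⁻¹ := by
  rw [flipWord, flipWord, ← flipProd_invRev hf]
  refine flipProd_congr fun s hs => ?_
  rw [invRev_length] at hs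
  exact flagged_invRev hW hs

theorem flipWord_of_short (hW : W.length = 2 * k + 1) {u : List (α × Bool)}
    (hu : u.length < 2 * k + 1) : flipWord k W f u = mk u :=
  flipProd_of_not fun s _ h => by have := h.add_lt hW; omega

theorem Flagged.append_left {u : List (α × Bool)} {s : ℕ}
    (h : Flagged k W u s) (v : List (α × Bool)) : Flagged k W (u ++ v) s := by
  obtain ⟨X, Y, rfl | rfl, rfl⟩ := h
  · exact ⟨X, Y ++ v, Or.inl (by simp), rfl⟩
  · exact ⟨X, Y ++ v, Or.inr (by simp), rfl⟩

theorem Flagged.append_right {v : List (α × Bool)} {s : ℕ}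
    (h : Flagged k W v s) (u : List (α × Bool)) : Flagged k W (u ++ v) (s + u.length) := by
  obtain ⟨X, Y, rfl | rfl, rfl⟩ := h
  · exact ⟨u ++ X, Y, Or.inl (by simp), by simp; omega⟩
  · exact ⟨u ++ X, Y, Or.inr (by simp), by simp; omega⟩

theorem exists_append_of_le {u v X V Y : List (α × Bool)} (h : u ++ v = X ++ V ++ Y)
    (hl : X.length + V.length ≤ u.length) : ∃ Y', u = X ++ V ++ Y' := by
  obtain ⟨Y', rfl⟩ : X ++ V <+: u :=
    List.prefix_of_prefix_length_le (⟨Y, h.symm⟩ : X ++ V <+: u ++ v) (List.prefix_append _ _)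
      (by simpa using hl)
  exact ⟨Y', rfl⟩

theorem exists_append_of_ge {u v X V Y : List (α × Bool)} (h : u ++ v = X ++ V ++ Y)
    (hl : u.length ≤ X.length) : ∃ X', v = X' ++ V ++ Y ∧ X = u ++ X' := by
  obtain ⟨X', rfl⟩ : u <+: X :=
    List.prefix_of_prefix_length_le (⟨v, by simpa using h⟩ : u <+: X ++ (V ++ Y))
      (List.prefix_append _ _) hl
  exact ⟨X', by simpa using h, rfl⟩

theorem Flagged.of_append_left (hW : W.length = 2 * k + 1) {u v : List (α × Bool)} {s : ℕ}
    (h : Flagged k W (u ++ v) s) (hs : s + k < u.length) : Flagged k W u s := by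
  obtain ⟨X, Y, h | h, rfl⟩ := h
  · obtain ⟨Y', hY⟩ := exists_append_of_le h (by omega)
    exact ⟨X, Y', Or.inl hY, rfl⟩
  · obtain ⟨Y', hY⟩ := exists_append_of_le h (by rw [invRev_length]; omega)
    exact ⟨X, Y', Or.inr hY, rfl⟩

theorem Flagged.of_append_right {u v : List (α × Bool)} {s : ℕ}
    (h : Flagged k W (u ++ v) (s + u.length)) (hs : k ≤ s) : Flagged k W v s := by
  obtain ⟨X, Y, h | h, hX⟩ := h
  · obtain ⟨X', hX', rfl⟩ := exists_append_of_ge h (by omega)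
    exact ⟨X', Y, Or.inl hX', by simp at hX; omega⟩
  · obtain ⟨X', hX', rfl⟩ := exists_append_of_ge h (by omega)
    exact ⟨X', Y, Or.inr hX', by simp at hX; omega⟩

theorem flipWord_append_near (hR : ∀ x ∈ R, x⁻¹ ∈ R) (hfR : ∀ l, Near R 1 (f l) (mk [l]))
    (hW : W.length = 2 * k + 1) (u v : List (α × Bool)) :
    Near R ((Finset.Ico (u.length - k) (u.length + k)).filter (Flagged k W (u ++ v))).card
      (flipWord k W f (u ++ v)) (flipWord k W f u * flipWord k W f v) := by
  rw [flipWord, flipProd_append]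
  have h1 := flipProd_near_card hR hfR u (Flagged k W (u ++ v)) (Flagged k W u)
    ((Finset.Ico (u.length - k) u.length).filter (Flagged k W (u ++ v))) fun s hs h => by
      have h2 : Flagged k W (u ++ v) s ∧ ¬ Flagged k W u s := by
        by_contra h3
        exact h ⟨fun h4 => by_contra fun h5 => h3 ⟨h4, h5⟩, fun h4 => h4.append_left v⟩
      refine Finset.mem_filter.2 ⟨Finset.mem_Ico.2 ⟨?_, hs⟩, h2.1⟩
      by_contra h3
      exact h2.2 (h2.1.of_append_left hW (by omega))
  have h2 := flipProd_near_card hR hfR v (fun s => Flagged k W (u ++ v) (s + u.length))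
    (Flagged k W v)
    ((Finset.range k).filter (fun s => Flagged k W (u ++ v) (s + u.length))) fun s hs h => by
      have h2 : Flagged k W (u ++ v) (s + u.length) ∧ ¬ Flagged k W v s := by
        by_contra h3
        exact h ⟨fun h4 => by_contra fun h5 => h3 ⟨h4, h5⟩, fun h4 => h4.append_right u⟩
      refine Finset.mem_filter.2 ⟨Finset.mem_range.2 ?_, h2.1⟩
      by_contra h3
      exact h2.2 (h2.1.of_append_right (by omega))
  refine (h1.mul h2).mono ?_
  rw [← Finset.card_map (addRightEmbedding u.length) (s := (Finset.range k).filter _),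
    ← Finset.card_union_of_disjoint]
  · refine Finset.card_le_card fun s hs => ?_
    simp only [Finset.mem_union, Finset.mem_filter, Finset.mem_Ico, Finset.mem_map,
      Finset.mem_range, addRightEmbedding_apply] at hs ⊢
    rcases hs with hs | ⟨t, ht, rfl⟩
    · exact ⟨by omega, hs.2⟩
    · exact ⟨by omega, ht.2⟩
  · rw [Finset.disjoint_left]
    simp only [Finset.mem_filter, Finset.mem_Ico, Finset.mem_map,
      Finset.mem_range, addRightEmbedding_apply]
    rintro s hs ⟨t, ht, rfl⟩
    omega

theorem near_flipWord (hR : ∀ x ∈ R, x⁻¹ ∈ R) (hfR : ∀ l, Near R 1 (f l) (mk [l]))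
    (u : List (α × Bool)) : Near R u.length (flipWord k W f u) (mk u) := by
  rw [← flipProd_of_not (f := f) (u := u) (b := fun _ => False) (by simp)]
  simpa [flipWord] using flipProd_near_card hR hfR u _ _ (Finset.range u.length)
    fun s hs _ => Finset.mem_range.2 hs

end Flip

section Family

open FreeGroup
open scoped Classical

variable {α K : Type*} {R : Set (FreeGroup α)} {k : ℕ} {U : Finset K}
  {W : K → List (α × Bool)} {f : K → α × Bool → FreeGroup α}

/-- A family of flips for which every position of every word is flagged at most once. -/
structure FlipFamily (R : Set (FreeGroup α)) (k : ℕ) (U : Finset K)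
    (W : K → List (α × Bool)) (f : K → α × Bool → FreeGroup α) : Prop where
  inv_mem : ∀ x ∈ R, x⁻¹ ∈ R
  f_inv : ∀ κ l, f κ (l.1, !l.2) = (f κ l)⁻¹
  near : ∀ κ ∈ U, ∀ l, Near R 1 (f κ l) (mk [l])
  length : ∀ κ ∈ U, (W κ).length = 2 * k + 1
  uniq : ∀ κ ∈ U, ∀ κ' ∈ U, W κ = W κ' ∨ W κ = invRev (W κ') → κ = κ'

theorem FlipFamily.eq_of_flagged (h : FlipFamily R k U W f) {κ κ' : K} (hκ : κ ∈ U)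
    (hκ' : κ' ∈ U) {u : List (α × Bool)} {s : ℕ} (h1 : Flagged k (W κ) u s)
    (h2 : Flagged k (W κ') u s) : κ = κ' := by
  obtain ⟨X, Y, h1, rfl⟩ := h1
  obtain ⟨X', Y', h2, h3⟩ := h2
  have hl := h.length κ hκ
  have hl' := h.length κ' hκ'
  have key : ∀ V V' : List (α × Bool), V.length = V'.length → u = X ++ V ++ Y →
      u = X' ++ V' ++ Y' → V = V' := by
    intro V V' hV e1 e2
    rw [e1, List.append_assoc, List.append_assoc] at e2
    exact (List.append_inj (List.append_inj e2 (by omega)).2 hV).1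
  refine h.uniq κ hκ κ' hκ' ?_
  rcases h1 with h1 | h1 <;> rcases h2 with h2 | h2
  · exact Or.inl (key _ _ (by omega) h1 h2)
  · exact Or.inr (key _ _ (by rw [invRev_length]; omega) h1 h2)
  · refine Or.inr ?_
    rw [← key _ _ (by rw [invRev_length]; omega) h1 h2, invRev_invRev]
  · exact Or.inl (invRev_injective (key _ _ (by simp only [invRev_length]; omega) h1 h2))

theorem FlipFamily.append (h : FlipFamily R k U W f) (u v : List (α × Bool)) :
    NearSum R U (2 * k) (fun κ => flipWord k (W κ) (f κ) (u ++ v))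
      (fun κ => flipWord k (W κ) (f κ) u * flipWord k (W κ) (f κ) v) := by
  refine ⟨_, fun κ hκ => flipWord_append_near h.inv_mem (h.near κ hκ) (h.length κ hκ) u v, ?_⟩
  simp only [Finset.card_filter]
  rw [Finset.sum_comm]
  refine (Finset.sum_le_card_nsmul _ _ 1 fun s _ => ?_).trans ?_
  · rw [← Finset.card_filter, Finset.card_le_one]
    intro κ hκ κ' hκ'
    rw [Finset.mem_filter] at hκ hκ'
    exact h.eq_of_flagged hκ.1 hκ'.1 hκ.2 hκ'.2
  · simp; omega

theorem isReduced_tripod {u v : List (α × Bool)} (hu : IsReduced u) (hv : IsReduced v) :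
    ∃ A B C, u = A ++ invRev B ∧ v = B ++ C ∧ IsReduced (A ++ C) := by
  induction u using List.reverseRecOn generalizing v with
  | nil => exact ⟨[], [], v, by simp, by simp, by simpa⟩
  | append_singleton u l ih =>
    by_cases h : ∃ t, v = (l.1, !l.2) :: t
    · obtain ⟨t, rfl⟩ := h
      obtain ⟨A, B, C, rfl, rfl, h3⟩ := ih (v := t) (List.IsChain.left_of_append hu)
        (List.IsChain.tail hv)
      exact ⟨A, (l.1, !l.2) :: B, C, by simp [invRev], by simp, h3⟩
    · refine ⟨u ++ [l], [], v, by simp, by simp, ?_⟩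
      refine List.isChain_append.2 ⟨hu, hv, fun x hx y hy hxy => ?_⟩
      simp only [List.getLast?_append, List.getLast?_singleton, Option.some_or,
        Option.mem_def, Option.some.injEq] at hx
      subst hx
      by_contra h2
      refine h ⟨v.tail, ?_⟩
      rw [Option.mem_def, List.head?_eq_some_iff] at hy
      obtain ⟨t, rfl⟩ := hy
      rcases y with ⟨y, b⟩
      simp only [List.tail_cons, List.cons.injEq, Prod.mk.injEq, and_true]
      refine ⟨hxy.symm, ?_⟩
      simp only at h2
      rcases hl : l.2 <;> rcases b <;> simp_all

variable [DecidableEq α]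

/-- The flip map on elements of the free group. -/
noncomputable def flipElt (k : ℕ) (W : List (α × Bool)) (f : α × Bool → FreeGroup α)
    (x : FreeGroup α) : FreeGroup α :=
  flipWord k W f x.toWord

theorem flipElt_inv {W : List (α × Bool)} {f : α × Bool → FreeGroup α}
    (hf : ∀ l, f (l.1, !l.2) = (f l)⁻¹) (hW : W.length = 2 * k + 1)
    (x : FreeGroup α) : flipElt k W f x⁻¹ = (flipElt k W f x)⁻¹ := by
  rw [flipElt, toWord_inv, flipWord_invRev hf hW, flipElt]

theorem FlipFamily.flipElt_mul (h : FlipFamily R k U W f) (x y : FreeGroup α) :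
    NearSum R U (6 * k) (fun κ => flipElt k (W κ) (f κ) (x * y))
      (fun κ => flipElt k (W κ) (f κ) x * flipElt k (W κ) (f κ) y) := by
  obtain ⟨A, B, C, hx, hy, hAC⟩ := isReduced_tripod (isReduced_toWord (x := x))
    (isReduced_toWord (x := y))
  have hxy : (x * y).toWord = A ++ C := by
    rw [← hAC.reduce_eq, ← toWord_mk]
    congr 1
    rw [← mk_toWord (x := x), ← mk_toWord (x := y), hx, hy]
    simp only [← mul_mk, ← inv_mk]
    group
  have h1 := h.append A C
  have h2 := (h.append A (invRev B)).symm h.inv_mem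
  have h3 := (h.append B C).symm h.inv_mem
  simp only [flipElt, hxy, hx, hy]
  refine ((h1.trans (NearSum.of_eq fun κ hκ => ?_)).trans (h2.mul h3)).mono (by omega)
  rw [flipWord_invRev (h.f_inv κ) (h.length κ hκ)]
  group

theorem FlipFamily.flipElt_prod (h : FlipFamily R k U W f) (L : List (FreeGroup α)) :
    NearSum R U (6 * k * L.length) (fun κ => flipElt k (W κ) (f κ) L.prod)
      (fun κ => (L.map (flipElt k (W κ) (f κ))).prod) := by
  induction L with
  | nil =>
    refine (NearSum.of_eq fun κ hκ => ?_).mono (Nat.zero_le _)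
    simp [flipElt, flipWord, flipProd]
  | cons x L ih =>
    simp only [List.prod_cons, List.map_cons, List.length_cons]
    exact ((h.flipElt_mul x L.prod).trans ((NearSum.refl 0 _).mul ih)).mono (by
      rw [mul_add]; omega)

end Family

section Circles

open FreeGroup
open scoped Classical

variable {α ι : Type*} {ρ : ι → List (α × Bool)} {k : ℕ}

/-- The relators read along the circles `ρ i`, together with their inverses. -/
def circleRel (ρ : ι → List (α × Bool)) : Set (FreeGroup α) :=
  {g | ∃ i, g = mk (ρ i) ∨ g = (mk (ρ i))⁻¹}

theorem circleRel_inv {x : FreeGroup α} (hx : x ∈ circleRel ρ) : x⁻¹ ∈ circleRel ρ := by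
  obtain ⟨i, rfl | rfl⟩ := hx
  · exact ⟨i, Or.inr rfl⟩
  · exact ⟨i, Or.inl (inv_inv _)⟩

/-- The window of length `2 * k + 1` starting at position `q` of the circle `w`. -/
def circleWin (k : ℕ) (w : List (α × Bool)) (q : ℕ) : List (α × Bool) :=
  (w.rotate q).take (2 * k + 1)

/-- Replacement of the first letter of `c` by the inverse of the rest of `c`. -/
noncomputable def flipLetter : List (α × Bool) → α × Bool → FreeGroup α
  | [], l => mk [l]
  | t :: τ, l => if l = t then (mk τ)⁻¹ else if l = (t.1, !t.2) then mk τ else mk [l]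

theorem flipLetter_inv (c : List (α × Bool)) (l : α × Bool) :
    flipLetter c (l.1, !l.2) = (flipLetter c l)⁻¹ := by
  rcases c with _ | ⟨t, τ⟩
  · simp [flipLetter, inv_mk, invRev]
  · rcases l with ⟨l, b⟩
    rcases t with ⟨t, b'⟩
    simp only [flipLetter, Prod.mk.injEq]
    by_cases h : l = t
    · rcases b <;> rcases b' <;> simp [h]
    · simp [h, inv_mk, invRev]

theorem flipLetter_near {R : Set (FreeGroup α)} (hR : ∀ x ∈ R, x⁻¹ ∈ R)
    {c : List (α × Bool)} (hc : mk c ∈ Group.conjugatesOfSet R) (l : α × Bool) :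
    Near R 1 (flipLetter c l) (mk [l]) := by
  rcases c with _ | ⟨t, τ⟩
  · exact Near.refl _ _
  · have h1 : mk (t :: τ) ∈ Area R 1 := ⟨[mk (t :: τ)], by simp, by simpa using hc, by simp⟩
    have h2 : mk (t :: τ) = mk [t] * mk τ := by rw [mul_mk]; rfl
    rw [h2] at h1
    simp only [flipLetter]
    split_ifs with h h'
    · subst h
      rw [Near, ← mul_inv_rev]
      exact Area.inv_mem hR h1
    · subst h'
      have h3 := Area.conj_mem h1 (mk [t])⁻¹
      have h4 : (mk [(t.1, !t.2)])⁻¹ = mk [t] := by simp [inv_mk, invRev]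
      rw [inv_mul_cancel_left, inv_inv] at h3
      rwa [Near, h4]
    · exact Near.refl _ _

theorem isConj_mk_rotate (w : List (α × Bool)) (q : ℕ) : IsConj (mk w) (mk (w.rotate q)) := by
  rw [← List.rotate_mod, List.rotate_eq_drop_append_take_mod, Nat.mod_mod]
  refine isConj_iff.2 ⟨(mk (w.take (q % w.length)))⁻¹, ?_⟩
  conv_lhs => rw [← List.take_append_drop (q % w.length) w, ← mul_mk]
  rw [List.take_append_drop, ← mul_mk]
  group

theorem mk_rotate_mem (i : ι) (q : ℕ) :
    mk ((ρ i).rotate q) ∈ Group.conjugatesOfSet (circleRel ρ) :=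
  Group.mem_conjugatesOfSet_iff.2 ⟨_, ⟨i, Or.inl rfl⟩, isConj_mk_rotate _ _⟩

theorem flipProd_rotate_eq_one {u : List (α × Bool)} {s : ℕ} (hs : s < u.length) :
    flipProd (flipLetter (u.rotate s)) u (· = s) = 1 := by
  obtain ⟨X, t, Y, rfl, rfl⟩ : ∃ X t Y, u = X ++ t :: Y ∧ X.length = s :=
    ⟨u.take s, u[s], u.drop (s + 1), by simp, by simp; omega⟩
  rw [List.rotate_append_length_eq, flipProd_append,
    flipProd_of_not (fun s hs => hs.ne), flipProd, if_pos (by simp),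
    flipProd_of_not (fun s _ => by omega), List.cons_append, flipLetter, if_pos rfl, ← mul_mk]
  group

theorem circleWin_mod (k : ℕ) (w : List (α × Bool)) (q : ℕ) :
    circleWin k w (q % w.length) = circleWin k w q := by
  rw [circleWin, List.rotate_mod, circleWin]

theorem eq_circleWin {w X V Y : List (α × Bool)} {b : ℕ} (h : w.rotate b = X ++ V ++ Y)
    (hV : V.length = 2 * k + 1) : V = circleWin k w (b + X.length) := by
  rw [circleWin, ← List.rotate_rotate, h, List.append_assoc, List.rotate_append_length_eq,
    List.append_assoc, ← hV, List.take_left]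

theorem exists_eq_circleWin {w : List (α × Bool)} {b j : ℕ} (hj : j + 2 * k < w.length) :
    ∃ X Y, w.rotate b = X ++ circleWin k w (b + j) ++ Y ∧ X.length = j := by
  refine ⟨(w.rotate b).take j, ((w.rotate b).drop j).drop (2 * k + 1), ?_, ?_⟩
  · rw [circleWin, ← List.rotate_rotate,
      List.rotate_eq_drop_append_take (l := w.rotate b) (by simp; omega),
      List.take_append_of_le_length (by simp; omega), List.append_assoc,
      List.take_append_drop, List.take_append_drop]
  · simp; omega

/-- The window of the colour `κ` occurs nowhere else on the circles with index in `I`. -/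
def UniqueIn (ρ : ι → List (α × Bool)) (k : ℕ) (I : Set ι) (κ : ι × ℕ) : Prop :=
  ∀ i ∈ I, ∀ b < (ρ i).length,
    (circleWin k (ρ i) b = circleWin k (ρ κ.1) κ.2 → (i, b) = κ) ∧
    circleWin k (ρ i) b ≠ invRev (circleWin k (ρ κ.1) κ.2)

variable {I : Set ι} {U : Finset (ι × ℕ)}

theorem length_circleWin {w : List (α × Bool)} {q : ℕ} (h : 2 * k < w.length) :
    (circleWin k w q).length = 2 * k + 1 := by
  simp [circleWin]; omega

theorem flipFamily_circles (hk : ∀ i ∈ I, 2 * k < (ρ i).length)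
    (hU : ∀ κ ∈ U, κ.1 ∈ I ∧ κ.2 < (ρ κ.1).length ∧ UniqueIn ρ k I κ) :
    FlipFamily (circleRel ρ) k U (fun κ => circleWin k (ρ κ.1) κ.2)
      (fun κ => flipLetter ((ρ κ.1).rotate (κ.2 + k))) where
  inv_mem _ := circleRel_inv
  f_inv _ := flipLetter_inv _
  near _ _ := flipLetter_near (fun _ => circleRel_inv) (mk_rotate_mem _ _)
  length κ hκ := length_circleWin (hk _ (hU κ hκ).1)
  uniq κ hκ κ' hκ' h := by
    have := (hU κ' hκ').2.2 κ.1 (hU κ hκ).1 κ.2 (hU κ hκ).2.1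
    rcases h with h | h
    · exact this.1 h
    · exact absurd h this.2

theorem flagged_rotate_iff {i : ι} (hi : i ∈ I) {κ : ι × ℕ} (hκ : UniqueIn ρ k I κ)
    (hk : 2 * k < (ρ κ.1).length) {b s : ℕ} :
    Flagged k (circleWin k (ρ κ.1) κ.2) ((ρ i).rotate b) s ↔
      ∃ j, j + k = s ∧ s + k < (ρ i).length ∧ κ = (i, (b + j) % (ρ i).length) := by
  have hl := length_circleWin (q := κ.2) hk
  constructor
  · intro h
    have hs := h.add_lt hl
    rw [List.length_rotate] at hs
    obtain ⟨X, Y, h, rfl⟩ := h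
    have hm : (b + X.length) % (ρ i).length < (ρ i).length := Nat.mod_lt _ (by omega)
    refine ⟨X.length, rfl, hs.2, ?_⟩
    rcases h with h | h
    · exact (((hκ i hi _ hm).1 (by rw [circleWin_mod, ← eq_circleWin h hl])).symm)
    · refine absurd ?_ (hκ i hi _ hm).2
      rw [circleWin_mod, ← eq_circleWin h (by rw [invRev_length, hl])]
  · rintro ⟨j, rfl, h1, rfl⟩
    obtain ⟨X, Y, h, rfl⟩ := exists_eq_circleWin (w := ρ i) (b := b) (j := j) (k := k)
      (by omega)
    exact ⟨X, Y, Or.inl (by rw [h, circleWin_mod]), rfl⟩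

theorem flipWord_rotate_near (hk : ∀ i ∈ I, 2 * k < (ρ i).length)
    (hU : ∀ κ ∈ U, κ.1 ∈ I ∧ κ.2 < (ρ κ.1).length ∧ UniqueIn ρ k I κ) {i : ι} (hi : i ∈ I)
    {b : ℕ} (hb : b < (ρ i).length) :
    NearSum (circleRel ρ) U (2 * k + (U.filter (fun κ => κ.1 ≠ i)).card)
      (fun κ => flipWord k (circleWin k (ρ κ.1) κ.2)
        (flipLetter ((ρ κ.1).rotate (κ.2 + k))) ((ρ i).rotate b)) (fun _ => 1) := by
  set m := (ρ i).length with hm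
  let good : ι × ℕ → Prop := fun κ => ∃ j, j + 2 * k < m ∧ κ = (i, (b + j) % m)
  refine ⟨fun κ => if good κ then 0 else 1, fun κ hκ => ?_, ?_⟩
  · have hflag := fun s => flagged_rotate_iff hi (hU κ hκ).2.2 (hk _ (hU κ hκ).1) (b := b) (s := s)
    beta_reduce
    by_cases hg : good κ
    · rw [if_pos hg]
      obtain ⟨j, hj, rfl⟩ := hg
      have h1 : flipWord k (circleWin k (ρ i) ((b + j) % m))
          (flipLetter ((ρ i).rotate ((b + j) % m + k))) ((ρ i).rotate b) = 1 := by
        rw [← flipProd_rotate_eq_one (u := (ρ i).rotate b) (s := j + k) (by simp; omega),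
          List.rotate_rotate, ← add_assoc, ← List.rotate_rotate _ (b + j), hm,
          ← List.rotate_rotate _ (_ % _), List.rotate_mod]
        refine flipProd_congr fun s _ => (hflag s).trans ⟨?_, ?_⟩
        · rintro ⟨j', rfl, h2, h3⟩
          rw [Prod.mk.injEq] at h3
          have h4 : j ≡ j' [MOD m] := Nat.ModEq.add_left_cancel' b h3.2
          rw [h4.eq_of_lt_of_lt (by omega) (by omega)]
        · rintro rfl
          exact ⟨j, rfl, by omega, rfl⟩
      simp only [h1]
      exact Near.refl _ _
    · rw [if_neg hg, flipWord, flipProd_of_not]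
      · exact ⟨[_], by simp, by simpa using mk_rotate_mem i b, by simp⟩
      · intro s _ h
        obtain ⟨j, rfl, h1, h2⟩ := (hflag s).1 h
        exact hg ⟨j, by omega, h2⟩
  · have h1 : ∑ κ ∈ U, (if good κ then 0 else 1) = (U.filter (fun κ => ¬ good κ)).card := by
      rw [Finset.card_filter]
      exact Finset.sum_congr rfl fun κ _ => by split_ifs <;> rfl
    rw [h1]
    have h2 : U.filter (fun κ => ¬ good κ) ⊆
        (Finset.Ico (m - 2 * k) m).image (fun j => (i, (b + j) % m)) ∪
        U.filter (fun κ => κ.1 ≠ i) := by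
      intro κ hκ
      rw [Finset.mem_filter] at hκ
      rw [Finset.mem_union, Finset.mem_filter, Finset.mem_image]
      by_cases h : κ.1 = i
      · left
        obtain ⟨i', q⟩ := κ
        simp only at h
        subst h
        have hq : q < m := (hU _ hκ.1).2.1
        have h3 : (b + (q + m - b) % m) % m = q := by
          rw [Nat.add_mod_mod, show b + (q + m - b) = q + m by omega, Nat.add_mod_right,
            Nat.mod_eq_of_lt hq]
        have h4 : (q + m - b) % m < m := Nat.mod_lt _ (by omega)
        refine ⟨(q + m - b) % m, Finset.mem_Ico.2 ⟨?_, h4⟩, by rw [h3]⟩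
        by_contra h5
        exact hκ.2 ⟨(q + m - b) % m, by omega, by rw [h3]⟩
      · exact Or.inr ⟨hκ.1, h⟩
    refine (Finset.card_le_card h2).trans ((Finset.card_union_le _ _).trans ?_)
    refine Nat.add_le_add_right (Finset.card_image_le.trans ?_) _
    simp; omega

theorem isCyclicallyReduced_rotate {w : List (α × Bool)} (hw : IsCyclicallyReduced w)
    (b : ℕ) : IsCyclicallyReduced (w.rotate b) := by
  induction b with
  | zero => simpa
  | succ b ih =>
    rw [← List.rotate_rotate]
    generalize w.rotate b = v at ih
    rcases v with _ | ⟨l, t⟩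
    · simp
    · obtain ⟨h1, h2⟩ := ih
      rw [List.rotate_cons_succ, List.rotate_zero]
      rw [FreeGroup.IsReduced, List.isChain_cons] at h1
      refine ⟨List.isChain_append.2 ⟨h1.2, List.isChain_singleton _, fun x hx y hy => ?_⟩,
        fun x hx y hy => ?_⟩
      · refine h2 x ?_ y (by simpa using hy)
        rw [Option.mem_def] at hx ⊢
        simp [List.getLast?_cons, hx]
      · rw [List.getLast?_concat] at hx
        cases hx
        rcases t with _ | ⟨z, t⟩
        · cases hy
          simp
        · exact h1.1 y hy

theorem isReduced_invRev {w : List (α × Bool)} (hw : IsReduced w) : IsReduced (invRev w) := by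
  rw [isReduced_iff_reduce_eq] at hw ⊢
  rw [reduce_invRev, hw]

theorem eq_snd_of_ne {x y : α × Bool} (h : y ≠ (x.1, !x.2)) (h' : x.1 = y.1) : x.2 = y.2 := by
  obtain ⟨x, b⟩ := x
  obtain ⟨y, b'⟩ := y
  rcases b <;> rcases b' <;> simp_all

theorem exists_reduced_conj {w : List (α × Bool)} (hw : IsCyclicallyReduced w) (hw0 : w ≠ [])
    {a : List (α × Bool)} (ha : IsReduced a) (b : ℕ) :
    ∃ (a' : List (α × Bool)) (b' : ℕ), b' < w.length ∧
      IsReduced (a' ++ w.rotate b' ++ invRev a') ∧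
      FreeGroup.mk (a ++ w.rotate b ++ invRev a) =
        FreeGroup.mk (a' ++ w.rotate b' ++ invRev a') := by
  induction a using List.reverseRecOn generalizing b with
  | nil =>
    refine ⟨[], b % w.length, Nat.mod_lt _ (List.length_pos_of_ne_nil hw0), ?_, ?_⟩
    · simpa using (isCyclicallyReduced_rotate hw _).1
    · rw [List.rotate_mod]
  | append_singleton a l ih =>
    have ha' : IsReduced a := List.IsChain.left_of_append ha
    have hl : (FreeGroup.mk [l])⁻¹ = FreeGroup.mk [(l.1, !l.2)] := by simp [inv_mk, invRev]
    by_cases h1 : ∃ C, w.rotate b = (l.1, !l.2) :: C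
    · obtain ⟨C, hC⟩ := h1
      have h2 : w.rotate (b + 1) = C ++ [(l.1, !l.2)] := by
        rw [← List.rotate_rotate, hC, List.rotate_cons_succ, List.rotate_zero]
      obtain ⟨a', b', h3, h4, h5⟩ := ih ha' (b + 1)
      refine ⟨a', b', h3, h4, ?_⟩
      rw [← h5, h2, hC, ← List.singleton_append (l := C)]
      simp only [← mul_mk, ← inv_mk, ← hl]
      group
    by_cases h2 : ∃ C, w.rotate b = C ++ [l]
    · obtain ⟨C, hC⟩ := h2
      have h2 : w.rotate (b + C.length) = [l] ++ C := by
        rw [← List.rotate_rotate, hC, List.rotate_append_length_eq]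
      obtain ⟨a', b', h3, h4, h5⟩ := ih ha' (b + C.length)
      refine ⟨a', b', h3, h4, ?_⟩
      rw [← h5, h2, hC]
      simp only [← mul_mk, ← inv_mk]
      group
    have hr : w.rotate b ≠ [] := by simpa using hw0
    refine ⟨a ++ [l], b % w.length, Nat.mod_lt _ (List.length_pos_of_ne_nil hw0), ?_, ?_⟩
    · rw [List.rotate_mod]
      refine List.isChain_append.2 ⟨List.isChain_append.2
        ⟨ha, (isCyclicallyReduced_rotate hw _).1, fun x hx y hy => ?_⟩,
        isReduced_invRev ha, fun x hx y hy => ?_⟩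
      · rw [List.getLast?_concat] at hx
        cases hx
        refine eq_snd_of_ne fun h => h1 ⟨(w.rotate b).tail, ?_⟩
        rw [← h]
        exact List.eq_cons_of_mem_head? hy
      · rw [List.getLast?_append_of_ne_nil _ hr] at hx
        simp only [invRev_append] at hy
        have hy' : y = (l.1, !l.2) := by simpa [invRev, eq_comm] using hy
        subst hy'
        intro h3
        have h4 : x ≠ l := by
          rintro rfl
          refine h2 ⟨(w.rotate b).dropLast, ?_⟩
          exact (List.dropLast_append_getLast? x hx).symm
        refine eq_snd_of_ne (fun h => h4 ?_) h3
        rw [Prod.mk.injEq, Bool.not_inj_iff] at h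
        exact (Prod.ext h.1 h.2).symm
    · rw [List.rotate_mod]

/-- The conjugates of the circle with index `i` and of its inverse. -/
def IsCell (ρ : ι → List (α × Bool)) (i : ι) (g : FreeGroup α) : Prop :=
  IsConj (FreeGroup.mk (ρ i)) g ∨ IsConj (FreeGroup.mk (ρ i))⁻¹ g

theorem exists_isCell_of_mem {g : FreeGroup α} (hg : g ∈ Group.conjugatesOfSet (circleRel ρ)) :
    ∃ i, IsCell ρ i g := by
  obtain ⟨r, ⟨i, rfl | rfl⟩, h⟩ := Group.mem_conjugatesOfSet_iff.1 hg
  · exact ⟨i, Or.inl h⟩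
  · exact ⟨i, Or.inr h⟩

variable [DecidableEq α]

theorem toWord_of_isConj {w : List (α × Bool)} (hw : IsCyclicallyReduced w) (hw0 : w ≠ [])
    {g : FreeGroup α} (hg : IsConj (FreeGroup.mk w) g) :
    ∃ (a : List (α × Bool)) (b : ℕ), b < w.length ∧
      g.toWord = a ++ w.rotate b ++ invRev a := by
  obtain ⟨c, rfl⟩ := isConj_iff.1 hg
  obtain ⟨a, b, h1, h2, h3⟩ := exists_reduced_conj hw hw0 (isReduced_toWord (x := c)) 0
  refine ⟨a, b, h1, ?_⟩
  rw [← h2.reduce_eq, ← toWord_mk, ← h3, List.rotate_zero]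
  simp only [← mul_mk, ← inv_mk, mk_toWord]

theorem flipElt_conj_near (hρ : ∀ i, IsCyclicallyReduced (ρ i))
    (hk : ∀ i ∈ I, 2 * k < (ρ i).length)
    (hU : ∀ κ ∈ U, κ.1 ∈ I ∧ κ.2 < (ρ κ.1).length ∧ UniqueIn ρ k I κ) {i : ι} (hi : i ∈ I)
    {g : FreeGroup α} (hg : IsConj (FreeGroup.mk (ρ i)) g) :
    NearSum (circleRel ρ) U (6 * k + (U.filter (fun κ => κ.1 ≠ i)).card)
      (fun κ => flipElt k (circleWin k (ρ κ.1) κ.2)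
        (flipLetter ((ρ κ.1).rotate (κ.2 + k))) g) (fun _ => 1) := by
  have hF := flipFamily_circles hk hU
  obtain ⟨a, b, hb, hg⟩ := toWord_of_isConj (hρ i)
    (List.ne_nil_of_length_pos (by have := hk i hi; omega)) hg
  simp only [flipElt, hg]
  have h1 := hF.append (a ++ (ρ i).rotate b) (invRev a)
  have h2 := hF.append a ((ρ i).rotate b)
  have h3 := flipWord_rotate_near hk hU hi hb
  refine ((h1.trans ((h2.trans ((NearSum.refl 0 _).mul h3)).mul
    (NearSum.refl 0 _))).trans (NearSum.of_eq fun κ hκ => ?_)).mono ?_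
  · rw [flipWord_invRev (hF.f_inv κ) (hF.length κ hκ)]
    group
  · omega

theorem flipElt_cell_near (hρ : ∀ i, IsCyclicallyReduced (ρ i))
    (hk : ∀ i ∈ I, 2 * k < (ρ i).length)
    (hU : ∀ κ ∈ U, κ.1 ∈ I ∧ κ.2 < (ρ κ.1).length ∧ UniqueIn ρ k I κ) {i : ι} (hi : i ∈ I)
    {g : FreeGroup α} (hg : IsCell ρ i g) :
    NearSum (circleRel ρ) U (6 * k + (U.filter (fun κ => κ.1 ≠ i)).card)
      (fun κ => flipElt k (circleWin k (ρ κ.1) κ.2)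
        (flipLetter ((ρ κ.1).rotate (κ.2 + k))) g) (fun _ => 1) := by
  rcases hg with hg | hg
  · exact flipElt_conj_near hρ hk hU hi hg
  · have hF := flipFamily_circles hk hU
    have hg' : IsConj (FreeGroup.mk (ρ i)) g⁻¹ := by
      obtain ⟨c, rfl⟩ := isConj_iff.1 hg
      exact isConj_iff.2 ⟨c, by group⟩
    have h := (flipElt_conj_near hρ hk hU hi hg').inv fun _ => circleRel_inv
    refine ((NearSum.of_eq fun κ hκ => ?_).trans (h.trans
      (NearSum.of_eq fun κ hκ => inv_one))).mono (by omega)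
    rw [← flipElt_inv (hF.f_inv κ) (hF.length κ hκ), inv_inv]

end Circles

section Minimality

open FreeGroup
open scoped Classical

variable {α ι : Type*} [DecidableEq α] {ρ : ι → List (α × Bool)} {k : ℕ} {I : Set ι}
  {U : Finset (ι × ℕ)}

/-- The flip map attached to the colour `κ`. -/
noncomputable def circleFlip (ρ : ι → List (α × Bool)) (k : ℕ) (κ : ι × ℕ) :
    FreeGroup α → FreeGroup α :=
  flipElt k (circleWin k (ρ κ.1) κ.2) (flipLetter ((ρ κ.1).rotate (κ.2 + k)))

theorem circleFlip_of_short {κ : ι × ℕ} (hk : 2 * k < (ρ κ.1).length) {x : FreeGroup α}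
    (hx : x.toWord.length < 2 * k + 1) : circleFlip ρ k κ x = x := by
  rw [circleFlip, flipElt, flipWord_of_short (length_circleWin hk) hx, mk_toWord]

theorem circleFlip_mul_inv_mem (κ : ι × ℕ) (x : FreeGroup α) :
    circleFlip ρ k κ x * x⁻¹ ∈ Subgroup.normalClosure (circleRel ρ) := by
  have h := near_flipWord (R := circleRel ρ) (k := k) (W := circleWin k (ρ κ.1) κ.2)
    (fun _ => circleRel_inv)
    (flipLetter_near (fun _ => circleRel_inv) (mk_rotate_mem κ.1 (κ.2 + k))) x.toWord
  rw [mk_toWord] at h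
  exact Area.mem_normalClosure h

theorem circleFlip_prod_cells_near (hρ : ∀ i, IsCyclicallyReduced (ρ i))
    (hk : ∀ i ∈ I, 2 * k < (ρ i).length)
    (hU : ∀ κ ∈ U, κ.1 ∈ I ∧ κ.2 < (ρ κ.1).length ∧ UniqueIn ρ k I κ)
    {idx : FreeGroup α → ι} {L : List (FreeGroup α)}
    (hL : ∀ g ∈ L, idx g ∈ I ∧ IsCell ρ (idx g) g) :
    NearSum (circleRel ρ) U
      (L.map fun g => 12 * k + (U.filter (fun κ => κ.1 ≠ idx g)).card).sum
      (fun κ => circleFlip ρ k κ L.prod) (fun _ => 1) := by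
  have hF := flipFamily_circles hk hU
  induction L with
  | nil =>
    refine NearSum.of_eq fun κ hκ => ?_
    simp [circleFlip, flipElt, flipWord, flipProd]
  | cons x L ih =>
    have h1 := hL x (by simp)
    have h2 := flipElt_cell_near hρ hk hU h1.1 h1.2
    have h3 := ih fun g hg => hL g (by simp [hg])
    rw [List.map_cons, List.sum_cons]
    refine (((hF.flipElt_mul x L.prod).trans (h2.mul h3)).trans
      (NearSum.of_eq fun κ _ => mul_one _)).mono ?_
    omega

variable {V : Type*} [DecidableEq V]

theorem lift_circleFlip_near (hρ : ∀ i, IsCyclicallyReduced (ρ i))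
    (hk : ∀ i ∈ I, 2 * k < (ρ i).length)
    (hU : ∀ κ ∈ U, κ.1 ∈ I ∧ κ.2 < (ρ κ.1).length ∧ UniqueIn ρ k I κ)
    {idx : FreeGroup α → ι} {L : List (FreeGroup α)}
    (hL : ∀ g ∈ L, idx g ∈ I ∧ IsCell ρ (idx g) g) (θ : V → FreeGroup α) (e : FreeGroup V)
    (he : L.prod = FreeGroup.lift θ e) :
    NearSum (circleRel ρ) U (6 * k * e.toWord.length +
      (L.map fun g => 12 * k + (U.filter (fun κ => κ.1 ≠ idx g)).card).sum)
      (fun κ => FreeGroup.lift (fun v => circleFlip ρ k κ (θ v)) e) (fun _ => 1) := by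
  have hF := flipFamily_circles hk hU
  have h1 := hF.flipElt_prod (e.toWord.map fun x => cond x.2 (θ x.1) (θ x.1)⁻¹)
  have h2 := circleFlip_prod_cells_near hρ hk hU hL
  rw [he] at h2
  rw [← lift_mk, mk_toWord, List.length_map] at h1
  refine (((NearSum.of_eq fun κ hκ => ?_).trans (h1.symm fun _ => circleRel_inv)).trans
    h2).mono (by omega)
  conv_lhs => rw [← mk_toWord (x := e), lift_mk]
  rw [List.map_map]
  congr 1
  refine List.map_congr_left fun x _ => ?_
  rcases hx : x.2
  · simp only [Function.comp_apply, hx, cond_false]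
    exact (flipElt_inv (hF.f_inv κ) (hF.length κ hκ) _).symm
  · simp only [Function.comp_apply, hx, cond_true]
    rfl

theorem sum_card_le_of_minimal (hρ : ∀ i, IsCyclicallyReduced (ρ i))
    (hk : ∀ i ∈ I, 2 * k < (ρ i).length)
    (hU : ∀ κ ∈ U, κ.1 ∈ I ∧ κ.2 < (ρ κ.1).length ∧ UniqueIn ρ k I κ)
    {idx : FreeGroup α → ι} {E : Finset (FreeGroup V)} {Ls : FreeGroup V → List (FreeGroup α)}
    (hL : ∀ e ∈ E, ∀ g ∈ Ls e, idx g ∈ I ∧ IsCell ρ (idx g) g) (θ : V → FreeGroup α)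
    (he : ∀ e ∈ E, (Ls e).prod = FreeGroup.lift θ e)
    (hmin : ∀ κ ∈ U, ∀ c : FreeGroup V → ℕ,
      (∀ e ∈ E, FreeGroup.lift (fun v => circleFlip ρ k κ (θ v)) e ∈ Area (circleRel ρ) (c e)) →
      ∑ e ∈ E, (Ls e).length ≤ ∑ e ∈ E, c e) :
    ∑ e ∈ E, ((Ls e).map fun g => (U.filter (fun κ => κ.1 = idx g)).card).sum ≤
      6 * k * ∑ e ∈ E, e.toWord.length + 12 * k * ∑ e ∈ E, (Ls e).length := by
  have h1 : ∀ e ∈ E, _ := fun e hE => lift_circleFlip_near hρ hk hU (hL e hE) θ e (he e hE)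
  choose! c hc hc' using h1
  have h2 : U.card * ∑ e ∈ E, (Ls e).length ≤ ∑ e ∈ E, ∑ κ ∈ U, c e κ := by
    rw [Finset.sum_comm, ← smul_eq_mul]
    refine Finset.card_nsmul_le_sum _ _ _ fun κ hκ => hmin κ hκ _ fun e hE => ?_
    simpa [Near] using hc e hE κ hκ
  have h3 := h2.trans (Finset.sum_le_sum hc')
  have h4 : ∀ L : List (FreeGroup α),
      (L.map fun g => 12 * k + (U.filter (fun κ => κ.1 ≠ idx g)).card).sum +
      (L.map fun g => (U.filter (fun κ => κ.1 = idx g)).card).sum =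
      12 * k * L.length + U.card * L.length := by
    intro L
    induction L with
    | nil => simp
    | cons g L ih =>
      simp only [List.map_cons, List.sum_cons, List.length_cons]
      have h5 : (U.filter (fun κ => κ.1 = idx g)).card +
          (U.filter (fun κ => κ.1 ≠ idx g)).card = U.card :=
        Finset.card_filter_add_card_filter_not _
      simp only [mul_add, mul_one]
      omega
  have h5 := Finset.sum_congr (rfl : E = E) fun e _ => h4 (Ls e)
  rw [Finset.sum_add_distrib, Finset.sum_add_distrib, ← Finset.mul_sum, ← Finset.mul_sum] at h5
  rw [Finset.sum_add_distrib, ← Finset.mul_sum] at h3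
  omega

theorem exists_lift_of_unique (hρ : ∀ i, IsCyclicallyReduced (ρ i)) {E : Finset (FreeGroup V)}
    {C ℓ k₁ k₂ : ℕ} (hC : ∑ e ∈ E, e.toWord.length ≤ C) (hk₁ : 16 * k₁ ≤ ℓ)
    (hk₁₂ : k₂ ≤ k₁) (hk₂ : 84 * k₂ * C < ℓ) (hlen : ∀ i, 7 * ℓ ≤ 8 * (ρ i).length)
    (huniq₁ : ∀ i, ∀ q < (ρ i).length, UniqueIn ρ k₁ Set.univ (i, q))
    (huniq₂ : ∀ I : Finset ι, I.Nonempty → I.card ≤ 3 * C → ∃ U : Finset (ι × ℕ),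
      ℓ ≤ 2 * U.card ∧ ∀ κ ∈ U, κ.1 ∈ I ∧ κ.2 < (ρ κ.1).length ∧ UniqueIn ρ k₂ I κ)
    (S : Set V) (θ₀ : V → FreeGroup α) (hS : ∀ v ∈ S, (θ₀ v).toWord.length ≤ 2 * k₂)
    (hθ₀ : ∀ e ∈ E, FreeGroup.lift θ₀ e ∈ Subgroup.normalClosure (circleRel ρ)) :
    ∃ θ : V → FreeGroup α,
      (∀ v, θ v * (θ₀ v)⁻¹ ∈ Subgroup.normalClosure (circleRel ρ)) ∧
      (∀ v ∈ S, θ v = θ₀ v) ∧ ∀ e ∈ E, FreeGroup.lift θ e = 1 := by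
  have hk : ∀ i, 2 * k₁ < (ρ i).length := fun i => by have := hlen i; omega
  let Adm : (V → FreeGroup α) → Prop := fun θ =>
    (∀ v, θ v * (θ₀ v)⁻¹ ∈ Subgroup.normalClosure (circleRel ρ)) ∧ ∀ v ∈ S, θ v = θ₀ v
  have hAdm : ∀ θ, Adm θ → ∀ k, k₂ ≤ k → k ≤ k₁ → ∀ κ,
      Adm fun v => circleFlip ρ k κ (θ v) := by
    refine fun θ hθ k h h' κ => ⟨fun v => ?_, fun v hv => ?_⟩
    · have := mul_mem (circleFlip_mul_inv_mem (ρ := ρ) (k := k) κ (θ v)) (hθ.1 v)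
      rwa [mul_assoc, inv_mul_cancel_left] at this
    · beta_reduce
      rw [hθ.2 v hv]
      refine circleFlip_of_short ?_ ?_
      · have := hk κ.1; omega
      · have := hS v hv; omega
  let P : ℕ → Prop := fun F => ∃ (θ : V → FreeGroup α) (c : FreeGroup V → ℕ), Adm θ ∧
    (∀ e ∈ E, FreeGroup.lift θ e ∈ Area (circleRel ρ) (c e)) ∧ ∑ e ∈ E, c e = F
  have hP : ∃ F, P F := by
    have := fun e (he : e ∈ E) => exists_mem_area (fun _ => circleRel_inv) (hθ₀ e he)
    choose! c hc using this
    exact ⟨_, θ₀, c, ⟨fun v => by rw [mul_inv_cancel]; exact one_mem _, fun _ _ => rfl⟩,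
      hc, rfl⟩
  obtain ⟨θ, c, hθ, hc, hF⟩ := Nat.find_spec hP
  choose! Ls hLs1 hLs2 hLs3 using hc
  have hmin : ∀ (θ' : V → FreeGroup α) (c' : FreeGroup V → ℕ), Adm θ' →
      (∀ e ∈ E, FreeGroup.lift θ' e ∈ Area (circleRel ρ) (c' e)) →
      ∑ e ∈ E, (Ls e).length ≤ ∑ e ∈ E, c' e := fun θ' c' h1 h2 =>
    (Finset.sum_le_sum hLs1).trans (hF.le.trans (Nat.find_min' hP ⟨θ', c', h1, h2, rfl⟩))
  refine ⟨θ, hθ.1, hθ.2, ?_⟩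
  by_cases h0 : ∀ e ∈ E, Ls e = []
  · intro e he
    rw [← hLs3 e he, h0 e he, List.prod_nil]
  exfalso
  push Not at h0
  obtain ⟨e₀, he₀, hne⟩ := h0
  obtain ⟨g₀, hg₀⟩ := List.exists_mem_of_ne_nil _ hne
  have hι : Nonempty ι := (exists_isCell_of_mem (hLs2 e₀ he₀ g₀ hg₀)).nonempty
  have hidx : ∀ g : FreeGroup α, g ∈ Group.conjugatesOfSet (circleRel ρ) →
      ∃ i, IsCell ρ i g := fun g => exists_isCell_of_mem
  choose! idx hidx using hidx
  set F := ∑ e ∈ E, (Ls e).length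
  let I : Finset ι := E.biUnion fun e => (Ls e).toFinset.image idx
  have hI : ∀ e ∈ E, ∀ g ∈ Ls e, idx g ∈ I := fun e he g hg =>
    Finset.mem_biUnion.2 ⟨e, he, Finset.mem_image_of_mem _ (List.mem_toFinset.2 hg)⟩
  have hIF : I.card ≤ F := Finset.card_biUnion_le.trans (Finset.sum_le_sum fun e _ =>
    Finset.card_image_le.trans (List.toFinset_card_le _))
  have hle : F ≤ 3 * C := by
    let U : Finset (ι × ℕ) := I.sigma (fun i => Finset.range (ρ i).length) |>.map
      (Equiv.sigmaEquivProd ι ℕ).toEmbedding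
    have hUm : ∀ κ : ι × ℕ, κ ∈ U ↔ κ.1 ∈ I ∧ κ.2 < (ρ κ.1).length := by
      rintro ⟨i, q⟩
      simp [U]
    have h1 := sum_card_le_of_minimal (k := k₁) (I := Set.univ) (U := U) (idx := idx)
      (Ls := Ls) hρ (fun i _ => hk i)
      (fun κ hκ => ⟨trivial, ((hUm κ).1 hκ).2, huniq₁ κ.1 κ.2 ((hUm κ).1 hκ).2⟩)
      (fun e he g hg => ⟨trivial, hidx g (hLs2 e he g hg)⟩) θ hLs3
      (fun κ hκ c' => hmin _ c' (hAdm θ hθ k₁ hk₁₂ le_rfl κ))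
    have h2 : ∀ e ∈ E, 7 * ℓ * (Ls e).length ≤
        8 * ((Ls e).map fun g => (U.filter (fun κ => κ.1 = idx g)).card).sum := by
      intro e he
      rw [← List.sum_map_mul_left]
      refine le_trans (le_of_eq ?_)
        (List.card_nsmul_le_sum _ (7 * ℓ) fun x hx => ?_)
      · simp [mul_comm]
      · obtain ⟨g, hg, rfl⟩ := List.mem_map.1 hx
        refine (hlen (idx g)).trans (Nat.mul_le_mul_left _ ?_)
        have h3 : (Finset.range (ρ (idx g)).length).image (fun q => (idx g, q)) ⊆
            U.filter (fun κ => κ.1 = idx g) := by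
          intro κ hκ
          obtain ⟨q, hq, rfl⟩ := Finset.mem_image.1 hκ
          exact Finset.mem_filter.2 ⟨(hUm _).2 ⟨hI e he g hg, Finset.mem_range.1 hq⟩, rfl⟩
        have h4 := Finset.card_le_card h3
        rwa [Finset.card_image_of_injective _ (Prod.mk_right_injective _),
          Finset.card_range] at h4
    have h3 := Finset.sum_le_sum h2
    rw [← Finset.mul_sum, ← Finset.mul_sum] at h3
    by_contra h4
    have h5 : 16 * k₁ * F ≤ ℓ * F := Nat.mul_le_mul_right _ hk₁
    have h6 : 16 * k₁ * ∑ e ∈ E, e.toWord.length ≤ ℓ * C := Nat.mul_le_mul hk₁ hC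
    have h7 : ℓ * (3 * C + 1) ≤ ℓ * F := Nat.mul_le_mul_left _ (by omega)
    change _ ≤ 6 * k₁ * _ + 12 * k₁ * F at h1
    change 7 * ℓ * F ≤ _ at h3
    simp only [mul_assoc, mul_add, mul_one, mul_left_comm ℓ] at *
    omega
  obtain ⟨U, hU1, hU2⟩ := huniq₂ I ⟨_, hI e₀ he₀ g₀ hg₀⟩ (hIF.trans hle)
  have h1 := sum_card_le_of_minimal (k := k₂) (I := I) (U := U) (idx := idx)
    (Ls := Ls) hρ (fun i _ => by have := hk i; omega) hU2
    (fun e he g hg => ⟨hI e he g hg, hidx g (hLs2 e he g hg)⟩) θ hLs3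
    (fun κ hκ c' => hmin _ c' (hAdm θ hθ k₂ le_rfl hk₁₂ κ))
  have h2 : U.card ≤
      ∑ e ∈ E, ((Ls e).map fun g => (U.filter (fun κ => κ.1 = idx g)).card).sum := by
    have h3 : U ⊆ E.biUnion fun e => (Ls e).toFinset.biUnion fun g =>
        U.filter (fun κ => κ.1 = idx g) := by
      intro κ hκ
      obtain ⟨e, he, h⟩ := Finset.mem_biUnion.1 (hU2 κ hκ).1
      obtain ⟨g, hg, h⟩ := Finset.mem_image.1 h
      exact Finset.mem_biUnion.2 ⟨e, he, Finset.mem_biUnion.2 ⟨g, hg,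
        Finset.mem_filter.2 ⟨hκ, h.symm⟩⟩⟩
    refine (Finset.card_le_card h3).trans (Finset.card_biUnion_le.trans
      (Finset.sum_le_sum fun e _ => Finset.card_biUnion_le.trans ?_))
    rw [Finset.sum_list_map_count]
    refine Finset.sum_le_sum fun g hg => ?_
    rw [smul_eq_mul]
    exact Nat.le_mul_of_pos_left _ (List.count_pos_iff.2 (List.mem_toFinset.1 hg))
  have h3 : 6 * k₂ * ∑ e ∈ E, e.toWord.length ≤ 6 * k₂ * C := Nat.mul_le_mul_left _ hC
  have h4 : 12 * k₂ * F ≤ 12 * k₂ * (3 * C) := Nat.mul_le_mul_left _ hle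
  change _ ≤ 6 * k₂ * _ + 12 * k₂ * F at h1
  have h5 : U.card ≤ 42 * (k₂ * C) := h2.trans (h1.trans ((add_le_add h3 h4).trans
    (le_of_eq (by ring))))
  have h6 : 84 * k₂ * C = 84 * (k₂ * C) := by ring
  omega

end Minimality

section Counting

open scoped Classical

theorem Finset.card_le_prod_of_eq_before {A X Λ : Type*} [LinearOrder X] [Fintype X] (T : Finset A)
    (v : A → X → Λ) (w : X → ℕ) (hinj : ∀ r ∈ T, ∀ r' ∈ T, v r = v r' → r = r')
    (hw : ∀ r ∈ T, ∀ x, ∃ B : Finset Λ, B.card ≤ w x ∧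
      ∀ r' ∈ T, (∀ y < x, v r' y = v r y) → v r' x ∈ B) :
    T.card ≤ ∏ x, w x := by
  let f : Finset X → A → X → Option Λ := fun S r x => if x ∈ S then some (v r x) else none
  have key : ∀ S : Finset X, (∀ x ∈ S, ∀ y < x, y ∈ S) →
      (T.image (f S)).card ≤ ∏ x ∈ S, w x := by
    intro S
    induction S using Finset.induction_on_max with
    | empty =>
      intro _
      rw [Finset.prod_empty]
      refine Finset.card_le_one.2 fun a ha b hb => ?_
      obtain ⟨r, -, rfl⟩ := Finset.mem_image.1 ha
      obtain ⟨r', -, rfl⟩ := Finset.mem_image.1 hb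
      funext x
      simp [f]
    | insert a S ha ih =>
      intro hS
      have haS : a ∉ S := fun h => lt_irrefl _ (ha a h)
      have hS' : ∀ x ∈ S, ∀ y < x, y ∈ S := fun x hx y hy =>
        (Finset.mem_insert.1 (hS x (Finset.mem_insert_of_mem hx) y hy)).resolve_left
          (hy.trans (ha x hx)).ne
      have hlt : ∀ y, y < a ↔ y ∈ S := fun y => ⟨fun h =>
        (Finset.mem_insert.1 (hS a (Finset.mem_insert_self _ _) y h)).resolve_left h.ne, ha y⟩
      rw [Finset.prod_insert haS]
      refine (Finset.card_le_mul_card_image_of_maps_to (t := T.image (f S))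
        (f := fun F x => if x ∈ S then F x else none) (fun F hF => ?_) (w a)
        (fun F hF => ?_)).trans (Nat.mul_le_mul_left _ (ih hS'))
      · obtain ⟨r, hr, rfl⟩ := Finset.mem_image.1 hF
        refine Finset.mem_image.2 ⟨r, hr, funext fun x => ?_⟩
        by_cases hx : x ∈ S <;> simp [f, hx]
      · obtain ⟨r, hr, rfl⟩ := Finset.mem_image.1 hF
        obtain ⟨B, hB, hB'⟩ := hw r hr a
        refine le_trans ?_ hB
        rw [← Finset.card_image_of_injective _ (Option.some_injective Λ)]
        have hmem : ∀ F ∈ (T.image (f (insert a S))).filter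
            (fun F => (fun x => if x ∈ S then F x else none) = f S r),
            ∃ r' ∈ T, f (insert a S) r' = F ∧ ∀ y < a, v r' y = v r y := by
          intro F hF
          obtain ⟨h1, h2⟩ := Finset.mem_filter.1 hF
          obtain ⟨r', hr', rfl⟩ := Finset.mem_image.1 h1
          refine ⟨r', hr', rfl, fun y hy => ?_⟩
          have := congrFun h2 y
          simpa [f, (hlt y).1 hy] using this
        refine Finset.card_le_card_of_injOn (fun F => F a) (fun F hF => ?_) ?_
        · obtain ⟨r', hr', rfl, h⟩ := hmem F hF
          refine Finset.mem_image.2 ⟨v r' a, hB' r' hr' h, ?_⟩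
          simp [f]
        · intro F hF F' hF' he
          obtain ⟨r', hr', rfl, h⟩ := hmem F hF
          obtain ⟨r'', hr'', rfl, h'⟩ := hmem F' hF'
          funext x
          by_cases hx : x = a
          · subst hx
            exact he
          · by_cases hxS : x ∈ S
            · have h1 := h x ((hlt x).2 hxS)
              have h2 := h' x ((hlt x).2 hxS)
              simp [f, hxS, h1, h2]
            · simp [f, hx, hxS]
  refine le_trans (Finset.card_le_card_of_injOn (f Finset.univ)
    (fun r hr => Finset.mem_image_of_mem _ hr) fun r hr r' hr' he => ?_)
    (key Finset.univ fun _ _ _ _ => Finset.mem_univ _)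
  refine hinj r hr r' hr' (funext fun x => ?_)
  simpa [f] using congrFun he x

variable {X : Type*} [LinearOrder X] [Fintype X]

/-- The points that are linked by `G` to a smaller point. -/
noncomputable def linkedSet (G : X → X → Prop) : Finset X :=
  Finset.univ.filter fun x => ∃ y < x, Relation.EqvGen G y x

theorem card_le_two_mul_card_linkedSet {G : X → X → Prop} {Q : Finset X}
    (hQ : ∀ x ∈ Q, ∃ y ≠ x, G x y ∨ G y x) : Q.card ≤ 2 * (linkedSet G).card := by
  have h1 : ∀ x ∈ Q, ∃ y ≠ x, Relation.EqvGen G x y := fun x hx => by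
    obtain ⟨y, hy, h | h⟩ := hQ x hx
    · exact ⟨y, hy, .rel _ _ h⟩
    · exact ⟨y, hy, .symm _ _ (.rel _ _ h)⟩
  choose! f hf hf' using h1
  have h2 : (Q.filter (· ∉ linkedSet G)).card ≤ (linkedSet G).card := by
    refine Finset.card_le_card_of_injOn f (fun x hx => ?_) ?_
    · obtain ⟨hxQ, hx⟩ := Finset.mem_filter.1 hx
      refine Finset.mem_filter.2 ⟨Finset.mem_univ _, x, ?_, hf' x hxQ⟩
      refine lt_of_not_ge fun h => hx (Finset.mem_filter.2 ⟨Finset.mem_univ _, f x,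
        lt_of_le_of_ne h (hf x hxQ), .symm _ _ (hf' x hxQ)⟩)
    · intro x hx y hy he
      obtain ⟨hxQ, hx⟩ := Finset.mem_filter.1 hx
      obtain ⟨hyQ, hy⟩ := Finset.mem_filter.1 hy
      have hxy : Relation.EqvGen G x y :=
        .trans _ _ _ (hf' x hxQ) (he ▸ .symm _ _ (hf' y hyQ))
      by_contra hne
      rcases lt_or_gt_of_ne hne with h | h
      · exact hy (Finset.mem_filter.2 ⟨Finset.mem_univ _, x, h, hxy⟩)
      · exact hx (Finset.mem_filter.2 ⟨Finset.mem_univ _, y, h, .symm _ _ hxy⟩)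
  have h3 : (Q.filter (· ∈ linkedSet G)).card ≤ (linkedSet G).card :=
    Finset.card_le_card fun x hx => (Finset.mem_filter.1 hx).2
  have h4 : (Q.filter (· ∈ linkedSet G)).card + (Q.filter (· ∉ linkedSet G)).card = Q.card :=
    Finset.card_filter_add_card_filter_not _
  omega

theorem Finset.card_le_prod_of_linked {A Λ : Type*} (T : Finset A) (v : A → X → Λ) (w : X → ℕ)
    (hinj : ∀ r ∈ T, ∀ r' ∈ T, v r = v r' → r = r')
    (hw : ∀ r ∈ T, ∀ x, ∃ B : Finset Λ, B.card ≤ w x ∧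
      ∀ r' ∈ T, (∀ y < x, v r' y = v r y) → v r' x ∈ B)
    {G : X → X → Prop}
    (hG : ∀ x y, G x y → ∀ r ∈ T, ∀ r' ∈ T, v r x = v r' x ↔ v r y = v r' y) :
    T.card ≤ ∏ x, if x ∈ linkedSet G then 1 else w x := by
  refine T.card_le_prod_of_eq_before v _ hinj fun r hr x => ?_
  split_ifs with hx
  · obtain ⟨-, y, hy, h⟩ := Finset.mem_filter.1 hx
    have key : ∀ r' ∈ T, v r y = v r' y ↔ v r x = v r' x := by
      intro r' hr'
      clear hx hy
      induction h with
      | rel a b h => exact hG a b h r hr r' hr'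
      | refl => rfl
      | symm a b _ ih => exact ih.symm
      | trans a b c _ _ ih ih' => exact ih.trans ih'
    exact ⟨{v r x}, by simp, fun r' hr' h' =>
      Finset.mem_singleton.2 ((key r' hr').1 (h' y hy).symm).symm⟩
  · exact hw r hr x

end Counting

section Words

open FreeGroup
open scoped Classical

theorem finite_words (n ℓ : ℕ) : {x : FreeGroup (Fin n) | x.toWord.length = ℓ}.Finite :=
  (List.finite_length_eq (Fin n × Bool) ℓ).preimage toWord_injective.injOn

/-- The set of elements of length `ℓ` of the free group on `n` generators. -/
noncomputable def words (n ℓ : ℕ) : Finset (FreeGroup (Fin n)) :=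
  (finite_words n ℓ).toFinset

theorem mem_words {n ℓ : ℕ} {x : FreeGroup (Fin n)} : x ∈ words n ℓ ↔ x.toWord.length = ℓ := by
  simp [words]

theorem card_ne_inv (n : ℕ) (l : Fin n × Bool) :
    (Finset.univ.filter fun x : Fin n × Bool => x ≠ (l.1, !l.2)).card = 2 * n - 1 := by
  rw [Finset.filter_ne', Finset.card_erase_of_mem (Finset.mem_univ _)]
  simp [mul_comm]

theorem ne_inv_iff {n : ℕ} {a b : Fin n × Bool} : (a.1 = b.1 → a.2 = b.2) ↔ b ≠ (a.1, !a.2) := by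
  rcases a with ⟨a, a'⟩
  rcases b with ⟨b, b'⟩
  cases a' <;> cases b' <;> simp [eq_comm]

theorem pow_le_card_words (n ℓ : ℕ) : (2 * n - 1) ^ ℓ ≤ (words n ℓ).card := by
  induction ℓ with
  | zero =>
    simpa using Finset.card_pos.2 ⟨1, mem_words.2 (by simp)⟩
  | succ ℓ ih =>
    rw [pow_succ, mul_comm]
    refine (Nat.mul_le_mul_left _ ih).trans
      (Finset.mul_card_image_le_card_of_maps_to (f := fun x => mk x.toWord.tail)
        (fun x hx => ?_) _ fun y hy => ?_)
    · rw [mem_words] at hx ⊢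
      have h : FreeGroup.IsReduced x.toWord.tail := List.IsChain.tail isReduced_toWord
      rw [toWord_mk, h.reduce_eq, List.length_tail, hx, Nat.add_sub_cancel]
    · have hred : ∀ l : Fin n × Bool, (∀ a ∈ y.toWord.head?, a ≠ (l.1, !l.2)) →
          (mk (l :: y.toWord)).toWord = l :: y.toWord := fun l hl => by
        have : FreeGroup.IsReduced (l :: y.toWord) :=
          List.isChain_cons.2 ⟨fun a ha => ne_inv_iff.2 (hl a ha), isReduced_toWord⟩
        rw [toWord_mk, this.reduce_eq]
      have hle : 2 * n - 1 ≤ (Finset.univ.filter fun l : Fin n × Bool =>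
          ∀ a ∈ y.toWord.head?, a ≠ (l.1, !l.2)).card := by
        rcases h : y.toWord.head? with _ | a
        · simp [mul_comm]
        · rw [← card_ne_inv n a]
          refine Finset.card_le_card fun l hl => ?_
          simp only [Finset.mem_filter, Finset.mem_univ, true_and, Option.mem_def,
            Option.some.injEq, forall_eq'] at hl ⊢
          rintro rfl
          simp at hl
      refine hle.trans (Finset.card_le_card_of_injOn (fun l => mk (l :: y.toWord))
        (fun l hl => ?_) fun l hl l' hl' he => ?_)
      · have h := hred l (Finset.mem_filter.1 hl).2
        refine Finset.mem_coe.2 (Finset.mem_filter.2 ⟨?_, ?_⟩)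
        · rw [mem_words, h, List.length_cons, mem_words.1 hy]
        · rw [h, List.tail_cons, mk_toWord]
      · have h := hred l (Finset.mem_filter.1 hl).2
        have h' := hred l' (Finset.mem_filter.1 hl').2
        dsimp only at he
        rw [he, h'] at h
        exact (List.cons.inj h).1.symm

/-- The letter `l`, inverted if `ε` holds. -/
def signed {n : ℕ} (ε : Bool) (l : Fin n × Bool) : Fin n × Bool := (l.1, xor ε l.2)

theorem signed_injective {n : ℕ} (ε : Bool) : Function.Injective (signed (n := n) ε) := by
  rintro ⟨a, a'⟩ ⟨b, b'⟩ h
  simpa [signed] using h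

theorem card_le_of_edges {n s ℓ : ℕ} (hn : 2 ≤ n) (T : Finset (Fin s → FreeGroup (Fin n)))
    (hT : ∀ r ∈ T, ∀ i, (r i).toWord.length = ℓ)
    (E : Fin s × ℕ → Fin s × ℕ → Bool → Prop)
    (hE : ∀ r ∈ T, ∀ x y ε, E x y ε → x.2 < ℓ → y.2 < ℓ →
      (r x.1).toWord[x.2]? = ((r y.1).toWord[y.2]?).map (signed ε))
    (Q : Finset (Fin s × ℕ))
    (hQ : ∀ x ∈ Q, x.2 < ℓ ∧ ∃ y ≠ x, y.2 < ℓ ∧ ∃ ε, E x y ε ∨ E y x ε) {D : ℕ}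
    (hD : 2 * D ≤ Q.card + 1) :
    T.card * (2 * n - 1) ^ D ≤ (2 * n) ^ s * (2 * n - 1) ^ (s * ℓ) := by
  let X := Fin s ×ₗ Fin ℓ
  let v : (Fin s → FreeGroup (Fin n)) → X → Option (Fin n × Bool) := fun r x =>
    (r (ofLex x).1).toWord[((ofLex x).2 : ℕ)]?
  let w : X → ℕ := fun x => if ((ofLex x).2 : ℕ) = 0 then 2 * n else 2 * n - 1
  let G : X → X → Prop := fun x y =>
    ∃ ε, E ((ofLex x).1, (ofLex x).2) ((ofLex y).1, (ofLex y).2) ε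
  have h1 : T.card ≤ ∏ x, if x ∈ linkedSet G then 1 else w x := by
    refine T.card_le_prod_of_linked v w (fun r hr r' hr' h => ?_) (fun r hr x => ?_)
      (fun x y hxy r hr r' hr' => ?_)
    · refine funext fun i => toWord_injective (List.ext_getElem? fun t => ?_)
      by_cases ht : t < ℓ
      · exact congrFun h (toLex (i, ⟨t, ht⟩))
      · rw [List.getElem?_eq_none (by rw [hT r hr]; omega),
          List.getElem?_eq_none (by rw [hT r' hr']; omega)]
    · obtain ⟨⟨i, t, ht⟩, rfl⟩ := toLex.surjective x
      by_cases h0 : t = 0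
      · have h2 : w (toLex (i, ⟨t, ht⟩)) = 2 * n := if_pos h0
        rw [h2]
        refine ⟨Finset.univ.image some, Finset.card_image_le.trans (by simp [mul_comm]),
          fun r' hr' _ => ?_⟩
        have h3 : t < (r' i).toWord.length := by rw [hT r' hr']; exact ht
        exact Finset.mem_image.2 ⟨_, Finset.mem_univ _, (List.getElem?_eq_getElem h3).symm⟩
      · have h2 : w (toLex (i, ⟨t, ht⟩)) = 2 * n - 1 := if_neg h0
        obtain ⟨t, rfl⟩ := Nat.exists_eq_succ_of_ne_zero h0
        have h4 : t < (r i).toWord.length := by rw [hT r hr]; omega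
        rw [h2, ← card_ne_inv n ((r i).toWord[t])]
        refine ⟨(Finset.univ.filter
          fun x : Fin n × Bool => x ≠ ((r i).toWord[t].1, !(r i).toWord[t].2)).image some,
          Finset.card_image_le, fun r' hr'1 hr'2 => ?_⟩
        have h3 : t + 1 < (r' i).toWord.length := by rw [hT r' hr'1]; exact ht
        refine Finset.mem_image.2 ⟨(r' i).toWord[t + 1], Finset.mem_filter.2
          ⟨Finset.mem_univ _, ?_⟩, (List.getElem?_eq_getElem h3).symm⟩
        have h5 : (r' i).toWord[t]? = (r i).toWord[t]? :=
          hr'2 (toLex (i, ⟨t, by omega⟩)) (Prod.Lex.toLex_lt_toLex.2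
            (Or.inr ⟨rfl, Fin.mk_lt_mk.2 (Nat.lt_succ_self t)⟩))
        rw [List.getElem?_eq_getElem h4, List.getElem?_eq_getElem (by omega),
          Option.some.injEq] at h5
        rw [← h5, ← ne_inv_iff]
        exact List.isChain_iff_getElem.1 (isReduced_toWord (x := r' i)) t h3
    · obtain ⟨ε, hε⟩ := hxy
      have h2 := hE r hr _ _ ε hε (ofLex x).2.2 (ofLex y).2.2
      have h3 := hE r' hr' _ _ ε hε (ofLex x).2.2 (ofLex y).2.2
      simp only [v]
      rw [h2, h3, (Option.map_injective (signed_injective ε)).eq_iff]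
  have h2 : Q.card ≤ 2 * (linkedSet G).card := by
    have h3 : (Q.attach.image fun x =>
        (toLex (x.1.1, ⟨x.1.2, (hQ x.1 x.2).1⟩) : X)).card = Q.card := by
      rw [Finset.card_image_of_injective, Finset.card_attach]
      rintro ⟨⟨i, t⟩, hx⟩ ⟨⟨i', t'⟩, hx'⟩ h
      have := toLex.injective h
      simp only [Prod.mk.injEq, Fin.mk.injEq] at this
      simp [this]
    rw [← h3]
    refine card_le_two_mul_card_linkedSet fun z hz => ?_
    obtain ⟨⟨x, hx⟩, -, rfl⟩ := Finset.mem_image.1 hz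
    obtain ⟨hx', y, hne, hy, ε, h⟩ := hQ x hx
    refine ⟨toLex (y.1, ⟨y.2, hy⟩), fun h' => hne ?_, h.imp (fun h => ⟨ε, h⟩) fun h => ⟨ε, h⟩⟩
    have := toLex.injective h'
    simp only [Prod.mk.injEq, Fin.mk.injEq] at this
    exact Prod.ext this.1 this.2
  have h3 : ∏ x, (if x ∈ linkedSet G then 1 else w x) ≤
      ∏ x : X, (if ((ofLex x).2 : ℕ) = 0 then 2 * n else 1) *
        (if x ∈ linkedSet G then 1 else 2 * n - 1) := by
    refine Finset.prod_le_prod' fun x _ => ?_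
    by_cases hx : x ∈ linkedSet G <;> by_cases h : ((ofLex x).2 : ℕ) = 0 <;>
      simp only [hx, h, w, if_true, if_false] <;>
        nlinarith [Nat.sub_add_cancel (show 1 ≤ 2 * n by omega)]
  have h4 : ∏ x : X, (if ((ofLex x).2 : ℕ) = 0 then 2 * n else 1) ≤ (2 * n) ^ s := by
    rw [Finset.prod_ite, Finset.prod_const, Finset.prod_const_one, mul_one]
    refine Nat.pow_le_pow_right (by omega) ?_
    refine (Finset.card_le_card_of_injOn (t := Finset.univ) (fun x => (ofLex x).1)
      (by simp) fun x hx y hy h => ?_).trans (by simp)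
    have hx := (Finset.mem_filter.1 hx).2
    have hy := (Finset.mem_filter.1 hy).2
    exact ofLex.injective (Prod.ext h (Fin.ext (hx.trans hy.symm)))
  have h5 : (∏ x : X, if x ∈ linkedSet G then 1 else 2 * n - 1) * (2 * n - 1) ^ D ≤
      (2 * n - 1) ^ (s * ℓ) := by
    rw [Finset.prod_ite, Finset.prod_const_one, one_mul, Finset.prod_const, ← pow_add]
    refine Nat.pow_le_pow_right (by omega) ?_
    have h6 : (Finset.univ.filter fun x : X => x ∈ linkedSet G).card +
        (Finset.univ.filter fun x : X => x ∉ linkedSet G).card = Fintype.card X :=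
      Finset.card_filter_add_card_filter_not _
    have h7 : Fintype.card X = s * ℓ := by simp [X]
    have h8 : (linkedSet G).card = (Finset.univ.filter fun x : X => x ∈ linkedSet G).card := by
      simp
    omega
  calc T.card * (2 * n - 1) ^ D
      ≤ _ * (2 * n - 1) ^ D := Nat.mul_le_mul_right _ (h1.trans h3)
    _ ≤ _ := by
      rw [Finset.prod_mul_distrib, mul_assoc]
      exact Nat.mul_le_mul h4 h5

end Words

section Probability

open FreeGroup
open scoped Classical

theorem mem_piFinset_words {n ℓ N : ℕ} {r : Fin N → FreeGroup (Fin n)} :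
    r ∈ Fintype.piFinset (fun _ : Fin N => words n ℓ) ↔ r ∈ relTuples n ℓ N := by
  simp [relTuples, mem_words]

theorem relProb_eq (n ℓ N : ℕ) (P : (Fin N → FreeGroup (Fin n)) → Prop)
    [DecidablePred P] :
    relProb n ℓ N P = (((Fintype.piFinset fun _ : Fin N => words n ℓ).filter P).card : ℝ) /
      ((words n ℓ).card : ℝ) ^ N := by
  have h1 : {r ∈ relTuples n ℓ N | P r} =
      ((Fintype.piFinset fun _ : Fin N => words n ℓ).filter P : Set _) := by
    ext r
    rw [Finset.mem_coe, Finset.mem_filter, mem_piFinset_words]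
    rfl
  have h2 : relTuples n ℓ N = (Fintype.piFinset fun _ : Fin N => words n ℓ : Set _) := by
    ext r
    rw [Finset.mem_coe, mem_piFinset_words]
  rw [relProb, h1, h2, Set.ncard_coe_finset, Set.ncard_coe_finset, Fintype.card_piFinset]
  simp

theorem card_words_pos {n : ℕ} (hn : 2 ≤ n) (ℓ : ℕ) : 0 < (words n ℓ).card :=
  (Nat.pow_pos (by omega)).trans_le (pow_le_card_words n ℓ)

variable {n : ℕ} {d : ℝ}

theorem relProb_mono (hn : 2 ≤ n) {ℓ N : ℕ} {P Q : (Fin N → FreeGroup (Fin n)) → Prop}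
    (h : ∀ r ∈ relTuples n ℓ N, P r → Q r) : relProb n ℓ N P ≤ relProb n ℓ N Q := by
  rw [relProb_eq, relProb_eq]
  have := card_words_pos hn ℓ
  gcongr ?_ / _
  refine Nat.cast_le.2 (Finset.card_le_card fun r hr => ?_)
  obtain ⟨h1, h2⟩ := Finset.mem_filter.1 hr
  exact Finset.mem_filter.2 ⟨h1, h r (mem_piFinset_words.1 h1) h2⟩

theorem relProb_add_not (hn : 2 ≤ n) (ℓ N : ℕ) (P : (Fin N → FreeGroup (Fin n)) → Prop) :
    relProb n ℓ N P + relProb n ℓ N (fun r => ¬ P r) = 1 := by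
  rw [relProb_eq, relProb_eq, ← add_div, ← Nat.cast_add,
    Finset.card_filter_add_card_filter_not, Fintype.card_piFinset]
  have := card_words_pos hn ℓ
  rw [Finset.prod_const, Finset.card_univ, Fintype.card_fin, Nat.cast_pow]
  exact div_self (by positivity)

theorem relProb_nonneg (ℓ N : ℕ) (P : (Fin N → FreeGroup (Fin n)) → Prop) :
    0 ≤ relProb n ℓ N P := by
  rw [relProb]
  positivity

theorem relProb_or_le (ℓ N : ℕ) (P Q : (Fin N → FreeGroup (Fin n)) → Prop) :
    relProb n ℓ N (fun r => P r ∨ Q r) ≤ relProb n ℓ N P + relProb n ℓ N Q := by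
  rw [relProb_eq, relProb_eq, relProb_eq, ← add_div, ← Nat.cast_add]
  gcongr
  refine (Finset.card_le_card fun r hr => ?_).trans (Finset.card_union_le _ _)
  obtain ⟨h1, h2⟩ := Finset.mem_filter.1 hr
  exact Finset.mem_union.2 (h2.imp (fun h => Finset.mem_filter.2 ⟨h1, h⟩)
    fun h => Finset.mem_filter.2 ⟨h1, h⟩)

variable {P Q : ∀ ℓ : ℕ, (Fin (numRel n d ℓ) → FreeGroup (Fin n)) → Prop}

theorem wop_iff (hn : 2 ≤ n) :
    wop n d P ↔ Tendsto (fun ℓ => relProb n ℓ (numRel n d ℓ) fun r => ¬ P ℓ r) atTop (nhds 0) := by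
  have h : ∀ ℓ, relProb n ℓ (numRel n d ℓ) (fun r => ¬ P ℓ r) =
      1 - relProb n ℓ (numRel n d ℓ) (P ℓ) := fun ℓ =>
    eq_sub_of_add_eq' (relProb_add_not hn ℓ _ _)
  rw [wop]
  simp only [h]
  constructor
  · intro h
    simpa using h.const_sub 1
  · intro h
    simpa using h.const_sub 1

theorem wop.mono (hn : 2 ≤ n) (hP : wop n d P)
    (h : ∀ᶠ ℓ in atTop, ∀ r ∈ relTuples n ℓ (numRel n d ℓ), P ℓ r → Q ℓ r) : wop n d Q := by
  rw [wop_iff hn] at hP ⊢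
  refine tendsto_of_tendsto_of_tendsto_of_le_of_le' tendsto_const_nhds hP
    (.of_forall fun ℓ => relProb_nonneg _ _ _) (h.mono fun ℓ h => ?_)
  exact relProb_mono hn fun r hr => mt (h r hr)

theorem wop.and (hn : 2 ≤ n) (hP : wop n d P) (hQ : wop n d Q) :
    wop n d fun ℓ r => P ℓ r ∧ Q ℓ r := by
  rw [wop_iff hn] at hP hQ ⊢
  have h := hP.add hQ
  rw [add_zero] at h
  refine squeeze_zero (fun ℓ => relProb_nonneg _ _ _) (fun ℓ => ?_) h
  simp only [not_and_or]
  exact relProb_or_le _ _ _ _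

theorem wop_true (hn : 2 ≤ n) : wop n d fun _ _ => True := by
  rw [wop_iff hn]
  refine tendsto_const_nhds.congr fun ℓ => ?_
  simp [relProb]

theorem wop.ball (hn : 2 ≤ n) {κ : Type*} (F : Finset κ)
    {P : κ → ∀ ℓ : ℕ, (Fin (numRel n d ℓ) → FreeGroup (Fin n)) → Prop}
    (hP : ∀ c ∈ F, wop n d (P c)) : wop n d fun ℓ r => ∀ c ∈ F, P c ℓ r := by
  induction F using Finset.induction_on with
  | empty => simpa using wop_true hn
  | insert c F _ ih =>
    simp only [Finset.forall_mem_insert]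
    exact (hP c (Finset.mem_insert_self _ _)).and hn
      (ih fun c hc => hP c (Finset.mem_insert_of_mem hc))

theorem wop.eventually_exists (hP : wop n d P) :
    ∀ᶠ ℓ in atTop, ∃ r ∈ relTuples n ℓ (numRel n d ℓ), P ℓ r := by
  refine (Tendsto.eventually_ne hP one_ne_zero).mono fun ℓ h => ?_
  by_contra! hne
  refine h ?_
  have : {r ∈ relTuples n ℓ (numRel n d ℓ) | P ℓ r} = ∅ :=
    Set.eq_empty_of_forall_notMem fun r hr => hne r hr.1 hr.2
  rw [relProb, this]
  simp

theorem card_filter_comp_mul_le {α : Type*} {N s : ℕ} (W : Finset α) {e : Fin s → Fin N}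
    (he : Function.Injective e) (A : (Fin s → α) → Prop) :
    ((Fintype.piFinset fun _ : Fin N => W).filter fun r => A (r ∘ e)).card * W.card ^ s ≤
      ((Fintype.piFinset fun _ : Fin s => W).filter A).card * W.card ^ N := by
  have h : ∀ m, W.card ^ m = (Fintype.piFinset fun _ : Fin m => W).card := fun m => by simp
  rw [h s, h N, ← Finset.card_product, ← Finset.card_product]
  refine Finset.card_le_card_of_injOn
    (fun x => (x.1 ∘ e, Function.extend e x.2 x.1)) (fun x hx => ?_) fun x hx y hy hxy => ?_
  · obtain ⟨h1, h2⟩ := Finset.mem_product.1 hx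
    obtain ⟨h1, h3⟩ := Finset.mem_filter.1 h1
    rw [Fintype.mem_piFinset] at h1 h2
    refine Finset.mem_product.2 ⟨Finset.mem_filter.2 ⟨Fintype.mem_piFinset.2 fun i => h1 _, h3⟩,
      Fintype.mem_piFinset.2 fun i => ?_⟩
    by_cases hi : ∃ j, e j = i
    · obtain ⟨j, rfl⟩ := hi
      dsimp only
      rw [he.extend_apply]
      exact h2 j
    · dsimp only
      rw [Function.extend_apply' _ _ _ hi]
      exact h1 i
  · rw [Prod.mk.injEq] at hxy
    refine Prod.ext (funext fun i => ?_) (funext fun j => ?_)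
    · by_cases hi : ∃ j, e j = i
      · obtain ⟨j, rfl⟩ := hi
        exact congrFun hxy.1 j
      · have := congrFun hxy.2 i
        rwa [Function.extend_apply' _ _ _ hi, Function.extend_apply' _ _ _ hi] at this
    · have := congrFun hxy.2 (e j)
      rwa [he.extend_apply, he.extend_apply] at this

theorem relProb_exists_comp_le (hn : 2 ≤ n) {s ℓ N : ℕ} {τ : Type*} [Fintype τ]
    (Acc : τ → (Fin s → FreeGroup (Fin n)) → Prop) {c : ℝ}
    (hc : ∀ t, (((Fintype.piFinset fun _ : Fin s => words n ℓ).filter (Acc t)).card : ℝ) ≤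
      c * ((2 * n - 1 : ℕ) : ℝ) ^ (s * ℓ)) (hc0 : 0 ≤ c) :
    relProb n ℓ N (fun r => ∃ e : Fin s → Fin N, Function.Injective e ∧ ∃ t, Acc t (r ∘ e)) ≤
      (N : ℝ) ^ s * Fintype.card τ * c := by
  set W := words n ℓ
  have hW : (0 : ℝ) < W.card := Nat.cast_pos.2 (card_words_pos hn ℓ)
  have h1 : ((Fintype.piFinset fun _ : Fin N => W).filter
      fun r => ∃ e : Fin s → Fin N, Function.Injective e ∧ ∃ t, Acc t (r ∘ e)) ⊆
      ((Finset.univ.filter fun e : Fin s → Fin N => Function.Injective e) ×ˢ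
        (Finset.univ : Finset τ)).biUnion fun x =>
        (Fintype.piFinset fun _ : Fin N => W).filter fun r => Acc x.2 (r ∘ x.1) := by
    intro r hr
    obtain ⟨h1, e, he, t, h2⟩ := Finset.mem_filter.1 hr
    exact Finset.mem_biUnion.2 ⟨(e, t), by simpa using he, Finset.mem_filter.2 ⟨h1, h2⟩⟩
  have h2 : ∀ x ∈ (Finset.univ.filter fun e : Fin s → Fin N => Function.Injective e) ×ˢ
      (Finset.univ : Finset τ), (((Fintype.piFinset fun _ : Fin N => W).filter
        fun r => Acc x.2 (r ∘ x.1)).card : ℝ) ≤ c * (W.card : ℝ) ^ N := by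
    intro x hx
    have he : Function.Injective x.1 := by simpa using hx
    have h3 := card_filter_comp_mul_le W he (Acc x.2)
    have h4 : ((2 * n - 1 : ℕ) : ℝ) ^ (s * ℓ) ≤ (W.card : ℝ) ^ s := by
      rw [mul_comm s ℓ, pow_mul]
      gcongr
      exact_mod_cast pow_le_card_words n ℓ
    refine le_of_mul_le_mul_right ?_ (pow_pos hW s)
    calc _ ≤ (((Fintype.piFinset fun _ : Fin s => W).filter (Acc x.2)).card : ℝ) *
          (W.card : ℝ) ^ N := by exact_mod_cast h3
      _ ≤ c * (W.card : ℝ) ^ s * (W.card : ℝ) ^ N := by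
        gcongr
        exact (hc x.2).trans (by gcongr)
      _ = _ := by ring
  rw [relProb_eq, div_le_iff₀ (pow_pos hW N)]
  calc _ ≤ ∑ x ∈ (Finset.univ.filter fun e : Fin s → Fin N => Function.Injective e) ×ˢ
      (Finset.univ : Finset τ), (((Fintype.piFinset fun _ : Fin N => W).filter
        fun r => Acc x.2 (r ∘ x.1)).card : ℝ) := by
        rw [← Nat.cast_sum]
        exact Nat.cast_le.2 ((Finset.card_le_card h1).trans Finset.card_biUnion_le)
    _ ≤ _ := Finset.sum_le_card_nsmul _ _ _ h2
    _ ≤ _ := by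
      rw [nsmul_eq_mul, Finset.card_product, Nat.cast_mul, Finset.card_univ, mul_assoc _ c]
      gcongr
      have : (Finset.univ.filter fun e : Fin s → Fin N => Function.Injective e).card ≤ N ^ s :=
        (Finset.card_filter_le _ _).trans (by simp)
      exact_mod_cast this

theorem wop_not_exists_comp (hn : 2 ≤ n) (hd : d < 1 / 16) {s : ℕ} (hs : 0 < s)
    {τ : ℕ → Type*} [∀ ℓ, Fintype (τ ℓ)] {a D : ℕ}
    (hτ : ∀ ℓ, Fintype.card (τ ℓ) ≤ a * (ℓ + 1) ^ D)
    (Acc : ∀ ℓ, τ ℓ → (Fin s → FreeGroup (Fin n)) → Prop)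
    (hAcc : ∀ ℓ t (T : Finset (Fin s → FreeGroup (Fin n))),
      (∀ r ∈ T, (∀ i, (r i).toWord.length = ℓ) ∧ Acc ℓ t r) →
      ∃ k, s * ℓ ≤ 16 * (k + s) ∧
        T.card * (2 * n - 1) ^ k ≤ (2 * n) ^ s * (2 * n - 1) ^ (s * ℓ)) :
    wop n d fun ℓ r => ∀ e : Fin s → Fin (numRel n d ℓ), Function.Injective e →
      ∀ t, ¬ Acc ℓ t (r ∘ e) := by
  set b : ℝ := ((2 * n - 1 : ℕ) : ℝ) with hb
  have hb1 : 1 < b := by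
    rw [hb]
    exact_mod_cast (by omega : 1 < 2 * n - 1)
  have hb0 : 0 < b := one_pos.trans hb1
  have hb' : 2 * (n : ℝ) - 1 = b := by
    rw [hb, Nat.cast_sub (by omega)]
    push_cast
    ring
  let q : ℝ := b ^ (-(s * (1 / 16 - d)))
  have hs' : (0 : ℝ) < s := Nat.cast_pos.2 hs
  have hq0 : 0 < q := Real.rpow_pos_of_pos hb0 _
  have hq1 : q < 1 := Real.rpow_lt_one_of_one_lt_of_neg hb1
    (neg_neg_of_pos (mul_pos hs' (by linarith)))
  rw [wop_iff hn]
  have hlim : Tendsto (fun ℓ : ℕ => (a * (2 * n) ^ s * b ^ s * q⁻¹) *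
      (((ℓ + 1 : ℕ) : ℝ) ^ D * q ^ (ℓ + 1))) atTop (nhds 0) := by
    have := (tendsto_pow_const_mul_const_pow_of_abs_lt_one D
      (by rwa [abs_of_pos hq0] : |q| < 1)).comp (tendsto_add_atTop_nat 1)
    simpa using this.const_mul (a * (2 * n) ^ s * b ^ s * q⁻¹)
  refine squeeze_zero (fun ℓ => relProb_nonneg _ _ _) (fun ℓ => ?_) hlim
  have h1 := relProb_exists_comp_le hn (ℓ := ℓ) (N := numRel n d ℓ) (Acc ℓ)
    (c := (2 * n) ^ s * b ^ s * b ^ (-(s * ℓ / 16 : ℝ))) (fun t => ?_) (by positivity)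
  · refine le_trans (relProb_mono hn fun r _ h => ?_) (h1.trans ?_)
    · push Not at h
      exact h
    · have hN : (numRel n d ℓ : ℝ) ^ s ≤ b ^ (s * (d * ℓ)) := by
        have : (numRel n d ℓ : ℝ) ≤ b ^ (d * ℓ) := by
          rw [numRel, hb']
          exact Nat.floor_le (by positivity)
        refine (pow_le_pow_left₀ (by positivity) this s).trans (le_of_eq ?_)
        rw [← Real.rpow_natCast, ← Real.rpow_mul hb0.le, mul_comm]
      have hq : q ^ ℓ = b ^ (s * (d * ℓ)) * b ^ (-(s * ℓ / 16 : ℝ)) := by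
        rw [← Real.rpow_natCast, ← Real.rpow_mul hb0.le, ← Real.rpow_add hb0]
        congr 1
        ring
      have hτ' : (Fintype.card (τ ℓ) : ℝ) ≤ a * ((ℓ + 1 : ℕ) : ℝ) ^ D := by
        exact_mod_cast hτ ℓ
      calc _ ≤ b ^ (s * (d * ℓ)) * (a * ((ℓ + 1 : ℕ) : ℝ) ^ D) *
            ((2 * n) ^ s * b ^ s * b ^ (-(s * ℓ / 16 : ℝ))) := by gcongr
        _ = (a * (2 * n) ^ s * b ^ s) * (((ℓ + 1 : ℕ) : ℝ) ^ D *
            (b ^ (s * (d * ℓ)) * b ^ (-(s * ℓ / 16 : ℝ)))) := by ring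
        _ = _ := by
          rw [← hq, pow_succ]
          field_simp
  · obtain ⟨k, hk, h2⟩ := hAcc ℓ t
      ((Fintype.piFinset fun _ : Fin s => words n ℓ).filter (Acc ℓ t)) fun r hr => by
        obtain ⟨h1, h2⟩ := Finset.mem_filter.1 hr
        exact ⟨mem_piFinset_words.1 h1, h2⟩
    have h3 : (((Fintype.piFinset fun _ : Fin s => words n ℓ).filter (Acc ℓ t)).card : ℝ) *
        b ^ k ≤ (2 * n) ^ s * b ^ (s * ℓ) := by
      rw [hb]
      exact_mod_cast h2
    have h4 : 1 ≤ b ^ k * (b ^ s * b ^ (-(s * ℓ / 16 : ℝ))) := by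
      rw [← Real.rpow_natCast, ← Real.rpow_natCast, ← Real.rpow_add hb0, ← Real.rpow_add hb0]
      refine Real.one_le_rpow hb1.le ?_
      have : (s * ℓ : ℝ) ≤ 16 * (k + s) := by exact_mod_cast hk
      linarith
    refine le_of_mul_le_mul_right (h3.trans ?_) (pow_pos hb0 k)
    calc (2 * n : ℝ) ^ s * b ^ (s * ℓ) ≤ (2 * n : ℝ) ^ s * b ^ (s * ℓ) *
          (b ^ k * (b ^ s * b ^ (-(s * ℓ / 16 : ℝ)))) := le_mul_of_one_le_right (by positivity) h4
      _ = _ := by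
        rw [hb]
        ring

end Probability

section Patterns

open FreeGroup
open scoped Classical

/-- The cyclically reduced core of the word of `x`. -/
def core {n : ℕ} (x : FreeGroup (Fin n)) : List (Fin n × Bool) :=
  reduceCyclically x.toWord

/-- The length of the word conjugating the core of `x` to `x`. -/
def coreDepth {n : ℕ} (x : FreeGroup (Fin n)) : ℕ :=
  (reduceCyclically.conjugator x.toWord).length

section Core

variable {n : ℕ} (x : FreeGroup (Fin n))

theorem isCyclicallyReduced_core : IsCyclicallyReduced (core x) :=
  reduceCyclically.isCyclicallyReduced isReduced_toWord

theorem toWord_eq_conj_core : x.toWord = reduceCyclically.conjugator x.toWord ++ core x ++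
    invRev (reduceCyclically.conjugator x.toWord) :=
  (reduceCyclically.conj_conjugator_reduceCyclically _).symm

theorem isConj_mk_core : IsConj (FreeGroup.mk (core x)) x := by
  refine isConj_iff.2 ⟨FreeGroup.mk (reduceCyclically.conjugator x.toWord), ?_⟩
  rw [inv_mk, mul_mk, mul_mk, ← toWord_eq_conj_core, mk_toWord]

theorem length_core_add : (core x).length + 2 * coreDepth x = x.toWord.length := by
  have h := congrArg List.length (toWord_eq_conj_core x)
  simp only [List.length_append, invRev_length] at h
  rw [coreDepth]
  omega

theorem core_ne_nil {x : FreeGroup (Fin n)} (hx : x.toWord ≠ []) : core x ≠ [] := by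
  intro h
  have h1 := isConj_mk_core x
  rw [h, ← one_eq_mk, isConj_one_right] at h1
  exact hx (by rw [h1, toWord_one])

theorem getElem?_core {t : ℕ} (ht : t < (core x).length) :
    x.toWord[coreDepth x + t]? = (core x)[t]? := by
  conv_lhs => rw [toWord_eq_conj_core x]
  rw [List.append_assoc, List.getElem?_append_right (by rw [coreDepth]; omega),
    List.getElem?_append_left (by rw [coreDepth]; omega), coreDepth, Nat.add_sub_cancel_left]

theorem getElem?_invRev {w : List (Fin n × Bool)} {t : ℕ} (ht : t < w.length) :
    (invRev w)[t]? = (w[w.length - 1 - t]?).map (signed true) := by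
  rw [invRev, List.getElem?_reverse (by simpa using ht), List.getElem?_map, List.length_map]
  congr 1
  funext l
  simp [signed]

theorem getElem?_toWord_of_lt_coreDepth {t : ℕ} (ht : t < coreDepth x) :
    x.toWord[t]? = (x.toWord[x.toWord.length - 1 - t]?).map (signed true) := by
  have h := length_core_add x
  have h1 : x.toWord[t]? = (reduceCyclically.conjugator x.toWord)[t]? := by
    conv_lhs => rw [toWord_eq_conj_core x]
    rw [List.append_assoc, List.getElem?_append_left ht]
  have h2 : x.toWord[x.toWord.length - 1 - t]? =
      (invRev (reduceCyclically.conjugator x.toWord))[coreDepth x - 1 - t]? := by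
    have h3 : x.toWord.length - 1 - t =
        (reduceCyclically.conjugator x.toWord ++ core x).length + (coreDepth x - 1 - t) := by
      rw [List.length_append, ← coreDepth]
      omega
    rw [h3]
    conv_lhs =>
      enter [1]
      rw [toWord_eq_conj_core x]
    rw [List.getElem?_append_right (Nat.le_add_right _ _), Nat.add_sub_cancel_left]
  rw [h1, h2, getElem?_invRev (by rw [coreDepth] at *; omega), Option.map_map]
  have h3 : signed true ∘ signed true = (id : Fin n × Bool → _) := by
    funext l
    simp [signed]
  rw [h3, Option.map_id, id]
  congr 1
  rw [← coreDepth]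
  omega

end Core

theorem getElem?_circleWin {α : Type*} {w : List (α × Bool)} {k q t : ℕ} (hk : 2 * k < w.length)
    (ht : t < 2 * k + 1) : (circleWin k w q)[t]? = w[(q + t) % w.length]? := by
  rw [circleWin, List.getElem?_take_of_lt ht, List.getElem?_rotate (by omega), add_comm]

variable {n s B ℓ : ℕ}

/-- A coincidence, up to the sign `ε`, of the windows of length `L` starting at `κ` and `κ'`. -/
def WinMatch {ι : Type*} (ρ : ι → List (Fin n × Bool)) (L : ℕ) (κ κ' : ι × ℕ) (ε : Bool) : Prop :=
  ∀ t < L, (ρ κ.1)[(κ.2 + t) % (ρ κ.1).length]? =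
    ((ρ κ'.1)[(κ'.2 + if ε then L - 1 - t else t) % (ρ κ'.1).length]?).map (signed ε)

theorem map_signed_false (o : Option (Fin n × Bool)) : o.map (signed false) = o := by
  cases o <;> simp [signed]

theorem exists_winMatch_of_not_uniqueIn {ι : Type*} {ρ : ι → List (Fin n × Bool)} {k : ℕ}
    (hk : ∀ i, 2 * k < (ρ i).length) {κ : ι × ℕ} (hκ : ¬ UniqueIn ρ k Set.univ κ) :
    ∃ κ' ε, κ'.2 < (ρ κ'.1).length ∧ WinMatch ρ (2 * k + 1) κ κ' ε ∧ (ε = false → κ' ≠ κ) := by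
  simp only [UniqueIn, Set.mem_univ, true_implies] at hκ
  push Not at hκ
  obtain ⟨i, b, hb, h⟩ := hκ
  by_cases h1 : circleWin k (ρ i) b = circleWin k (ρ κ.1) κ.2 ∧ (i, b) ≠ κ
  · refine ⟨(i, b), false, hb, fun t ht => ?_, fun _ => h1.2⟩
    rw [map_signed_false, ← getElem?_circleWin (hk _) ht, ← h1.1, getElem?_circleWin (hk _) ht]
    rfl
  · have h2 := h fun h3 => by_contra fun h4 => h1 ⟨h3, h4⟩
    refine ⟨(i, b), true, hb, fun t ht => ?_, by simp⟩
    have h3 := congrArg invRev h2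
    rw [invRev_invRev] at h3
    rw [← getElem?_circleWin (hk _) ht, ← h3,
      getElem?_invRev (by rw [length_circleWin (hk _)]; exact ht), length_circleWin (hk _),
      getElem?_circleWin (hk _) (by omega)]
    rfl

/-- The code of a system of coincidences among `s` words of length `ℓ`: the depths of the
cores, the common length of the windows, and for each index a pair of windows and a sign. -/
abbrev PatternCode (s B ℓ : ℕ) : Type :=
  (Fin s → Fin (ℓ + 1)) × Fin (ℓ + 1) ×
    (Fin s × Fin B → Fin (ℓ + 1) × (Fin s × Fin (ℓ + 1)) × Bool)

/-- The equalities between letters, up to sign, prescribed by a pattern. -/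
def PatternEdge (ℓ : ℕ) (j : Fin s → ℕ) (L : ℕ) (μ : Fin s × Fin B → ℕ × (Fin s × ℕ) × Bool)
    (x y : Fin s × ℕ) (ε : Bool) : Prop :=
  (∃ i t, t < j i ∧ x = (i, t) ∧ y = (i, ℓ - 1 - t) ∧ ε = true) ∨
  ∃ c t, t < L ∧ x = (c.1, j c.1 + ((μ c).1 + t) % (ℓ - 2 * j c.1)) ∧
    y = ((μ c).2.1.1, j (μ c).2.1.1 +
      ((μ c).2.1.2 + if (μ c).2.2 then L - 1 - t else t) % (ℓ - 2 * j (μ c).2.1.1)) ∧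
    ε = (μ c).2.2

/-- The edges of a pattern given by its code. -/
def PatternCode.Edge (p : PatternCode s B ℓ) : Fin s × ℕ → Fin s × ℕ → Bool → Prop :=
  PatternEdge ℓ (fun i => p.1 i) p.2.1
    fun c => ((p.2.2 c).1, ((p.2.2 c).2.1.1, (p.2.2 c).2.1.2), (p.2.2 c).2.2)

/-- The words `r` satisfy the pattern, and the pattern constrains many letters. -/
def PatternCode.Accepts (p : PatternCode s B ℓ) (r : Fin s → FreeGroup (Fin n)) : Prop :=
  (∀ x y ε, p.Edge x y ε → x.2 < ℓ → y.2 < ℓ →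
    (r x.1).toWord[x.2]? = ((r y.1).toWord[y.2]?).map (signed ε)) ∧
  ∃ Q : Finset (Fin s × ℕ), s * ℓ ≤ 8 * Q.card + 16 * s ∧
    ∀ x ∈ Q, x.2 < ℓ ∧ ∃ y ≠ x, y.2 < ℓ ∧ ∃ ε, p.Edge x y ε ∨ p.Edge y x ε

theorem PatternCode.exists_card_mul_le (hn : 2 ≤ n) (p : PatternCode s B ℓ)
    (T : Finset (Fin s → FreeGroup (Fin n)))
    (hT : ∀ r ∈ T, (∀ i, (r i).toWord.length = ℓ) ∧ p.Accepts r) :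
    ∃ k, s * ℓ ≤ 16 * (k + s) ∧
      T.card * (2 * n - 1) ^ k ≤ (2 * n) ^ s * (2 * n - 1) ^ (s * ℓ) := by
  rcases T.eq_empty_or_nonempty with rfl | ⟨r, hr⟩
  · exact ⟨s * ℓ, by omega, by simp⟩
  · obtain ⟨-, Q, hQ, hQ'⟩ := (hT r hr).2
    exact ⟨(Q.card + 1) / 2, by omega, card_le_of_edges hn T (fun r hr => (hT r hr).1) p.Edge
      (fun r hr => (hT r hr).2.1) Q hQ' (by omega)⟩

theorem card_patternCode_le (s B ℓ : ℕ) :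
    Fintype.card (PatternCode s B ℓ) ≤
      (s * 2) ^ (s * B) * (ℓ + 1) ^ (s + 1 + 2 * (s * B)) := by
  simp only [Fintype.card_prod, Fintype.card_fun, Fintype.card_fin, Fintype.card_bool]
  refine le_of_eq ?_
  rw [show (ℓ + 1) * (s * (ℓ + 1) * 2) = (s * 2) * (ℓ + 1) ^ 2 by ring, mul_pow, ← pow_mul]
  ring

theorem wop_not_accepts (hn : 2 ≤ n) {d : ℝ} (hd : d < 1 / 16) (hs : 0 < s) (B : ℕ) :
    wop n d fun ℓ r => ∀ e : Fin s → Fin (numRel n d ℓ), Function.Injective e →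
      ∀ p : PatternCode s B ℓ, ¬ p.Accepts (r ∘ e) :=
  wop_not_exists_comp hn hd hs (card_patternCode_le s B) (fun _ p => p.Accepts)
    fun _ p => p.exists_card_mul_le hn

theorem exists_patternCode {j : Fin s → ℕ} (hj : ∀ i, j i ≤ ℓ) {L : ℕ} (hL : L ≤ ℓ)
    {μ : Fin s × Fin B → ℕ × (Fin s × ℕ) × Bool}
    (hμ : ∀ c, (μ c).1 ≤ ℓ ∧ (μ c).2.1.2 ≤ ℓ) :
    ∃ p : PatternCode s B ℓ, p.Edge = PatternEdge ℓ j L μ :=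
  ⟨⟨fun i => ⟨j i, Nat.lt_succ_of_le (hj i)⟩, ⟨L, Nat.lt_succ_of_le hL⟩, fun c =>
    ⟨⟨(μ c).1, Nat.lt_succ_of_le (hμ c).1⟩, ⟨(μ c).2.1.1, ⟨(μ c).2.1.2,
      Nat.lt_succ_of_le (hμ c).2⟩⟩, (μ c).2.2⟩⟩, rfl⟩

theorem exists_accepts {k : ℕ} (r : Fin s → FreeGroup (Fin n))
    (hr : ∀ i, (r i).toWord.length = ℓ) (hl : 2 * k < ℓ)
    (hk : ∀ i, 2 * k < (core (r i)).length) (β : Fin s × Fin B → Option ℕ)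
    (hβ : ∀ c q, β c = some q → q < (core (r c.1)).length ∧
      ¬ UniqueIn (fun i => core (r i)) k Set.univ (c.1, q))
    (Q : Finset (Fin s × ℕ))
    (hQ : ∀ x ∈ Q, ∃ b q t, β (x.1, b) = some q ∧ t < 2 * k + 1 ∧
      x.2 = (q + t) % (core (r x.1)).length)
    (hcard : s * ℓ ≤ 8 * (∑ i, 2 * coreDepth (r i) + Q.card) + 16 * s) :
    ∃ p : PatternCode s B ℓ, p.Accepts r := by
  set ρ : Fin s → List (Fin n × Bool) := fun i => core (r i) with hρ
  set j : Fin s → ℕ := fun i => coreDepth (r i) with hj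
  have hlen : ∀ i, (ρ i).length + 2 * j i = ℓ := fun i => (length_core_add _).trans (hr i)
  have hlen' : ∀ i, ℓ - 2 * j i = (ρ i).length := fun i => by have := hlen i; omega
  have hpos : ∀ i, 0 < (ρ i).length := fun i => (Nat.zero_le _).trans_lt (hk i)
  have h1 : ∀ c, ∃ μ : ℕ × (Fin s × ℕ) × Bool, (μ.1 ≤ ℓ ∧ μ.2.1.2 ≤ ℓ) ∧
      WinMatch ρ (2 * k + 1) (c.1, μ.1) μ.2.1 μ.2.2 ∧ ∀ q, β c = some q →
        μ.1 = q ∧ q < (ρ c.1).length ∧ μ.2.1.2 < (ρ μ.2.1.1).length ∧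
          (μ.2.2 = false → μ.2.1 ≠ (c.1, q)) := by
    intro c
    rcases h : β c with _ | q
    · refine ⟨(0, (c.1, 0), false), by simp, fun t _ => ?_, by simp⟩
      rw [map_signed_false]
      rfl
    · obtain ⟨hq, hq'⟩ := hβ c q h
      obtain ⟨κ', ε, h1, h2, h3⟩ := exists_winMatch_of_not_uniqueIn hk hq'
      refine ⟨(q, κ', ε), ⟨?_, ?_⟩, h2, fun q' hq' => ?_⟩
      · have := hlen c.1
        change q < (ρ c.1).length at hq
        dsimp only
        omega
      · have := hlen κ'.1
        change κ'.2 < (ρ κ'.1).length at h1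
        dsimp only
        omega
      · obtain rfl := Option.some.inj hq'
        exact ⟨rfl, hq, h1, h3⟩
  choose μ hμ hμ' hμβ using h1
  obtain ⟨p, hp⟩ := exists_patternCode (j := j) (fun i => by have := hlen i; omega)
    (L := 2 * k + 1) (by omega) hμ
  have hmod : ∀ i a, a % (ρ i).length < (ρ i).length := fun i a => Nat.mod_lt _ (hpos i)
  have hedge : ∀ x y ε, PatternEdge ℓ j (2 * k + 1) μ x y ε →
      (r x.1).toWord[x.2]? = ((r y.1).toWord[y.2]?).map (signed ε) ∧ x.2 < ℓ ∧ y.2 < ℓ := by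
    rintro x y ε (⟨i, t, ht, rfl, rfl, rfl⟩ | ⟨c, t, ht, rfl, rfl, rfl⟩)
    · have := hlen i
      refine ⟨?_, by dsimp only; omega, by dsimp only; omega⟩
      have h := getElem?_toWord_of_lt_coreDepth (r i) ht
      rwa [hr] at h
    · simp only [hlen']
      refine ⟨?_, ?_, ?_⟩
      · rw [getElem?_core _ (hmod _ _), getElem?_core _ (hmod _ _)]
        exact hμ' c t ht
      · have := hlen c.1
        have := hmod c.1 ((μ c).1 + t)
        omega
      · have := hlen (μ c).2.1.1
        have := hmod (μ c).2.1.1 ((μ c).2.1.2 + if (μ c).2.2 then 2 * k + 1 - 1 - t else t)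
        omega
  have hne : ∀ x y, PatternEdge ℓ j (2 * k + 1) μ x y true → y ≠ x := by
    rintro x y h rfl
    obtain ⟨h1, h2, -⟩ := hedge _ _ _ h
    rw [List.getElem?_eq_getElem (by rw [hr]; exact h2), Option.map_some,
      Option.some.injEq] at h1
    have := congrArg Prod.snd h1
    simp [signed] at this
  refine ⟨p, fun x y ε h _ _ => (hedge x y ε (hp ▸ h)).1, ?_⟩
  rw [hp]
  let Q₁ : Finset (Fin s × ℕ) := (Finset.univ.sigma fun i => Finset.range (j i)).map
    (Equiv.sigmaEquivProd _ _).toEmbedding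
  have hQ₁ : ∀ x, x ∈ Q₁ ↔ x.2 < j x.1 := by
    rintro ⟨i, t⟩
    simp [Q₁]
  have hcQ₁ : Q₁.card = ∑ i, j i := by simp [Q₁]
  let Q₂ := Q₁.image fun x => (x.1, ℓ - 1 - x.2)
  have hcQ₂ : Q₂.card = ∑ i, j i := by
    rw [← hcQ₁]
    refine Finset.card_image_of_injOn fun x hx y hy h => ?_
    have hx := (hQ₁ x).1 hx
    have hy := (hQ₁ y).1 hy
    simp only [Prod.mk.injEq] at h
    have := hlen x.1
    have := hlen y.1
    refine Prod.ext h.1 ?_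
    omega
  let Q₃ := Q.image fun x => (x.1, j x.1 + x.2)
  have hcQ₃ : Q₃.card = Q.card := by
    refine Finset.card_image_of_injective _ fun x y h => ?_
    obtain ⟨i, a⟩ := x
    obtain ⟨i', a'⟩ := y
    simp only [Prod.mk.injEq] at h
    obtain ⟨rfl, h⟩ := h
    exact Prod.ext rfl (by dsimp only; omega)
  have hlt₂ : ∀ x ∈ Q₂, x.2 < ℓ ∧ ℓ ≤ x.2 + j x.1 := by
    intro x hx
    obtain ⟨y, hy, rfl⟩ := Finset.mem_image.1 hx
    have := (hQ₁ y).1 hy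
    have := hlen y.1
    dsimp only
    omega
  have hlt₃ : ∀ x ∈ Q₃, j x.1 ≤ x.2 ∧ x.2 + j x.1 < ℓ := by
    intro x hx
    obtain ⟨y, hy, rfl⟩ := Finset.mem_image.1 hx
    obtain ⟨b, q, t, -, -, h⟩ := hQ y hy
    have := hmod y.1 (q + t)
    have := hlen y.1
    change y.2 = (q + t) % (ρ y.1).length at h
    dsimp only
    omega
  refine ⟨Q₁ ∪ Q₂ ∪ Q₃, ?_, ?_⟩
  · rw [Finset.card_union_of_disjoint, Finset.card_union_of_disjoint, hcQ₁, hcQ₂, hcQ₃]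
    · rw [← Finset.mul_sum] at hcard
      change s * ℓ ≤ 8 * (2 * ∑ i, j i + Q.card) + 16 * s at hcard
      omega
    · refine Finset.disjoint_left.2 fun x h1 h2 => ?_
      have h1 := (hQ₁ x).1 h1
      have h2 := hlt₂ x h2
      have := hlen x.1
      have := hpos x.1
      omega
    · refine Finset.disjoint_left.2 fun x h1 h2 => ?_
      have h2 := hlt₃ x h2
      rcases Finset.mem_union.1 h1 with h1 | h1
      · have h1 := (hQ₁ x).1 h1
        omega
      · have h1 := hlt₂ x h1
        omega
  · intro x hx
    have key : ∃ y, y ≠ x ∧ ∃ ε, PatternEdge ℓ j (2 * k + 1) μ x y ε ∨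
        PatternEdge ℓ j (2 * k + 1) μ y x ε := by
      rcases Finset.mem_union.1 hx with hx | hx
      · rcases Finset.mem_union.1 hx with hx | hx
        · have h : PatternEdge ℓ j (2 * k + 1) μ x (x.1, ℓ - 1 - x.2) true :=
            Or.inl ⟨x.1, x.2, (hQ₁ x).1 hx, rfl, rfl, rfl⟩
          exact ⟨_, hne _ _ h, true, Or.inl h⟩
        · obtain ⟨y, hy, rfl⟩ := Finset.mem_image.1 hx
          have h : PatternEdge ℓ j (2 * k + 1) μ y (y.1, ℓ - 1 - y.2) true :=
            Or.inl ⟨y.1, y.2, (hQ₁ y).1 hy, rfl, rfl, rfl⟩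
          exact ⟨_, (hne _ _ h).symm, true, Or.inr h⟩
      · obtain ⟨⟨i, a⟩, hy, rfl⟩ := Finset.mem_image.1 hx
        obtain ⟨b, q, t, h1, h2, h3⟩ := hQ _ hy
        obtain ⟨h4, h5, h6, h7⟩ := hμβ _ _ h1
        have h : PatternEdge ℓ j (2 * k + 1) μ (i, j i + a) _ (μ (i, b)).2.2 :=
          Or.inr ⟨(i, b), t, h2, by rw [h4, hlen']; exact congrArg (Prod.mk i) (congrArg _ h3),
            rfl, rfl⟩
        refine ⟨_, ?_, _, Or.inl h⟩
        rcases hε : (μ (i, b)).2.2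
        · intro he
          refine h7 hε ?_
          rw [Prod.mk.injEq] at he
          obtain ⟨he1, he2⟩ := he
          dsimp only at h3 h5 ⊢
          refine Prod.ext he1 ?_
          rw [hlen', he1] at he2
          rw [he1] at h6
          have h8 : ((μ (i, b)).2.1.2 + t) % (ρ i).length = (q + t) % (ρ i).length := by
            simp only at he2
            change a = (q + t) % (ρ i).length at h3
            rw [← h3]
            simpa using he2
          have h9 := Nat.ModEq.add_right_cancel' t h8
          exact Nat.ModEq.eq_of_lt_of_lt h9 h6 h5
        · rw [hε] at h
          exact hne _ _ (by simpa [hε] using h)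
    obtain ⟨y, hy, ε, h | h⟩ := key
    · exact ⟨(hedge _ _ _ h).2.1, y, hy, (hedge _ _ _ h).2.2, ε, Or.inl h⟩
    · exact ⟨(hedge _ _ _ h).2.2, y, hy, (hedge _ _ _ h).2.1, ε, Or.inr h⟩

end Patterns

section Rigid

open FreeGroup
open scoped Classical

variable {n N ℓ B K : ℕ}

/-- No pattern constraining at most `K` of the words `r` is satisfied. -/
def Rigid (ℓ B K : ℕ) (r : Fin N → FreeGroup (Fin n)) : Prop :=
  ∀ s ∈ Finset.Icc 1 K, ∀ e : Fin s → Fin N, Function.Injective e →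
    ∀ p : PatternCode s B ℓ, ¬ p.Accepts (r ∘ e)

theorem wop_rigid (hn : 2 ≤ n) {d : ℝ} (hd : d < 1 / 16) (B K : ℕ) :
    wop n d fun ℓ r => Rigid ℓ B K r :=
  wop.ball hn (Finset.Icc 1 K) fun _ hs =>
    wop_not_accepts hn hd (Finset.mem_Icc.1 hs).1 B

theorem UniqueIn.of_comp {α ι κ : Type*} {ρ : ι → List (α × Bool)} {k : ℕ} {e : κ → ι} {a : κ}
    {q : ℕ} (h : UniqueIn (fun i => ρ (e i)) k Set.univ (a, q)) :
    UniqueIn ρ k (Set.range e) (e a, q) := by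
  rintro _ ⟨c, rfl⟩ b hb
  obtain ⟨h1, h2⟩ := h c (Set.mem_univ _) b hb
  refine ⟨fun h3 => ?_, h2⟩
  have h4 := h1 h3
  rw [Prod.mk.injEq] at h4 ⊢
  exact ⟨congrArg e h4.1, h4.2⟩

theorem exists_not_uniqueIn_pair {α ι : Type*} {ρ : ι → List (α × Bool)} {k i q : _}
    {I : Set ι} (hq : q < (ρ i).length) (h : ¬ UniqueIn ρ k I (i, q)) :
    ∃ i' ∈ I, ∃ b < (ρ i').length, ∀ J : Set ι, i ∈ J → i' ∈ J →
      ¬ UniqueIn ρ k J (i, q) ∧ ¬ UniqueIn ρ k J (i', b) := by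
  rw [UniqueIn] at h
  push Not at h
  obtain ⟨i', hi', b, hb, h⟩ := h
  refine ⟨i', hi', b, hb, fun J hi hi'' => ⟨fun hJ => ?_, fun hJ => ?_⟩⟩
  · obtain ⟨h1, h2⟩ := hJ i' hi'' b hb
    exact h2 (h h1)
  · obtain ⟨h1, h2⟩ := hJ i hi q hq
    refine h2 ?_
    rw [h fun h3 => (h1 h3.symm).symm, invRev_invRev]

/-- The positions covered by the window of length `L` starting at `q` on a circle of length `m`. -/
def winPos {ι : Type*} [DecidableEq ι] (L m : ℕ) (i : ι) (q : ℕ) : Finset (ι × ℕ) :=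
  (Finset.range L).image fun t => (i, (q + t) % m)

theorem card_winPos {ι : Type*} [DecidableEq ι] {L m : ℕ} (hL : L ≤ m) (i : ι) (q : ℕ) :
    (winPos L m i q).card = L := by
  rw [winPos, Finset.card_image_of_injOn, Finset.card_range]
  intro t ht t' ht' h
  rw [Finset.coe_range, Set.mem_Iio] at ht ht'
  exact Nat.ModEq.eq_of_lt_of_lt (Nat.ModEq.add_left_cancel' q (Prod.mk.inj h).2)
    (ht.trans_le hL) (ht'.trans_le hL)

variable {r : Fin N → FreeGroup (Fin n)}

theorem core_length_pos {x : FreeGroup (Fin n)} (hx : 0 < x.toWord.length) :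
    0 < (core x).length := by
  exact List.length_pos_iff.2 (core_ne_nil (List.ne_nil_of_length_pos hx))

theorem Rigid.le_length_core (h : Rigid ℓ B K r) (hr : r ∈ relTuples n ℓ N) (hK : 1 ≤ K)
    (hl : 0 < ℓ) (i : Fin N) : 7 * ℓ ≤ 8 * (core (r i)).length := by
  by_contra! hlt
  have h1 := length_core_add (r i)
  rw [hr i] at h1
  have h2 : ∃ p : PatternCode 1 B ℓ, p.Accepts (r ∘ fun _ => i) := by
    refine exists_accepts (k := 0) _ (fun _ => hr i) (by omega) (fun _ => ?_) (fun _ => none)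
      (by simp) ∅ (by simp) ?_
    · exact core_length_pos (by rw [Function.comp_apply, hr i]; exact hl)
    · simp only [Function.comp_apply, Finset.univ_unique, Finset.sum_singleton, Finset.card_empty]
      omega
  obtain ⟨p, hp⟩ := h2
  exact h 1 (Finset.mem_Icc.2 ⟨le_rfl, hK⟩) _ (Function.injective_of_subsingleton _) p hp

theorem Rigid.exists_uniqueIn_of_windows (h : Rigid ℓ B K r) (hr : r ∈ relTuples n ℓ N)
    (hl : 0 < ℓ) (hB : 0 < B) {k : ℕ} (hk : 16 * k ≤ ℓ) (hk' : ℓ ≤ 16 * k + 24)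
    {s : ℕ} (hs : 1 ≤ s) (hsK : s ≤ K) (e : Fin s → Fin N) (he : Function.Injective e)
    (q : Fin s → ℕ) (hq : ∀ c, q c < (core (r (e c))).length) :
    ∃ c, UniqueIn (fun i => core (r i)) k (Set.range e) (e c, q c) := by
  by_contra! hno
  have hlen : ∀ i, 2 * k < (core (r i)).length := fun i => by
    have := h.le_length_core hr (hs.trans hsK) hl i
    omega
  obtain ⟨p, hp⟩ : ∃ p : PatternCode s B ℓ, p.Accepts (r ∘ e) := by
    refine exists_accepts (k := k) _ (fun c => hr (e c)) (by omega) (fun c => hlen (e c))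
      (fun c => if c.2 = ⟨0, hB⟩ then some (q c.1) else none) ?_
      (Finset.univ.biUnion fun c => winPos (2 * k + 1) (core (r (e c))).length c (q c)) ?_ ?_
    · rintro c q' h1
      split_ifs at h1
      obtain rfl := Option.some.inj h1
      exact ⟨hq _, fun h2 =>
        hno c.1 (UniqueIn.of_comp (ρ := fun i => core (r i)) (e := e) h2)⟩
    · rintro x hx
      obtain ⟨c, -, hx⟩ := Finset.mem_biUnion.1 hx
      obtain ⟨t, ht, rfl⟩ := Finset.mem_image.1 hx
      exact ⟨⟨0, hB⟩, q c, t, by simp, Finset.mem_range.1 ht, rfl⟩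
    · rw [Finset.card_biUnion]
      · simp only [card_winPos (Nat.succ_le_of_lt (hlen _)), Finset.sum_const, Finset.card_univ,
          Fintype.card_fin, smul_eq_mul]
        have := Nat.mul_le_mul_left s hk'
        have h0 : s * (2 * k).succ = 2 * (s * k) + s := by
          rw [Nat.succ_eq_add_one]
          ring
        have h1 : s * (16 * k + 24) = 16 * (s * k) + 24 * s := by ring
        omega
      · intro c _ c' _ hc
        refine Finset.disjoint_left.2 fun x hx hx' => hc ?_
        obtain ⟨t, -, rfl⟩ := Finset.mem_image.1 hx
        obtain ⟨t', -, h'⟩ := Finset.mem_image.1 hx'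
        exact (Prod.mk.inj h').1.symm
  exact h s (Finset.mem_Icc.2 ⟨hs, hsK⟩) e he p hp

theorem Rigid.uniqueIn_univ (h : Rigid ℓ B K r) (hr : r ∈ relTuples n ℓ N)
    (hl : 0 < ℓ) (hB : 0 < B) (hK : 2 ≤ K) {k : ℕ} (hk : 16 * k ≤ ℓ) (hk' : ℓ ≤ 16 * k + 24)
    (i : Fin N) {q : ℕ} (hq : q < (core (r i)).length) :
    UniqueIn (fun i => core (r i)) k Set.univ (i, q) := by
  by_contra hno
  obtain ⟨i', -, b, hb, hno⟩ :=
    exists_not_uniqueIn_pair (ρ := fun i => core (r i)) hq hno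
  rcases eq_or_ne i i' with rfl | hii
  · obtain ⟨c, hc⟩ := h.exists_uniqueIn_of_windows hr hl hB hk hk' le_rfl (by omega)
      (fun _ : Fin 1 => i) (Function.injective_of_subsingleton _) (fun _ => q) (fun _ => hq)
    exact (hno _ (Set.mem_range_self c) (Set.mem_range_self c)).1 hc
  · obtain ⟨c, hc⟩ := h.exists_uniqueIn_of_windows hr hl hB hk hk' one_le_two hK
      ![i, i'] (by
        intro c c' hc
        fin_cases c <;> fin_cases c' <;> simp_all [eq_comm]) ![q, b] (by
        intro c
        fin_cases c <;> simpa)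
    have := hno (Set.range ![i, i']) ⟨0, rfl⟩ ⟨1, rfl⟩
    fin_cases c
    · exact this.1 hc
    · exact this.2 hc

theorem Rigid.exists_unique_colours (h : Rigid ℓ B K r) (hr : r ∈ relTuples n ℓ N)
    (hl : 0 < ℓ) {k : ℕ} (hk0 : 0 < k) (hk : 16 * k ≤ ℓ) (hkB : ℓ < k * B)
    (I : Finset (Fin N)) (hI : I.Nonempty) (hIK : I.card ≤ K) :
    ∃ U : Finset (Fin N × ℕ), ℓ ≤ 2 * U.card ∧ ∀ κ ∈ U, κ.1 ∈ I ∧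
      κ.2 < (core (r κ.1)).length ∧ UniqueIn (fun i => core (r i)) k I κ := by
  have hs : 1 ≤ I.card := hI.card_pos
  have hlen : ∀ i, 2 * k < (core (r i)).length := fun i => by
    have := h.le_length_core hr (hs.trans hIK) hl i
    omega
  have hlen' : ∀ i, (core (r i)).length + 2 * coreDepth (r i) = ℓ := fun i =>
    (length_core_add _).trans (hr i)
  set e : Fin I.card → Fin N := fun c => (I.equivFin.symm c : Fin N) with he
  have heinj : Function.Injective e :=
    Subtype.val_injective.comp I.equivFin.symm.injective
  have herange : Set.range e = I := by
    rw [he, Set.range_comp' Subtype.val, I.equivFin.symm.range_eq_univ, Set.image_univ,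
      Subtype.range_coe_subtype, Finset.setOfPred_mem]
  set A : Finset (Fin I.card × ℕ) :=
    Finset.univ.sigma (fun c => Finset.range (core (r (e c))).length) |>.map
      (Equiv.sigmaEquivProd _ _).toEmbedding with hA
  have hAmem : ∀ x, x ∈ A ↔ x.2 < (core (r (e x.1))).length := by
    rintro ⟨c, q⟩
    simp [hA]
  have hAcard : ∑ c, 2 * coreDepth (r (e c)) + A.card = I.card * ℓ := by
    rw [hA, Finset.card_map, Finset.card_sigma, ← Finset.sum_add_distrib]
    simp only [Finset.card_range]
    rw [Finset.sum_congr rfl fun c _ => (add_comm _ _).trans (hlen' (e c))]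
    simp
  set P : Fin I.card × ℕ → Prop := fun x =>
    UniqueIn (fun i => core (r i)) k (I : Set (Fin N)) (e x.1, x.2) with hP
  have hsplit := A.card_filter_add_card_filter_not P
  by_cases hU : ℓ ≤ 2 * (A.filter P).card
  · refine ⟨(A.filter P).map ⟨Prod.map e id, heinj.prodMap Function.injective_id⟩,
      by rwa [Finset.card_map], ?_⟩
    simp only [Finset.mem_map, Finset.mem_filter, Function.Embedding.coeFn_mk]
    rintro _ ⟨x, ⟨hx, hx'⟩, rfl⟩
    exact ⟨herange.subset ⟨x.1, rfl⟩, (hAmem x).1 hx, hx'⟩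
  · exfalso
    set Bad : Fin I.card × Fin B → ℕ → Prop := fun c q =>
      (c.1, q) ∈ A ∧ ¬ P (c.1, q) ∧ q / k = c.2
    obtain ⟨p, hp⟩ : ∃ p : PatternCode I.card B ℓ, p.Accepts (r ∘ e) := by
      refine exists_accepts (k := k) _ (fun c => hr (e c)) (by omega) (fun c => hlen (e c))
        (fun c => if hc : ∃ q, Bad c q then some (Nat.find hc) else none) ?_
        (A.filter fun x => ¬ P x) ?_ ?_
      · rintro c q h1
        split_ifs at h1 with hc
        obtain rfl := Option.some.inj h1
        obtain ⟨h2, h3, -⟩ := Nat.find_spec hc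
        refine ⟨(hAmem _).1 h2, fun h4 => h3 ?_⟩
        have := h4.of_comp (ρ := fun i => core (r i)) (e := e)
        rwa [herange] at this
      · rintro ⟨c, q⟩ hx
        obtain ⟨hx, hx'⟩ := Finset.mem_filter.1 hx
        have hq := (hAmem _).1 hx
        dsimp only at hq
        have hqB : q / k < B := by
          rw [Nat.div_lt_iff_lt_mul hk0, mul_comm]
          have := hlen' (e c)
          omega
        have hc : ∃ a, Bad (c, ⟨q / k, hqB⟩) a := ⟨q, hx, hx', rfl⟩
        obtain ⟨-, -, h3⟩ := Nat.find_spec hc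
        have h4 : Nat.find hc ≤ q := Nat.find_min' hc ⟨hx, hx', rfl⟩
        have h5 := Nat.div_add_mod q k
        have h6 := Nat.mod_lt q hk0
        have h7 := Nat.div_mul_le_self (Nat.find hc) k
        dsimp only at h3
        rw [h3, mul_comm] at h7
        refine ⟨⟨q / k, hqB⟩, Nat.find hc, q - Nat.find hc, dif_pos hc, by omega, ?_⟩
        rw [Nat.add_sub_cancel' h4]
        exact (Nat.mod_eq_of_lt hq).symm
      · simp only [Function.comp_apply]
        have : ℓ ≤ I.card * ℓ := Nat.le_mul_of_pos_left _ hs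
        omega
    exact h _ (Finset.mem_Icc.2 ⟨hs, hIK⟩) e heinj p hp

theorem normalClosure_range_eq (r : Fin N → FreeGroup (Fin n)) :
    Subgroup.normalClosure (Set.range r) =
      Subgroup.normalClosure (circleRel fun i => core (r i)) := by
  have hmem : ∀ i, FreeGroup.mk (core (r i)) ∈ Subgroup.normalClosure (Set.range r) := by
    intro i
    obtain ⟨c, hc⟩ := isConj_iff.1 (isConj_mk_core (r i)).symm
    rw [← hc]
    exact Subgroup.normalClosure_normal.conj_mem _
      (Subgroup.subset_normalClosure (Set.mem_range_self i)) _
  refine le_antisymm (Subgroup.normalClosure_le_normal ?_) (Subgroup.normalClosure_le_normal ?_)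
  · rintro _ ⟨i, rfl⟩
    obtain ⟨c, hc⟩ := isConj_iff.1 (isConj_mk_core (r i))
    rw [SetLike.mem_coe, ← hc]
    have hi : FreeGroup.mk (core (r i)) ∈ circleRel fun i => core (r i) := ⟨i, Or.inl rfl⟩
    exact Subgroup.normalClosure_normal.conj_mem _ (Subgroup.subset_normalClosure hi) _
  · rintro _ ⟨i, rfl | rfl⟩
    · exact hmem i
    · exact inv_mem (hmem i)

end Rigid

section Lifting

open FreeGroup
open scoped Classical

variable {n N ℓ : ℕ} {r : Fin N → FreeGroup (Fin n)}

theorem Rigid.exists_lift {C : ℕ} (hC0 : 0 < C) (h : Rigid ℓ (200 * C) (3 * C + 2) r)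
    (hr : r ∈ relTuples n ℓ N) (hl : 100 * C ≤ ℓ) {V : Type*} [DecidableEq V]
    {E : Finset (FreeGroup V)}
    (hC : ∑ w ∈ E, w.toWord.length ≤ C) (S : Set V) (θ₀ : V → FreeGroup (Fin n))
    (hS : ∀ v ∈ S, (θ₀ v).toWord.length ≤ 2 * (ℓ / (100 * C)))
    (hθ₀ : ∀ w ∈ E, randProj r (FreeGroup.lift θ₀ w) = 1) :
    ∃ θ : V → FreeGroup (Fin n), (∀ v, randProj r (θ v) = randProj r (θ₀ v)) ∧
      (∀ v ∈ S, θ v = θ₀ v) ∧ ∀ w ∈ E, FreeGroup.lift θ w = 1 := by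
  have hl0 : 0 < ℓ := by omega
  set k := ℓ / (100 * C) with hk
  have hk0 : 0 < k := Nat.div_pos hl (by omega)
  have hk1 : k * (100 * C) ≤ ℓ := Nat.div_mul_le_self _ _
  have hk2 : ℓ < (k + 1) * (100 * C) := by
    rw [← Nat.div_lt_iff_lt_mul (by omega)]
    exact Nat.lt_succ_self _
  have hkC : k ≤ k * C := Nat.le_mul_of_pos_right _ hC0
  have hCk : C ≤ k * C := Nat.le_mul_of_pos_left _ hk0
  rw [show k * (100 * C) = 100 * (k * C) by ring] at hk1
  rw [show (k + 1) * (100 * C) = 100 * (k * C) + 100 * C by ring] at hk2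
  have hproj : ∀ x, randProj r x = 1 ↔
      x ∈ Subgroup.normalClosure (circleRel fun i => core (r i)) := fun x => by
    rw [← normalClosure_range_eq]
    exact QuotientGroup.eq_one_iff x
  obtain ⟨θ, h1, h2, h3⟩ := exists_lift_of_unique (ρ := fun i => core (r i))
    (fun i => isCyclicallyReduced_core (r i)) hC
    (k₁ := ℓ / 16) (k₂ := k) (by omega) (by omega)
    (by rw [show 84 * k * C = 84 * (k * C) by ring]; omega)
    (fun i => h.le_length_core hr (by omega) hl0 i)
    (fun i q hq => h.uniqueIn_univ hr hl0 (by omega) (by omega) (by omega) (by omega) i hq)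
    (fun I hI hIC => h.exists_unique_colours hr hl0 hk0 (by omega)
      (by rw [show k * (200 * C) = 200 * (k * C) by ring]; omega) I hI (by omega))
    S θ₀ hS (fun w hw => (hproj _).1 (hθ₀ w hw))
  refine ⟨θ, fun v => ?_, h2, h3⟩
  rw [← mul_inv_eq_one, ← _root_.map_inv, ← _root_.map_mul]
  exact (hproj _).2 (h1 v)

theorem randProj_lift {p m : ℕ} (r : Fin N → FreeGroup (Fin n)) (θ : Fin p → FreeGroup (Fin n))
    (a : Fin m → FreeGroup (Fin n)) (w : FreeGroup (Fin p ⊕ Fin m)) :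
    randProj r (FreeGroup.lift (Sum.elim θ a) w) =
      FreeGroup.lift (Sum.elim (fun i => randProj r (θ i)) fun i => randProj r (a i)) w := by
  rw [← MonoidHom.comp_apply]
  refine DFunLike.congr_fun (FreeGroup.ext_hom _ _ fun v => ?_) w
  rcases v with i | i <;> simp

theorem wop_lift (hn : 2 ≤ n) {d : ℝ} (hd : d < 1 / 16) {p m : ℕ}
    (E : Finset (FreeGroup (Fin p ⊕ Fin m))) (a : Fin m → FreeGroup (Fin n)) :
    wop n d fun _ r => ∀ x : Fin p → RandGroup r,
      (∀ w ∈ E, FreeGroup.lift (Sum.elim x fun i => randProj r (a i)) w = 1) →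
      ∃ θ : Fin p → FreeGroup (Fin n), (∀ i, randProj r (θ i) = x i) ∧
        ∀ w ∈ E, FreeGroup.lift (Sum.elim θ a) w = 1 := by
  set C := ∑ w ∈ E, w.toWord.length + 1 with hC
  set A := ∑ i, (a i).toWord.length with hA
  refine (wop_rigid hn hd (200 * C) (3 * C + 2)).mono hn ?_
  filter_upwards [eventually_ge_atTop (100 * C * (A + 1))] with ℓ hℓ r hr h x hx
  have hA' : A + 1 ≤ ℓ / (100 * C) := by
    rw [Nat.le_div_iff_mul_le (by omega), mul_comm]
    exact hℓ
  choose θ₀ hθ₀ using fun i => QuotientGroup.mk'_surjective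
    (Subgroup.normalClosure (Set.range r)) (x i)
  obtain ⟨θ, h1, h2, h3⟩ := h.exists_lift (by omega) hr
    (le_trans (Nat.le_mul_of_pos_right _ (by omega)) hℓ) (E := E) (by omega)
    (Set.range Sum.inr) (Sum.elim θ₀ a) (by
      rintro _ ⟨i, rfl⟩
      have : (a i).toWord.length ≤ A :=
        Finset.single_le_sum (f := fun i => (a i).toWord.length) (fun _ _ => Nat.zero_le _)
          (Finset.mem_univ i)
      rw [Sum.elim_inr]
      omega)
    (fun w hw => by
      rw [randProj_lift, show (fun i => randProj r (θ₀ i)) = x from funext hθ₀]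
      exact hx w hw)
  refine ⟨fun i => θ (Sum.inl i), fun i => (h1 _).trans (hθ₀ i), ?_⟩
  have hθ : Sum.elim (fun i => θ (Sum.inl i)) a = θ := by
    funext v
    rcases v with i | i
    · rfl
    · exact (h2 _ ⟨i, rfl⟩).symm
  rwa [hθ]

end Lifting

section Sentences

open scoped Classical

/-- The words occurring in a boolean combination of equations. -/
noncomputable def BoolComb.atoms {α : Type*} : BoolComb α → Finset α
  | .eq w => {w}
  | .not φ => φ.atoms
  | .and φ ψ => φ.atoms ∪ ψ.atoms
  | .or φ ψ => φ.atoms ∪ ψ.atoms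

theorem BoolComb.holds_congr {α G H : Type*} [Group G] [Group H] {f : α → G} {g : α → H}
    (φ : BoolComb α) (h : ∀ w ∈ φ.atoms, f w = 1 ↔ g w = 1) : φ.Holds f ↔ φ.Holds g := by
  induction φ with
  | eq w => exact h w (by simp [atoms])
  | not φ ih => exact not_congr (ih h)
  | and φ ψ ih₁ ih₂ =>
    exact and_congr (ih₁ fun w hw => h w (Finset.mem_union_left _ hw))
      (ih₂ fun w hw => h w (Finset.mem_union_right _ hw))
  | or φ ψ ih₁ ih₂ =>
    exact or_congr (ih₁ fun w hw => h w (Finset.mem_union_left _ hw))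
      (ih₂ fun w hw => h w (Finset.mem_union_right _ hw))

variable {n : ℕ}

theorem wop_randProj_ne_one (hn : 2 ≤ n) {d : ℝ} (hd : d < 1 / 16) {g : FreeGroup (Fin n)}
    (hg : g ≠ 1) : wop n d fun _ r => randProj r g ≠ 1 := by
  refine (wop_lift hn hd (p := 0) (m := 1) {FreeGroup.of (Sum.inr 0)} fun _ => g).mono hn
    (Eventually.of_forall fun ℓ r _ h h1 => hg ?_)
  obtain ⟨θ, -, hθ⟩ := h Fin.elim0 (by simpa using h1)
  simpa using hθ

theorem satAc_of_wop (hn : 2 ≤ n) {d : ℝ} (hd : d < 1 / 16) {p m : ℕ}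
    (φ : BoolComb (FreeGroup (Fin p ⊕ Fin m))) (a : Fin m → FreeGroup (Fin n))
    (h : wop n d fun _ r => SatAc (RandGroup r) φ fun i => randProj r (a i)) :
    SatAc (FreeGroup (Fin n)) φ a := by
  intro x
  have h1 := h.and hn <| wop.ball hn
    (φ.atoms.filter fun w => FreeGroup.lift (Sum.elim x a) w ≠ 1) fun w hw =>
      wop_randProj_ne_one hn hd (Finset.mem_filter.1 hw).2
  obtain ⟨ℓ, r, -, h2, h3⟩ := h1.eventually_exists.exists
  refine (BoolComb.holds_congr φ fun w hw => ?_).1 (h2 fun i => randProj r (x i))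
  rw [← randProj_lift]
  refine ⟨fun h4 => by_contra fun h5 => h3 w (Finset.mem_filter.2 ⟨hw, h5⟩) h4, fun h4 => ?_⟩
  rw [h4, map_one]

theorem wop_of_satAc (hn : 2 ≤ n) {d : ℝ} (hd : d < 1 / 16) {p m : ℕ}
    (φ : BoolComb (FreeGroup (Fin p ⊕ Fin m))) (a : Fin m → FreeGroup (Fin n))
    (h : SatAc (FreeGroup (Fin n)) φ a) :
    wop n d fun _ r => SatAc (RandGroup r) φ fun i => randProj r (a i) := by
  refine (wop.ball hn φ.atoms.powerset fun E _ => wop_lift hn hd E a).mono hn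
    (Eventually.of_forall fun ℓ r _ h1 x => ?_)
  obtain ⟨θ, h2, h3⟩ := h1 (φ.atoms.filter fun w =>
    FreeGroup.lift (Sum.elim x fun i => randProj r (a i)) w = 1)
    (Finset.mem_powerset.2 (Finset.filter_subset _ _)) x fun w hw => (Finset.mem_filter.1 hw).2
  refine (BoolComb.holds_congr φ fun w hw =>
    ⟨fun h4 => ?_, fun h4 => h3 w (Finset.mem_filter.2 ⟨hw, h4⟩)⟩).1 (h θ)
  rw [← funext h2, ← randProj_lift, h4, map_one]

end Sentences

/-- A universal sentence with constants `ā` from `F_n` (interpreted in the random group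
via the quotient map `π_ℓ`) is true in `F_n` if and only if it is true with overwhelming
probability in a random group of density `d < 1/16`. -/
theorem randomGroup_satisfies_universal_with_constants_iff_free
    (n : ℕ) (hn : 2 ≤ n) (d : ℝ) (hd0 : 0 ≤ d) (hd : d < 1/16)
    (p m : ℕ) (φ : BoolComb (FreeGroup (Fin p ⊕ Fin m)))
    (a : Fin m → FreeGroup (Fin n)) :
    SatAc (FreeGroup (Fin n)) φ a ↔
      wop n d (fun _ r => SatAc (RandGroup r) φ (fun i => randProj r (a i))) := by
  exact ⟨wop_of_satAc hn hd φ a, satAc_of_wop hn hd φ a⟩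
end

section
/- Let F be a free group with a basis containing two distinct elements e₁ and e₂. Then for all x, y ∈ F: (x = 1 and y = 1) if and only if (x²e₁)²e₁⁻² = ((ye₂)²e₂⁻²)². -/
/-- The integral Heisenberg group: `⟨a, b, c⟩` stands for the upper unitriangular `3 × 3` matrix
with entries `a`, `b` above the diagonal and `c` in the corner. -/
@[ext]
structure IntHeisenberg where
  a : ℤ
  b : ℤ
  c : ℤ

namespace IntHeisenberg

instance : Mul IntHeisenberg := ⟨fun g h => ⟨g.a + h.a, g.b + h.b, g.c + h.c + g.a * h.b⟩⟩

instance : One IntHeisenberg := ⟨⟨0, 0, 0⟩⟩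

instance : Inv IntHeisenberg := ⟨fun g => ⟨-g.a, -g.b, -g.c + g.a * g.b⟩⟩

@[simp] theorem mul_a (g h : IntHeisenberg) : (g * h).a = g.a + h.a := rfl

@[simp] theorem mul_b (g h : IntHeisenberg) : (g * h).b = g.b + h.b := rfl

@[simp] theorem mul_c (g h : IntHeisenberg) : (g * h).c = g.c + h.c + g.a * h.b := rfl

@[simp] theorem one_a : (1 : IntHeisenberg).a = 0 := rfl

@[simp] theorem one_b : (1 : IntHeisenberg).b = 0 := rfl

@[simp] theorem one_c : (1 : IntHeisenberg).c = 0 := rfl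

@[simp] theorem inv_a (g : IntHeisenberg) : g⁻¹.a = -g.a := rfl

@[simp] theorem inv_b (g : IntHeisenberg) : g⁻¹.b = -g.b := rfl

@[simp] theorem inv_c (g : IntHeisenberg) : g⁻¹.c = -g.c + g.a * g.b := rfl

instance : Group IntHeisenberg where
  mul_assoc _ _ _ := by ext <;> simp <;> ring
  one_mul _ := by ext <;> simp
  mul_one _ := by ext <;> simp
  inv_mul_cancel _ := by ext <;> simp

/-- The homomorphism to `ℤ/2` that takes `⟨a, b, c⟩` to `α a + β b`. -/
def parity (α β : ZMod 2) : IntHeisenberg →* Multiplicative (ZMod 2) :=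
  MonoidHom.mk' (fun g => Multiplicative.ofAdd (α * g.a + β * g.b)) fun g h => by
    rw [← ofAdd_add]
    congr 1
    push_cast [mul_a, mul_b]
    ring

theorem parity_eq_one {α β : ZMod 2} {g : IntHeisenberg} :
    parity α β g = 1 ↔ α * g.a + β * g.b = 0 := Iff.rfl

/-- A solution of `x² y² = z²` in the Heisenberg group lies in a subgroup of index two. -/
theorem exists_parity_eq_one {x y z : IntHeisenberg} (h : x ^ 2 * y ^ 2 = z ^ 2) :
    ∃ α β : ZMod 2, (α ≠ 0 ∨ β ≠ 0) ∧
      parity α β x = 1 ∧ parity α β y = 1 ∧ parity α β z = 1 := by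
  have ha := congrArg IntHeisenberg.a h
  have hb := congrArg IntHeisenberg.b h
  have hc := congrArg IntHeisenberg.c h
  simp only [pow_two, mul_a, mul_b, mul_c] at ha hb hc
  replace ha : z.a = x.a + y.a := by lia
  replace hb : z.b = x.b + y.b := by lia
  rw [ha, hb] at hc
  have hdet : x.a * y.b + y.a * x.b = 2 * (x.c + y.c - z.c + 2 * (x.a * y.b)) := by
    linear_combination -hc
  have hdet₂ : (x.a : ZMod 2) * y.b + y.a * x.b = 0 := by
    have h2 : (2 : ZMod 2) = 0 := rfl
    have := congrArg (Int.cast : ℤ → ZMod 2) hdet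
    push_cast at this
    simpa [h2] using this
  have key : ∀ p q r s : ZMod 2, p * s + r * q = 0 →
      ∃ α β : ZMod 2, (α ≠ 0 ∨ β ≠ 0) ∧ α * p + β * q = 0 ∧ α * r + β * s = 0 := by
    decide
  obtain ⟨α, β, hne, hx, hy⟩ := key _ _ _ _ hdet₂
  refine ⟨α, β, hne, parity_eq_one.2 hx, parity_eq_one.2 hy, parity_eq_one.2 ?_⟩
  rw [ha, hb]
  push_cast
  linear_combination hx + hy

end IntHeisenberg

/-- A free group is either cyclic or has the Heisenberg group as a quotient. -/
theorem IsFreeGroup.isCyclic_or_exists_hom (G : Type*) [Group G] [IsFreeGroup G] :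
    IsCyclic G ∨ ∃ (f : G →* IntHeisenberg) (p q : G), f p = ⟨1, 0, 0⟩ ∧ f q = ⟨0, 1, 0⟩ := by
  classical
  rcases subsingleton_or_nontrivial (IsFreeGroup.Generators G) with hs | hn
  · left
    have : IsCyclic (FreeGroup (IsFreeGroup.Generators G)) := by
      cases isEmpty_or_nonempty (IsFreeGroup.Generators G)
      · infer_instance
      · have := Classical.choice (nonempty_unique (IsFreeGroup.Generators G))
        infer_instance
    exact isCyclic_of_surjective _ (IsFreeGroup.mulEquiv G).surjective
  · right
    obtain ⟨p, q, hpq⟩ := exists_pair_ne (IsFreeGroup.Generators G)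
    refine ⟨IsFreeGroup.lift fun i => if i = p then ⟨1, 0, 0⟩ else ⟨0, 1, 0⟩,
      IsFreeGroup.of p, IsFreeGroup.of q, ?_, ?_⟩ <;> simp [hpq.symm]

theorem commute_of_isCyclic_subgroup {G : Type*} [Group G] {H : Subgroup G} [IsCyclic H] {x y : G}
    (hx : x ∈ H) (hy : y ∈ H) : Commute x y := by
  obtain ⟨g, hg⟩ := IsCyclic.exists_generator (α := H)
  obtain ⟨m, hm⟩ := hg ⟨x, hx⟩
  obtain ⟨n, hn⟩ := hg ⟨y, hy⟩
  obtain rfl : (g : G) ^ m = x := congrArg Subtype.val hm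
  obtain rfl : (g : G) ^ n = y := congrArg Subtype.val hn
  exact Commute.zpow_zpow_self _ _ _

/-- Roots in a torsion-free group commute with whatever their powers commute with. -/
theorem Commute.of_zpow_left {G : Type*} [Group G] [IsMulTorsionFree G] {x y : G} {n : ℤ}
    (hn : n ≠ 0) (h : Commute (x ^ n) y) : Commute x y := by
  have : (y * x * y⁻¹) ^ n = x ^ n := by
    rw [conj_zpow, ← h.eq, mul_inv_cancel_right]
  exact (mul_inv_eq_iff_eq_mul.1 (zpow_left_injective hn this)).symm

namespace FreeGroup

variable {α : Type*}

/-- A commutative subgroup of a free group is cyclic. -/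
theorem isCyclic_subgroup_of_commute {H : Subgroup (FreeGroup α)}
    (h : ∀ x ∈ H, ∀ y ∈ H, Commute x y) : IsCyclic H := by
  refine (IsFreeGroup.isCyclic_or_exists_hom H).resolve_right ?_
  rintro ⟨f, p, q, hp, hq⟩
  have hpq : p * q = q * p := Subtype.ext (h p p.2 q q.2)
  have := congrArg (fun g => (f g).c) hpq
  simp [hp, hq] at this

/-- The Lyndon–Schützenberger theorem for exponents two (due to Lyndon). -/
theorem commute_of_sq_mul_sq_eq_sq {x y z : FreeGroup α} (h : x ^ 2 * y ^ 2 = z ^ 2) :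
    Commute x y := by
  let S : Set (FreeGroup α) := {x, y, z}
  have hx : x ∈ Subgroup.closure S := Subgroup.subset_closure (by simp [S])
  have hy : y ∈ Subgroup.closure S := Subgroup.subset_closure (by simp [S])
  have hz : z ∈ Subgroup.closure S := Subgroup.subset_closure (by simp [S])
  rcases IsFreeGroup.isCyclic_or_exists_hom (Subgroup.closure S) with hc | ⟨f, p, q, hp, hq⟩
  · exact commute_of_isCyclic_subgroup hx hy
  · have hf : f ⟨x, hx⟩ ^ 2 * f ⟨y, hy⟩ ^ 2 = f ⟨z, hz⟩ ^ 2 := by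
      have hS : (⟨x, hx⟩ ^ 2 * ⟨y, hy⟩ ^ 2 : Subgroup.closure S) = ⟨z, hz⟩ ^ 2 := Subtype.ext h
      rw [← map_pow, ← map_pow, ← map_pow, ← hS]
      exact (f.map_mul _ _).symm
    obtain ⟨a, b, hne, hfx, hfy, hfz⟩ := IntHeisenberg.exists_parity_eq_one hf
    have htriv : (IntHeisenberg.parity a b).comp f = 1 := by
      refine MonoidHom.eq_of_eqOn_dense (Subgroup.closure_closure_coe_preimage (k := S)) ?_
      intro g hg
      obtain h | h | h : g = ⟨x, hx⟩ ∨ g = ⟨y, hy⟩ ∨ g = ⟨z, hz⟩ := by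
        simpa [S, Subtype.ext_iff] using hg
      all_goals rw [h]
      exacts [hfx, hfy, hfz]
    have hp₁ := DFunLike.congr_fun htriv p
    have hq₁ := DFunLike.congr_fun htriv q
    simp only [MonoidHom.comp_apply, MonoidHom.one_apply, hp, hq,
      IntHeisenberg.parity_eq_one] at hp₁ hq₁
    simp_all

/-- Commutation is transitive on the nontrivial elements of a free group. -/
theorem commute_trans {x y z : FreeGroup α} (hy : y ≠ 1) (hxy : Commute x y) (hyz : Commute y z) :
    Commute x z := by
  have hcyc : IsCyclic (Subgroup.closure {x, y}) :=
    isCyclic_subgroup_of_commute fun u hu v hv => by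
      have hc := Subgroup.isMulCommutative_closure (k := {x, y}) (by
        rintro a (rfl | rfl) b (rfl | rfl)
        exacts [rfl, hxy, hxy.symm, rfl])
      exact congrArg Subtype.val (hc.is_comm.comm ⟨u, hu⟩ ⟨v, hv⟩)
  obtain ⟨g, hg⟩ := IsCyclic.exists_generator (α := Subgroup.closure {x, y})
  obtain ⟨m, hm⟩ := hg ⟨x, Subgroup.subset_closure (by simp)⟩
  obtain ⟨n, hn⟩ := hg ⟨y, Subgroup.subset_closure (by simp)⟩
  replace hm : (g : FreeGroup α) ^ m = x := congrArg Subtype.val hm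
  replace hn : (g : FreeGroup α) ^ n = y := congrArg Subtype.val hn
  have hn₀ : n ≠ 0 := by
    rintro rfl
    exact hy (hn.symm.trans (zpow_zero _))
  rw [← hn] at hyz
  rw [← hm]
  exact (hyz.of_zpow_left hn₀).zpow_left m

/-- In a free group, an element that commutes with its conjugate by `a` commutes with `a`. -/
theorem commute_of_commute_conj {x a : FreeGroup α} (h : Commute x (a * x * a⁻¹)) :
    Commute x a := by
  rcases eq_or_ne x 1 with rfl | hx
  · exact Commute.one_left a
  have hcyc : IsCyclic (Subgroup.centralizer {x}) :=
    isCyclic_subgroup_of_commute fun u hu v hv =>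
      commute_trans hx (Subgroup.mem_centralizer_singleton_iff.1 hu)
        (Subgroup.mem_centralizer_singleton_iff.1 hv).symm
  obtain ⟨⟨g, hgx⟩, hg⟩ := IsCyclic.exists_generator (α := Subgroup.centralizer {x})
  replace hgx : Commute g x := Subgroup.mem_centralizer_singleton_iff.1 hgx
  replace hg : ∀ u, Commute u x → ∃ n : ℤ, g ^ n = u := fun u hu => by
    obtain ⟨n, hn⟩ := hg ⟨u, Subgroup.mem_centralizer_singleton_iff.2 hu⟩
    exact ⟨n, congrArg Subtype.val hn⟩
  have hconj : ∀ b : FreeGroup α, Commute x (b * x * b⁻¹) → ∃ n : ℤ, g ^ n = b * g * b⁻¹ :=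
    fun b hb => hg _ <| commute_trans (by simpa using hx)
      (by simpa using hgx.map (MulAut.conj b)) hb.symm
  have h' : Commute x (a⁻¹ * x * a⁻¹⁻¹) := by
    simpa [mul_assoc] using (h.map (MulAut.conj a⁻¹)).symm
  obtain ⟨m, hm⟩ := hconj a h
  obtain ⟨n, hn⟩ := hconj a⁻¹ h'
  obtain ⟨k, rfl⟩ := hg x (Commute.refl x)
  have hg₁ : g ≠ 1 := by
    rintro rfl
    exact hx (one_zpow k)
  have hmn : m * n = 1 := by
    have hpow : g ^ (m * n - 1) = 1 := by
      rw [zpow_sub_one, zpow_mul, hm, conj_zpow, hn]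
      group
    exact sub_eq_zero.1 ((IsMulTorsionFree.zpow_eq_one_iff_right hg₁).1 hpow)
  refine Commute.zpow_left ?_ k
  rcases Int.eq_one_or_neg_one_of_mul_eq_one hmn with rfl | rfl
  · rw [zpow_one] at hm
    exact eq_mul_inv_iff_mul_eq.1 hm
  · rw [zpow_neg_one] at hm
    have hg₂ : a * g = g⁻¹ * a := (eq_mul_inv_iff_mul_eq.1 hm).symm
    have hg₃ : a * g⁻¹ = g * a := by
      rw [← inv_inj] at hm
      exact (eq_mul_inv_iff_mul_eq.1 (by simpa [mul_assoc] using hm)).symm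
    refine (Commute.of_zpow_left two_ne_zero ?_).symm
    rw [zpow_two, commute_iff_eq, mul_assoc, hg₂, ← mul_assoc, hg₃, mul_assoc]

theorem commute_of_of_iff {i j : α} : Commute (of i) (of j) ↔ i = j := by
  classical
  refine ⟨fun h => ?_, fun h => h ▸ Commute.refl _⟩
  by_contra hij
  have := congrArg toWord h.eq
  simp [toWord_mul, reduce.cons, hij] at this

end FreeGroup

/-- Malcev's lemma: in a free group `F` whose basis contains two distinct elements
`e₁ = of i` and `e₂ = of j`, a conjunction of two equations is equivalent to the single
equation `(x²e₁)²e₁⁻² = ((ye₂)²e₂⁻²)²`: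
for all `x, y ∈ F`, `x = 1 ∧ y = 1 ↔ (x²e₁)²e₁⁻² = ((ye₂)²e₂⁻²)²`. -/
theorem malcev_conjunction {β : Type*} (i j : β) (hij : i ≠ j) (x y : FreeGroup β) :
    (x = 1 ∧ y = 1) ↔
      (x ^ 2 * FreeGroup.of i) ^ 2 * (FreeGroup.of i)⁻¹ ^ 2 =
        ((y * FreeGroup.of j) ^ 2 * (FreeGroup.of j)⁻¹ ^ 2) ^ 2 := by
  constructor
  · rintro ⟨rfl, rfl⟩
    simp [pow_two]
  intro h
  set a := FreeGroup.of i
  set b := FreeGroup.of j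
  set w := (y * b) ^ 2 * b⁻¹ ^ 2 with hw
  have hwb : w * b ^ 2 = (y * b) ^ 2 := by simp [hw]
  have hconj : x ^ 2 * (a * x * a⁻¹) ^ 2 = w ^ 2 := by
    rw [← h]
    simp [pow_two, mul_assoc]
  rcases eq_or_ne x 1 with rfl | hx
  · have hw₁ : w = 1 := pow_left_injective two_ne_zero (by simpa using hconj.symm)
    rw [hw₁, one_mul] at hwb
    exact ⟨rfl, by simpa using pow_left_injective two_ne_zero hwb⟩
  · exfalso
    have hxa : Commute x a :=
      FreeGroup.commute_of_commute_conj (FreeGroup.commute_of_sq_mul_sq_eq_sq hconj)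
    have hwx : w = x ^ 2 := by
      rw [← hxa.eq, mul_inv_cancel_right, ← pow_two] at hconj
      exact (pow_left_injective two_ne_zero hconj).symm
    have hxb : Commute x b := FreeGroup.commute_of_sq_mul_sq_eq_sq (hwx ▸ hwb)
    exact hij (FreeGroup.commute_of_of_iff.1 (FreeGroup.commute_trans hx hxa.symm hxb))
end

section
/- Let F be a nonabelian free group with finite basis ā, and let X, Y be finite sets of variables. Let Σ(x̄,ȳ,ā) and Ψ(x̄,ȳ,ā) be finite sets of words in the variables X ∪ Y and constants ā. Suppose that for every assignment x̄ : X → F there exists an assignment ȳ : Y → F such that every word of Σ evaluates to 1 in F and every word of Ψ evaluates to a nontrivial element of F. Then there exists a tuple of words w̄(x̄,ā), one for each variable in Y, in the free group on X ∪ ā, such that: (1) substituting w̄ for ȳ makes every word of Σ equal to the identity of the free group on X ∪ ā; and (2) there exists an assignment x̄ : X → F such that every word of Ψ, evaluated at x̄ and at the values w̄(x̄,ā) ∈ F, is nontrivial in F. -/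
open Monoid (CoprodI)

namespace SyllableMap

section General

open Monoid.CoprodI

variable {ι G : Type*} {M : ι → Type*} [∀ i, Group (M i)] [Group G]

/-- Apply `f i` to every syllable from `M i` of a reduced word and multiply the results. -/
def wordMap (f : ∀ i, M i → G) (w : Word M) : G :=
  (w.toList.map fun s => f s.1 s.2).prod

theorem wordMap_cons (f : ∀ i, M i → G) {i : ι} (m : M i) (w : Word M)
    (hw : w.fstIdx ≠ some i) (hm : m ≠ 1) :
    wordMap f (Word.cons m w hw hm) = f i m * wordMap f w := by
  simp [wordMap, Word.cons]

variable [DecidableEq ι] [∀ i, DecidableEq (M i)]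

theorem wordMap_smul (f : ∀ i, M i → G) (hf : ∀ i, f i 1 = 1) {i : ι} (m : M i) (w : Word M)
    (hw : w.fstIdx ≠ some i) :
    wordMap f (of m • w) = f i m * wordMap f w := by
  by_cases hm : m = 1
  · subst hm
    simp [hf]
  · rw [← Word.cons_eq_smul (h1 := hw) (h2 := hm), wordMap_cons]

theorem fstIdx_smul {i : ι} {m : M i} (hm : m ≠ 1) {w : Word M} (hw : w.fstIdx ≠ some i) :
    (of m • w).fstIdx = some i := by
  rw [← Word.cons_eq_smul (h1 := hw) (h2 := hm), Word.fstIdx_cons]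

theorem exists_eq_smul (i : ι) (w : Word M) :
    ∃ (n : M i) (w' : Word M), w'.fstIdx ≠ some i ∧ w = of n • w' :=
  ⟨(Word.equivPair i w).head, (Word.equivPair i w).tail, (Word.equivPair i w).fstIdx_ne,
    (Word.equivPair_head_smul_equivPair_tail w).symm⟩

theorem wordMap_prod_inv_smul (f : ∀ i, M i → G) (hf : ∀ i, f i 1 = 1)
    (hinv : ∀ i m, f i m⁻¹ = (f i m)⁻¹) (u v : Word M)
    (huv : ∀ i, u.fstIdx = some i → v.fstIdx ≠ some i) :
    wordMap f (u.prod⁻¹ • v) = (wordMap f u)⁻¹ * wordMap f v := by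
  induction u using Word.consRecOn generalizing v with
  | empty => simp [wordMap]
  | cons i m w hw hm ih =>
    have hv : v.fstIdx ≠ some i := huv i (Word.fstIdx_cons ..)
    rw [Word.prod_cons, mul_inv_rev, mul_smul, ← map_inv, ih, wordMap_smul f hf _ _ hv, hinv,
      wordMap_cons, mul_inv_rev, mul_assoc]
    intro j hj
    rw [fstIdx_smul (inv_ne_one.mpr hm) hv]
    rintro ⟨rfl⟩
    exact hw hj

theorem exists_wordMap_prod_inv_smul [Nonempty ι] (u v : Word M) :
    ∃ (i : ι) (m n : M i), ∀ f : ∀ i, M i → G, (∀ i, f i 1 = 1) →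
      (∀ i m, f i m⁻¹ = (f i m)⁻¹) → f i (m⁻¹ * n) = (f i m)⁻¹ * f i n →
      wordMap f (u.prod⁻¹ • v) = (wordMap f u)⁻¹ * wordMap f v := by
  induction u using Word.consRecOn generalizing v with
  | empty =>
    obtain ⟨i⟩ := ‹Nonempty ι›
    exact ⟨i, 1, 1, fun f _ _ _ => by simp [wordMap]⟩
  | cons i m w hw hm ih =>
    obtain ⟨n, v, hv, rfl⟩ := exists_eq_smul i v
    by_cases hmn : m = n
    · subst hmn
      obtain ⟨j, p, q, hj⟩ := ih v
      refine ⟨j, p, q, fun f hf hinv hpq => ?_⟩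
      rw [Word.prod_cons, mul_inv_rev, mul_smul, inv_smul_smul, hj f hf hinv hpq, wordMap_cons,
        wordMap_smul f hf _ _ hv]
      group
    · refine ⟨i, m, n, fun f hf hinv hpq => ?_⟩
      rw [Word.prod_cons, mul_inv_rev, mul_smul, ← map_inv, ← mul_smul (of m⁻¹), ← map_mul,
        wordMap_prod_inv_smul f hf hinv, wordMap_smul f hf _ _ hv, wordMap_cons,
        wordMap_smul f hf _ _ hv, hpq]
      · group
      · intro j hj
        rw [fstIdx_smul (by rwa [ne_eq, inv_mul_eq_one]) hv]
        rintro ⟨rfl⟩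
        exact hw hj

/-- Apply `f i` to every syllable from `M i` of the normal form of an element of the free product
and multiply the results. -/
def coprodMap (f : ∀ i, M i → G) (g : CoprodI M) : G :=
  wordMap f (Word.equiv g)

theorem equiv_mul (g h : CoprodI M) : Word.equiv (g * h) = g • Word.equiv h := by
  simp [Word.equiv, mul_smul]

theorem prod_equiv (g : CoprodI M) : (Word.equiv g).prod = g :=
  Word.equiv.symm_apply_apply g

theorem equiv_one : Word.equiv (1 : CoprodI M) = Word.empty := by
  simp [Word.equiv]

theorem coprodMap_one (f : ∀ i, M i → G) : coprodMap f (1 : CoprodI M) = 1 := by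
  simp [coprodMap, equiv_one, wordMap]

theorem coprodMap_of (f : ∀ i, M i → G) (hf : ∀ i, f i 1 = 1) {i : ι} (m : M i) :
    coprodMap f (of m) = f i m := by
  have h := wordMap_smul f hf m Word.empty (by simp [Word.fstIdx])
  rw [← equiv_one, ← equiv_mul, mul_one] at h
  simpa [coprodMap, equiv_one, wordMap] using h

theorem coprodMap_inv (f : ∀ i, M i → G) (hf : ∀ i, f i 1 = 1)
    (hinv : ∀ i m, f i m⁻¹ = (f i m)⁻¹) (g : CoprodI M) :
    coprodMap f g⁻¹ = (coprodMap f g)⁻¹ := by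
  have h := wordMap_prod_inv_smul f hf hinv (Word.equiv g) Word.empty (by simp [Word.fstIdx])
  rw [prod_equiv, ← equiv_one, ← equiv_mul, mul_one] at h
  simpa [coprodMap, equiv_one, wordMap] using h

theorem map_coprodMap {H : Type*} [Group H] (ρ : G →* H) (D : CoprodI M →* H)
    (f : ∀ i, M i → G) (hf : ∀ i m, ρ (f i m) = D (of m)) (g : CoprodI M) :
    ρ (coprodMap f g) = D g := by
  conv_rhs => rw [← prod_equiv g]
  rw [coprodMap, wordMap, Word.prod, map_list_prod, map_list_prod, List.map_map, List.map_map]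
  simp only [Function.comp_def, hf]

theorem exists_coprodMap_inv_mul [Nonempty ι] (g h : CoprodI M) :
    ∃ (i : ι) (m n : M i), ∀ f : ∀ i, M i → G, (∀ i, f i 1 = 1) →
      (∀ i m, f i m⁻¹ = (f i m)⁻¹) → f i (m⁻¹ * n) = (f i m)⁻¹ * f i n →
      coprodMap f (g⁻¹ * h) = (coprodMap f g)⁻¹ * coprodMap f h := by
  obtain ⟨i, m, n, H⟩ := exists_wordMap_prod_inv_smul (G := G) (Word.equiv g) (Word.equiv h)
  refine ⟨i, m, n, fun f hf hinv hmn => ?_⟩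
  have := H f hf hinv hmn
  rwa [prod_equiv, ← equiv_mul] at this

end General

section Powers

variable {β G : Type*} [Group G] [DecidableEq β]

/-- The family of maps on infinite cyclic groups that is the homomorphism `n ↦ c b ^ n` for
`b ≠ a`, and the odd extension of `ψ` for `b = a`. -/
def powerMap (c : β → G) (a : β) (ψ : ℕ → G) (b : β) (m : Multiplicative ℤ) : G :=
  if b = a then
    if 0 ≤ m.toAdd then ψ m.toAdd.natAbs else (ψ m.toAdd.natAbs)⁻¹
  else c b ^ m.toAdd

variable (c : β → G) (a : β) (ψ : ℕ → G)

theorem powerMap_of_ne {b : β} (hb : b ≠ a) (m : Multiplicative ℤ) :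
    powerMap c a ψ b m = c b ^ m.toAdd := by
  simp [powerMap, hb]

theorem powerMap_natCast (n : ℕ) : powerMap c a ψ a (Multiplicative.ofAdd (n : ℤ)) = ψ n := by
  simp [powerMap]

variable {c a ψ}

theorem powerMap_eq_zpow {b : β} {m : Multiplicative ℤ}
    (h : ψ m.toAdd.natAbs = c a ^ m.toAdd.natAbs) : powerMap c a ψ b m = c b ^ m.toAdd := by
  by_cases hb : b = a
  · subst hb
    rw [powerMap, if_pos rfl, h]
    obtain ⟨n, hn | hn⟩ := Int.eq_nat_or_neg m.toAdd
    · simp [hn]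
    · rcases Nat.eq_zero_or_pos n with rfl | hpos
      · simp [hn]
      · simp [hn, Nat.pos_iff_ne_zero.mp hpos]
  · exact powerMap_of_ne _ _ _ hb _

theorem powerMap_one (hψ : ψ 0 = 1) (b : β) : powerMap c a ψ b 1 = 1 := by
  rw [powerMap_eq_zpow] <;> simp [hψ]

theorem powerMap_inv (hψ : ψ 0 = 1) (b : β) (m : Multiplicative ℤ) :
    powerMap c a ψ b m⁻¹ = (powerMap c a ψ b m)⁻¹ := by
  simp only [powerMap, toAdd_inv, Int.natAbs_neg, zpow_neg]
  by_cases hb : b = a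
  · simp only [if_pos hb]
    rcases lt_trichotomy m.toAdd 0 with h | h | h
    · rw [if_pos (by lia), if_neg (by lia), inv_inv]
    · simp [h, hψ]
    · rw [if_neg (by lia), if_pos (by lia)]
  · simp only [if_neg hb]

variable (c a)

theorem exists_coprodMap_powerMap_inv_mul (g h : CoprodI fun _ : β => Multiplicative ℤ) :
    ∃ B : Finset ℕ, B.card ≤ 3 ∧ ∀ ψ : ℕ → G, ψ 0 = 1 → (∀ k ∈ B, ψ k = c a ^ k) →
      coprodMap (powerMap c a ψ) (g⁻¹ * h) =
        (coprodMap (powerMap c a ψ) g)⁻¹ * coprodMap (powerMap c a ψ) h := by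
  have : Nonempty β := ⟨a⟩
  obtain ⟨i, m, n, H⟩ := exists_coprodMap_inv_mul (G := G) g h
  refine ⟨{(m⁻¹ * n).toAdd.natAbs, m.toAdd.natAbs, n.toAdd.natAbs}, Finset.card_le_three,
    fun ψ hψ hB => H _ (powerMap_one hψ) (powerMap_inv hψ) ?_⟩
  rw [powerMap_eq_zpow (hB _ (by simp)), powerMap_eq_zpow (hB _ (by simp)),
    powerMap_eq_zpow (hB _ (by simp)), toAdd_mul, toAdd_inv, zpow_add, zpow_neg]

theorem exists_coprodMap_lift_mk {Z : Type*} (v : Z → CoprodI fun _ : β => Multiplicative ℤ)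
    (L : List (Z × Bool)) :
    ∃ B : Finset ℕ, B.card ≤ 3 * L.length ∧ ∀ ψ : ℕ → G, ψ 0 = 1 →
      (∀ k ∈ B, ψ k = c a ^ k) →
      FreeGroup.lift (fun z => coprodMap (powerMap c a ψ) (v z)) (FreeGroup.mk L) =
        coprodMap (powerMap c a ψ) (FreeGroup.lift v (FreeGroup.mk L)) := by
  classical
  induction L with
  | nil => exact ⟨∅, by simp, fun ψ _ _ => by simp [coprodMap_one]⟩
  | cons s L ih =>
    obtain ⟨B, hB, H⟩ := ih
    obtain ⟨z, e⟩ := s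
    obtain ⟨B', hB', H'⟩ := exists_coprodMap_powerMap_inv_mul c a
      (cond e (v z)⁻¹ (v z)) (FreeGroup.lift v (FreeGroup.mk L))
    refine ⟨B ∪ B', ?_, fun ψ hψ hk => ?_⟩
    · have := Finset.card_union_le B B'
      rw [List.length_cons]
      lia
    · have h1 := H ψ hψ fun k hk' => hk k (Finset.mem_union_left _ hk')
      have h2 := H' ψ hψ fun k hk' => hk k (Finset.mem_union_right _ hk')
      rw [FreeGroup.lift_mk, FreeGroup.lift_mk] at *
      rw [List.map_cons, List.prod_cons, List.map_cons, List.prod_cons, h1]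
      cases e
      · exact h2.symm
      · simpa [coprodMap_inv _ (powerMap_one hψ) (powerMap_inv hψ)] using h2.symm

theorem exists_coprodMap_lift {Z : Type*} (S : Finset (FreeGroup Z)) :
    ∃ K : ℕ, ∀ v : Z → CoprodI fun _ : β => Multiplicative ℤ,
      ∃ B : Finset ℕ, B.card ≤ K ∧ ∀ ψ : ℕ → G, ψ 0 = 1 → (∀ k ∈ B, ψ k = c a ^ k) →
        ∀ w ∈ S, FreeGroup.lift (fun z => coprodMap (powerMap c a ψ) (v z)) w =
          coprodMap (powerMap c a ψ) (FreeGroup.lift v w) := by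
  classical
  refine ⟨∑ w ∈ S, 3 * w.toWord.length, fun v => ?_⟩
  choose B hB H using fun w : FreeGroup Z => exists_coprodMap_lift_mk c a v w.toWord
  refine ⟨S.biUnion B, Finset.card_biUnion_le.trans (Finset.sum_le_sum fun w _ => hB w),
    fun ψ hψ hk w hw => ?_⟩
  have := H w ψ hψ fun k hk' => hk k (Finset.mem_biUnion.mpr ⟨w, hw, hk'⟩)
  rwa [FreeGroup.mk_toWord] at this

variable {c a}

/-- The syllable `b ^ n` in the free product of infinite cyclic groups. -/
abbrev syllable (b : β) (n : ℤ) : CoprodI fun _ : β => Multiplicative ℤ :=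
  CoprodI.of (i := b) (Multiplicative.ofAdd n)

theorem coprodMap_powerMap_list_prod (hψ : ψ 0 = 1) {b : β} (hab : b ≠ a) (l : List ℕ)
    (hl : ∀ k ∈ l, k ≠ 0) :
    coprodMap (powerMap c a ψ) (l.map fun k : ℕ => syllable a k * syllable b 1).prod =
      (l.map fun k => ψ k * c b).prod := by
  suffices h : ∀ w, w = CoprodI.Word.equiv
      (l.map fun k : ℕ => syllable a k * syllable b 1).prod →
      w.fstIdx ≠ some b ∧ wordMap (powerMap c a ψ) w = (l.map fun k => ψ k * c b).prod from
    (h _ rfl).2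
  induction l with
  | nil =>
    rintro w rfl
    simp [equiv_one, wordMap, CoprodI.Word.fstIdx]
  | cons k l ih =>
    rintro w rfl
    obtain ⟨h1, h2⟩ := ih (fun k hk => hl k (List.mem_cons_of_mem _ hk)) _ rfl
    rw [List.map_cons, List.prod_cons, mul_assoc, equiv_mul, equiv_mul]
    have hb : (Multiplicative.ofAdd (1 : ℤ)) ≠ 1 := by decide
    have ha : (Multiplicative.ofAdd (k : ℤ)) ≠ 1 := by
      simpa using hl k (by simp)
    have h3 := fstIdx_smul hb h1
    have h4 : (syllable b 1 • CoprodI.Word.equiv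
        (l.map fun k : ℕ => syllable a k * syllable b 1).prod).fstIdx ≠ some a := by
      rw [h3]
      simpa using hab
    refine ⟨?_, ?_⟩
    · rw [fstIdx_smul ha h4]
      simpa using hab.symm
    · rw [wordMap_smul _ (powerMap_one hψ) _ _ h4, wordMap_smul _ (powerMap_one hψ) _ _ h1, h2,
        powerMap_natCast, powerMap_of_ne _ _ _ hab]
      simp [mul_assoc]

theorem map_powerMap {H : Type*} [Group H] (ρ : G →* H) (b : β) (m : Multiplicative ℤ) :
    ρ (powerMap c a ψ b m) = powerMap (ρ ∘ c) a (ρ ∘ ψ) b m := by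
  simp only [powerMap, Function.comp_apply]
  split_ifs <;> simp

end Powers

/-- Given finitely many forbidden exponents, one can change the power function `k ↦ p ^ k` at one
allowed exponent `N x j` for each `x` so that the product of the `p ^ N x j * q`
becomes a prescribed element `u x`. -/
theorem exists_powers_perturbation {G H X : Type*} [Group G] [Group H] (p q : G) (u : X → G)
    (N : X → ℕ → ℕ) (hN : ∀ x y i j, N x i = N y j → x = y ∧ i = j) (K : ℕ) (B : Finset ℕ)
    (hB : B.card ≤ K) :
    ∃ ψ : ℕ → G, (∀ k ∈ B, ψ k = p ^ k) ∧ (∀ k, (∀ x j, k ≠ N x j) → ψ k = p ^ k) ∧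
      (∀ x, ((List.range (K + 1)).map fun j => ψ (N x j) * q).prod = u x) ∧
      ∀ ρ : G →* H,
        (∀ x, ρ (u x) = ((List.range (K + 1)).map fun j => ρ p ^ N x j * ρ q).prod) →
        ∀ k, ρ (ψ k) = ρ p ^ k := by
  classical
  have hex : ∀ x, ∃ j ∈ List.range (K + 1), N x j ∉ B := by
    intro x
    by_contra! hx
    have hsub : (Finset.range (K + 1)).image (N x) ⊆ B := by
      intro k hk
      obtain ⟨j, hj, rfl⟩ := Finset.mem_image.mp hk
      exact hx j (by simpa using hj)
    have hcard := Finset.card_le_card hsub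
    rw [Finset.card_image_of_injective _ fun i j hij => (hN x x i j hij).2,
      Finset.card_range] at hcard
    lia
  choose j hj hjB using hex
  choose s t hst using fun x => List.append_of_mem (hj x)
  have hnodup : ∀ x, (s x ++ j x :: t x).Nodup := fun x => hst x ▸ List.nodup_range
  have hs : ∀ x, ∀ i ∈ s x, i ≠ j x := by
    rintro x i hi rfl
    exact (List.nodup_middle.mp (hnodup x)).notMem (List.mem_append_left _ hi)
  have ht : ∀ x, ∀ i ∈ t x, i ≠ j x := by
    rintro x i hi rfl
    exact (List.nodup_middle.mp (hnodup x)).notMem (List.mem_append_right _ hi)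
  let block : X → List ℕ → G := fun x l => (l.map fun i => p ^ N x i * q).prod
  let g : X → G := fun x => (block x (s x))⁻¹ * u x * (block x (t x))⁻¹ * q⁻¹
  let ψ : ℕ → G := fun k => if h : ∃ x, k = N x (j x) then g h.choose else p ^ k
  have hψg : ∀ x, ψ (N x (j x)) = g x := by
    intro x
    have h : ∃ y, N x (j x) = N y (j y) := ⟨x, rfl⟩
    simp only [ψ, dif_pos h]
    rw [← (hN _ _ _ _ h.choose_spec).1]
  have hψp : ∀ k, (∀ x, k ≠ N x (j x)) → ψ k = p ^ k := by
    intro k hk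
    exact dif_neg (not_exists.mpr hk)
  have hψN : ∀ x i, i ≠ j x → ψ (N x i) = p ^ N x i := by
    intro x i hi
    refine hψp _ fun y hy => ?_
    obtain ⟨rfl, h⟩ := hN _ _ _ _ hy
    exact hi h
  have hblock : ∀ x l, (∀ i ∈ l, i ≠ j x) →
      (l.map fun i => ψ (N x i) * q).prod = block x l := by
    intro x l hl
    refine congrArg List.prod (List.map_congr_left fun i hi => ?_)
    rw [hψN x i (hl i hi)]
  refine ⟨ψ, fun k hk => hψp k ?_, fun k hk => hψp k fun x => hk x _, fun x => ?_,
    fun ρ hρ k => ?_⟩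
  · rintro x rfl
    exact hjB x hk
  · rw [hst, List.map_append, List.map_cons, List.prod_append, List.prod_cons,
      hblock x _ (hs x), hblock x _ (ht x), hψg]
    simp only [g]
    group
  · by_cases hk : ∃ x, k = N x (j x)
    · obtain ⟨x, rfl⟩ := hk
      have hρb : ∀ l, ρ (block x l) = (l.map fun i => ρ p ^ N x i * ρ q).prod := by
        intro l
        simp [block, map_list_prod, Function.comp_def]
      have h := hρ x
      rw [hst x, List.map_append, List.map_cons, List.prod_append, List.prod_cons, ← hρb,
        ← hρb] at h
      rw [hψg]
      simp only [g, map_mul, map_inv, h]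
      group
    · rw [hψp k (not_exists.mp hk), map_pow]

end SyllableMap

/-- Merzlyakov's theorem with inequations.  Let `F = FreeGroup β` be a nonabelian free
group with finite basis `ā` (indexed by `β`, of rank at least `2`), and let `X`, `Y` be
finite sets of variables.  Words over the variables `X ∪ Y` with constants `ā` are
elements of the free group on `X ⊕ (Y ⊕ β)`, evaluated in `F` by assigning group
elements to the variables and sending each constant to the corresponding basis element.
Suppose that for every assignment `x̄ : X → F` there is an assignment `ȳ : Y → F`
making every word of the finite set `Sys` trivial and every word of the finite set `Ψ`
nontrivial in `F`.  Then there is a formal solution: a tuple `w̄` of words in the free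
group on `X ⊕ β` (one for each variable in `Y`) such that
(1) substituting `w̄` for `ȳ` makes every word of `Sys` equal to the identity of the free
group on `X ⊕ β`, and
(2) there is an assignment `x̄ : X → F` such that every word of `Ψ`, evaluated at `x̄`
and at the values `w̄(x̄,ā) ∈ F`, is nontrivial in `F`. -/
theorem merzlyakov_with_inequations
    {β X Y : Type*} [Finite β] [Finite X] [Finite Y] (hβ : 2 ≤ Nat.card β)
    (Sys Ψ : Finset (FreeGroup (X ⊕ (Y ⊕ β))))
    (h : ∀ x : X → FreeGroup β, ∃ y : Y → FreeGroup β,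
      (∀ w ∈ Sys, FreeGroup.lift (Sum.elim x (Sum.elim y FreeGroup.of)) w = 1) ∧
        (∀ w ∈ Ψ, FreeGroup.lift (Sum.elim x (Sum.elim y FreeGroup.of)) w ≠ 1)) :
    ∃ w' : Y → FreeGroup (X ⊕ β),
      (∀ w ∈ Sys,
        FreeGroup.lift
          (Sum.elim (fun v : X => FreeGroup.of (Sum.inl v))
            (Sum.elim w' (fun b : β => FreeGroup.of (Sum.inr b)))) w = 1) ∧
      ∃ x : X → FreeGroup β,
        ∀ w ∈ Ψ,
          FreeGroup.lift
            (Sum.elim x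
              (Sum.elim (fun v : Y => FreeGroup.lift (Sum.elim x FreeGroup.of) (w' v))
                FreeGroup.of)) w ≠ 1 := by
  classical
  obtain ⟨a, b, hab⟩ := (Finite.one_lt_card_iff_nontrivial.mp hβ).exists_pair_ne
  obtain ⟨e, he⟩ := Countable.exists_injective_nat X
  let N : X → ℕ → ℕ := fun x j => Nat.pair (e x) j + 2
  have hN : ∀ x y i j, N x i = N y j → x = y ∧ i = j := by
    intro x y i j hxy
    have := Nat.pair_eq_pair.mp (Nat.add_right_cancel hxy)
    exact ⟨he this.1, this.2⟩
  let c : β → FreeGroup (X ⊕ β) := fun b => FreeGroup.of (Sum.inr b)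
  obtain ⟨K, hK⟩ := SyllableMap.exists_coprodMap_lift c a Sys
  let E : FreeGroup β →* CoprodI fun _ : β => Multiplicative ℤ :=
    FreeGroup.lift fun b => SyllableMap.syllable b 1
  let D : (CoprodI fun _ : β => Multiplicative ℤ) →* FreeGroup β :=
    CoprodI.lift fun b => zpowersHom (FreeGroup β) (FreeGroup.of b)
  have hDE : ∀ g, D (E g) = g := by
    intro g
    have : D.comp E = MonoidHom.id _ := by
      ext b
      simp [D, E]
    exact DFunLike.congr_fun this g
  let x : X → FreeGroup β := fun v =>
    ((List.range (K + 1)).map fun j => FreeGroup.of a ^ N v j * FreeGroup.of b).prod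
  obtain ⟨y, hSys, hΨ⟩ := h x
  obtain ⟨B, hBK, hB⟩ := hK fun z => E (Sum.elim x (Sum.elim y FreeGroup.of) z)
  obtain ⟨ψ, hψB, hψN, hψu, hψρ⟩ := SyllableMap.exists_powers_perturbation
    (H := FreeGroup β) (c a) (c b) (fun v : X => FreeGroup.of (Sum.inl v)) N hN K B hBK
  have hψ0 : ψ 0 = 1 := by
    rw [hψN 0 fun v j => by simp [N], pow_zero]
  have hψ1 : ψ 1 = c a := by
    rw [hψN 1 fun v j => by simp [N], pow_one]
  let T : FreeGroup β → FreeGroup (X ⊕ β) := fun g =>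
    SyllableMap.coprodMap (SyllableMap.powerMap c a ψ) (E g)
  have hTof : ∀ d, T (FreeGroup.of d) = c d := by
    intro d
    simp only [T, E, FreeGroup.lift_apply_of]
    rw [SyllableMap.coprodMap_of _ (SyllableMap.powerMap_one hψ0),
      SyllableMap.powerMap_eq_zpow (by simpa using hψ1)]
    simp
  have hTx : ∀ v, T (x v) = FreeGroup.of (Sum.inl v) := by
    intro v
    have hE : E (x v) = (((List.range (K + 1)).map (N v)).map fun k : ℕ =>
        SyllableMap.syllable a k * SyllableMap.syllable b 1).prod := by
      simp only [x, E, map_list_prod, List.map_map, Function.comp_def, map_mul, map_pow,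
        FreeGroup.lift_apply_of, SyllableMap.syllable]
      simp only [← map_pow, ← ofAdd_nsmul, nsmul_eq_mul, mul_one]
    simp only [T, hE]
    rw [SyllableMap.coprodMap_powerMap_list_prod hψ0 hab.symm _ (by simp [N]), List.map_map]
    exact hψu v
  let ρ : FreeGroup (X ⊕ β) →* FreeGroup β := FreeGroup.lift (Sum.elim x FreeGroup.of)
  have hρT : ∀ g, ρ (T g) = g := by
    intro g
    refine (SyllableMap.map_coprodMap ρ D _ (fun d m => ?_) (E g)).trans (hDE g)
    rw [SyllableMap.map_powerMap, SyllableMap.powerMap_eq_zpow]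
    · simp [D, ρ, c]
    · exact hψρ ρ (fun v => by simp [ρ, c, x]) _
  have hsub : (fun z => T (Sum.elim x (Sum.elim y FreeGroup.of) z)) =
      Sum.elim (fun v : X => FreeGroup.of (Sum.inl v)) (Sum.elim (fun v => T (y v)) c) := by
    funext z
    rcases z with v | v | d
    · exact hTx v
    · rfl
    · exact hTof d
  refine ⟨fun v => T (y v), fun w hw => ?_, x, fun w hw => ?_⟩
  · have h1 := hB ψ hψ0 hψB w hw
    have h2 : FreeGroup.lift (fun z => E (Sum.elim x (Sum.elim y FreeGroup.of) z)) w =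
        E (FreeGroup.lift (Sum.elim x (Sum.elim y FreeGroup.of)) w) := by
      have : FreeGroup.lift (fun z => E (Sum.elim x (Sum.elim y FreeGroup.of) z)) =
          E.comp (FreeGroup.lift (Sum.elim x (Sum.elim y FreeGroup.of))) := by
        ext z
        simp
      rw [this, MonoidHom.comp_apply]
    rw [h2, hSys w hw, map_one, SyllableMap.coprodMap_one] at h1
    rw [← h1, ← hsub]
  · have hy : (fun v => FreeGroup.lift (Sum.elim x FreeGroup.of) (T (y v))) = y :=
      funext fun v => hρT (y v)
    rw [hy]
    exact hΨ w hw
end
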